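/- arXiv:2108.07560 — 8 statements merged into one kernel-verified Lean document; each statement's English description precedes it below -/
import Mathlib

section
/- Let n be an odd positive integer, let P be a finite set, let ε : P → ℤ with ε(p) ∈ {1, -1} for all p, and let w : P → Fin n → ℕ with w(p)(i) ≥ 1 for all p and i. If the rational function ∑_{p ∈ P} ε(p) · ∏_{i=1}^{n} f_{w(p)(i)} in RatFunc ℚ is constant, then ∑_{p ∈ P} ε(p) = 0; equivalently, the number of p ∈ P with ε(p) = 1 equals the number of p ∈ P with ε(p) = -1, and in particular the cardinality of P is even. (This is the combinatorial content of Proposition 2.3 and Corollary 2.7: for a circle action on a compact oriented manifold of dimension 2n with n odd and a discrete fixed point set, the signature vanishes, the fixed points with sign +1 and -1 are equinumerous, and the number of fixed points is even.) -/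
/-- The rational function `(1 + X^w)/(1 - X^w)` in `RatFunc ℚ`. -/
noncomputable def f (w : ℕ) : RatFunc ℚ :=
  (1 + RatFunc.X ^ w) / (1 - RatFunc.X ^ w)

open Polynomial in
/-- `x` is regular at `a` with value `v`. -/
def GoodAt (a : ℚ) (x : RatFunc ℚ) (v : ℚ) : Prop :=
  ∃ p q : ℚ[X], q.eval a ≠ 0 ∧
    x * algebraMap ℚ[X] (RatFunc ℚ) q = algebraMap ℚ[X] (RatFunc ℚ) p ∧
    p.eval a = v * q.eval a

theorem GoodAt.add {a : ℚ} {x y : RatFunc ℚ} {u v : ℚ} (hx : GoodAt a x u) (hy : GoodAt a y v) :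
    GoodAt a (x + y) (u + v) := by
  obtain ⟨p, q, h1, h2, h3⟩ := hx
  obtain ⟨p', q', h1', h2', h3'⟩ := hy
  refine ⟨p * q' + p' * q, q * q', ?_, ?_, ?_⟩
  · simpa using ⟨h1, h1'⟩
  · simp only [map_mul, map_add, ← h2, ← h2']; ring
  · simp only [Polynomial.eval_mul, Polynomial.eval_add, h3, h3']; ring

theorem GoodAt.mul {a : ℚ} {x y : RatFunc ℚ} {u v : ℚ} (hx : GoodAt a x u) (hy : GoodAt a y v) :
    GoodAt a (x * y) (u * v) := by
  obtain ⟨p, q, h1, h2, h3⟩ := hx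
  obtain ⟨p', q', h1', h2', h3'⟩ := hy
  refine ⟨p * p', q * q', ?_, ?_, ?_⟩
  · simpa using ⟨h1, h1'⟩
  · simp only [map_mul, ← h2, ← h2']; ring
  · simp only [Polynomial.eval_mul, h3, h3']; ring

theorem GoodAt.const (a r : ℚ) : GoodAt a (RatFunc.C r) r :=
  ⟨Polynomial.C r, 1, by simp, by simp, by simp⟩

theorem GoodAt.sum {a : ℚ} {ι : Type} (s : Finset ι) (x : ι → RatFunc ℚ) (v : ι → ℚ)
    (h : ∀ i, GoodAt a (x i) (v i)) : GoodAt a (∑ i ∈ s, x i) (∑ i ∈ s, v i) := by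
  classical
  induction s using Finset.induction_on with
  | empty => simpa using GoodAt.const a 0
  | insert i s hi ih => rw [Finset.sum_insert hi, Finset.sum_insert hi]; exact (h i).add ih

theorem GoodAt.prod {a : ℚ} {ι : Type} (s : Finset ι) (x : ι → RatFunc ℚ) (v : ι → ℚ)
    (h : ∀ i, GoodAt a (x i) (v i)) : GoodAt a (∏ i ∈ s, x i) (∏ i ∈ s, v i) := by
  classical
  induction s using Finset.induction_on with
  | empty => simpa using GoodAt.const a 1
  | insert i s hi ih => rw [Finset.prod_insert hi, Finset.prod_insert hi]; exact (h i).mul ih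

theorem GoodAt.eq_const {a r v : ℚ} (h : GoodAt a (RatFunc.C r) v) : v = r := by
  obtain ⟨p, q, h1, h2, h3⟩ := h
  have : Polynomial.C r * q = p := by
    apply RatFunc.algebraMap_injective ℚ
    rw [map_mul, RatFunc.algebraMap_C, h2]
  rw [← this] at h3
  simp only [Polynomial.eval_mul, Polynomial.eval_C] at h3
  exact (mul_right_cancel₀ h1 h3).symm

theorem goodAt_f (a : ℚ) (w : ℕ) (h : 1 - a ^ w ≠ 0) :
    GoodAt a (f w) ((1 + a ^ w) / (1 - a ^ w)) := by
  refine ⟨1 + Polynomial.X ^ w, 1 - Polynomial.X ^ w, by simpa using h, ?_, ?_⟩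
  · have hne : algebraMap (Polynomial ℚ) (RatFunc ℚ) (1 - Polynomial.X ^ w) ≠ 0 := by
      intro h0
      rw [map_eq_zero_iff _ (RatFunc.algebraMap_injective ℚ)] at h0
      apply h
      simpa using congrArg (Polynomial.eval a) h0
    have e : f w = algebraMap (Polynomial ℚ) (RatFunc ℚ) (1 + Polynomial.X ^ w) /
        algebraMap (Polynomial ℚ) (RatFunc ℚ) (1 - Polynomial.X ^ w) := by
      simp [f]
    rw [e, div_mul_cancel₀ _ hne]
  · simp [div_mul_cancel₀ _ h]

theorem stmt0 (n : ℕ) (hodd : Odd n) (hpos : 0 < n)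
    (P : Type) [Fintype P] (ε : P → ℤ) (hε : ∀ p, ε p = 1 ∨ ε p = -1)
    (w : P → Fin n → ℕ) (hw : ∀ p i, 1 ≤ w p i)
    (hconst : ∃ r : ℚ,
      ∑ p : P, (ε p : RatFunc ℚ) * ∏ i : Fin n, f (w p i) = RatFunc.C r) :
    ∑ p : P, ε p = 0 ∧
    (Finset.univ.filter fun p => ε p = 1).card
      = (Finset.univ.filter fun p => ε p = -1).card ∧
    Even (Fintype.card P) := by
  obtain ⟨r, hr⟩ := hconst
  have key : ∀ a : ℚ, (∀ p i, 1 - a ^ w p i ≠ 0) →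
      ∑ p : P, (ε p : ℚ) * ∏ i : Fin n, ((1 + a ^ w p i) / (1 - a ^ w p i)) = r := by
    intro a ha
    apply GoodAt.eq_const (a := a)
    rw [← hr]
    refine GoodAt.sum _ _ _ fun p => GoodAt.mul ?_ (GoodAt.prod _ _ _ fun i => goodAt_f a _ (ha p i))
    simpa using GoodAt.const a (ε p : ℚ)
  have hw0 : ∀ p i, w p i ≠ 0 := fun p i => by have := hw p i; omega
  have k0 := key 0 (fun p i => by simp [hw0 p i])
  have h2 : ∀ p i, (1:ℚ) < 2 ^ w p i := fun p i => one_lt_pow₀ (by norm_num) (hw0 p i)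
  have k2 := key 2 (fun p i => by have := h2 p i; intro h; linarith)
  have k3 := key (1/2) (fun p i => by
    have : ((1:ℚ)/2) ^ w p i < 1 := pow_lt_one₀ (by norm_num) (by norm_num) (hw0 p i)
    intro h; linarith)
  have hf : ∀ p i, (1 + ((1:ℚ)/2) ^ w p i) / (1 - (1/2) ^ w p i)
      = - ((1 + 2 ^ w p i) / (1 - 2 ^ w p i)) := by
    intro p i
    have := h2 p i
    rw [one_div, inv_pow]
    generalize (2:ℚ) ^ w p i = t at *
    have h1 : t ≠ 0 := by intro h; linarith
    have h3 : 1 - t ≠ 0 := by intro h; linarith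
    have h4 : t - 1 ≠ 0 := by intro h; linarith
    have h5 : 1 - t⁻¹ ≠ 0 := by
      intro h; apply h4; field_simp at h; simpa using h
    rw [← neg_div, div_eq_div_iff h5 h3]
    field_simp
    ring
  simp only [hf, Finset.prod_neg, Finset.card_univ, Fintype.card_fin, hodd.neg_one_pow] at k3
  simp only [neg_mul, one_mul, mul_neg, Finset.sum_neg_distrib] at k3
  have r0 : r = 0 := by linarith
  have hs : ∑ p : P, ε p = 0 := by
    rw [r0] at k0
    simp [hw0] at k0
    exact_mod_cast k0
  have hcard : (Finset.univ.filter fun p => ε p = 1).card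
      = (Finset.univ.filter fun p => ε p = -1).card := by
    have e : ∀ p, ε p = (if ε p = 1 then 1 else 0) - (if ε p = -1 then 1 else 0) := by
      intro p; rcases hε p with h | h <;> simp [h]
    rw [Finset.sum_congr rfl (fun p _ => e p), Finset.sum_sub_distrib,
      Finset.sum_boole, Finset.sum_boole] at hs
    exact_mod_cast sub_eq_zero.mp hs
  refine ⟨hs, hcard, ?_⟩
  have hn : (Finset.univ.filter fun p => ε p = -1) = Finset.univ.filter fun p => ¬ ε p = 1 := by
    apply Finset.filter_congr
    intro p _
    rcases hε p with h | h <;> simp [h]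
  have := Finset.card_filter_add_card_filter_not (s := (Finset.univ : Finset P)) (fun p => ε p = 1)
  rw [← hn, ← hcard, Finset.card_univ] at this
  exact ⟨_, this.symm⟩
end

section
/- Let n be a positive integer, let P be a nonempty finite set, let ε : P → ℤ with ε(p) ∈ {1, -1} for all p, and let w : P → Fin n → ℕ with w(p)(i) ≥ 1 for all p and i. Let a := min { w(p)(i) : p ∈ P, i ∈ Fin n } be the smallest weight. If the rational function ∑_{p ∈ P} ε(p) · ∏_{i=1}^{n} f_{w(p)(i)} in RatFunc ℚ is constant, then ∑_{p : ε(p)=1} N_p(a) = ∑_{p : ε(p)=-1} N_p(a), where N_p(a) = |{ i : w(p)(i) = a }| is the number of indices i with w(p)(i) = a. (This is the combinatorial content of Lemma 2.4: for a circle action on a compact oriented 2n-manifold with a discrete fixed point set, the total multiplicity of the smallest weight a among fixed points of sign +1 equals the total multiplicity of a among fixed points of sign -1.) -/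
open scoped RatFunc in
/-- The embedding of rational functions into Laurent series. -/
noncomputable def phiL : RatFunc ℚ →+* LaurentSeries ℚ :=
  algebraMap (RatFunc ℚ) (LaurentSeries ℚ)

open scoped RatFunc in
theorem phiL_X : phiL RatFunc.X = HahnSeries.ofPowerSeries ℤ ℚ PowerSeries.X := by
  rw [HahnSeries.ofPowerSeries_X]
  exact RatFunc.coe_X

open PowerSeries in
theorem aux_pow (a w : ℕ) (ha : 1 ≤ a) (hw : a ≤ w) :
    ∃ h : PowerSeries ℚ, phiL (f w) =
      HahnSeries.ofPowerSeries ℤ ℚ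
        (1 + X ^ a * (((2 * (if w = a then 1 else 0) : ℕ) : PowerSeries ℚ) + X * h)) := by
  have hX : phiL RatFunc.X
      = HahnSeries.ofPowerSeries ℤ ℚ X := phiL_X
  have hc : constantCoeff (1 - X ^ w : PowerSeries ℚ) ≠ 0 := by
    have : w ≠ 0 := by omega
    simp [this]
  have hu := PowerSeries.mul_inv_cancel (1 - X ^ w : PowerSeries ℚ) hc
  set u := (1 - X ^ w : PowerSeries ℚ)⁻¹
  have hne : (1 - X ^ w : PowerSeries ℚ) ≠ 0 := by
    intro h0; rw [h0] at hc; simp at hc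
  have hne' : HahnSeries.ofPowerSeries ℤ ℚ (1 - X ^ w) ≠ 0 := by
    intro h0
    exact hne (HahnSeries.ofPowerSeries_injective (h0.trans (map_zero _).symm))
  have key : ∀ g : PowerSeries ℚ, g * (1 - X ^ w) = 1 + X ^ w →
      phiL (f w) = HahnSeries.ofPowerSeries ℤ ℚ g := by
    intro g hg
    have e1 : phiL (f w)
        = HahnSeries.ofPowerSeries ℤ ℚ (1 + X ^ w) / HahnSeries.ofPowerSeries ℤ ℚ (1 - X ^ w) := by
      rw [f, map_div₀, map_add, map_sub, map_pow, hX, map_add, map_sub, map_pow, map_one, map_one]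
    rw [e1, div_eq_iff hne', ← map_mul, hg]
  rcases eq_or_lt_of_le hw with h | h
  · subst h
    obtain ⟨b, rfl⟩ : ∃ b, a = b + 1 := ⟨a - 1, by omega⟩
    refine ⟨2 * X ^ b * u, key _ ?_⟩
    simp only [if_true]
    push_cast
    linear_combination (2 * X ^ (2 * (b + 1))) * hu
  · obtain ⟨b, rfl⟩ : ∃ b, w = a + 1 + b := ⟨w - a - 1, by omega⟩
    refine ⟨2 * X ^ b * u, key _ ?_⟩
    rw [if_neg (by omega)]
    push_cast
    linear_combination (2 * X ^ (a + 1 + b)) * hu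

open PowerSeries in
theorem aux_prod {n : ℕ} (a : ℕ) (ha : 1 ≤ a) (w : Fin n → ℕ) (hw : ∀ i, a ≤ w i)
    (s : Finset (Fin n)) :
    ∃ h : PowerSeries ℚ, phiL (∏ i ∈ s, f (w i)) =
      HahnSeries.ofPowerSeries ℤ ℚ
        (1 + X ^ a * (((2 * (s.filter fun i => w i = a).card : ℕ) : PowerSeries ℚ) + X * h)) := by
  classical
  induction s using Finset.induction_on with
  | empty => exact ⟨0, by simp⟩
  | insert i s hi ih =>
    obtain ⟨h, hh⟩ := ih
    obtain ⟨g, hg⟩ := aux_pow a (w i) ha (hw i)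
    obtain ⟨b, rfl⟩ : ∃ b, a = b + 1 := ⟨a - 1, by omega⟩
    rw [Finset.prod_insert hi, map_mul, hh, hg, ← map_mul]
    have hcard : ((insert i s).filter fun i => w i = b + 1).card
        = (if w i = b + 1 then 1 else 0) + (s.filter fun i => w i = b + 1).card := by
      rw [Finset.card_filter, Finset.sum_insert hi, Finset.card_filter]
    rw [hcard]
    generalize (if w i = b + 1 then 1 else 0) = c
    generalize (s.filter fun i => w i = b + 1).card = d
    refine ⟨g + h + X ^ b * (((2 * c : ℕ) : PowerSeries ℚ) + X * g)
      * (((2 * d : ℕ) : PowerSeries ℚ) + X * h), congrArg _ ?_⟩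
    push_cast
    ring

/-- Combinatorial content of Lemma 2.4: if the Atiyah–Singer signature sum is constant,
then the total multiplicity of the smallest weight `a` among fixed points of sign `+1`
equals the total multiplicity of `a` among fixed points of sign `-1`. -/
theorem stmt1 (n : ℕ) (hn : 0 < n) (P : Type) [Fintype P] [Nonempty P]
    (ε : P → ℤ) (hε : ∀ p, ε p = 1 ∨ ε p = -1)
    (w : P → Fin n → ℕ) (hw : ∀ p i, 1 ≤ w p i)
    (a : ℕ) (hle : ∀ p i, a ≤ w p i) (hmem : ∃ p i, w p i = a)
    (hconst : ∃ r : ℚ,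
      ∑ p : P, (ε p : RatFunc ℚ) * ∏ i : Fin n, f (w p i) = RatFunc.C r) :
    ∑ p ∈ Finset.univ.filter (fun p => ε p = 1),
        (Finset.univ.filter fun i => w p i = a).card
      = ∑ p ∈ Finset.univ.filter (fun p => ε p = -1),
          (Finset.univ.filter fun i => w p i = a).card := by
  classical
  obtain ⟨r, hr⟩ := hconst
  obtain ⟨p0, i0, h0⟩ := hmem
  have ha : 1 ≤ a := h0 ▸ hw p0 i0
  choose h hh using fun p => aux_prod a ha (w p) (hle p) Finset.univ
  have e := congrArg phiL hr
  have hC : phiL (RatFunc.C r)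
      = HahnSeries.ofPowerSeries ℤ ℚ (PowerSeries.C r) := by
    exact RingHom.congr_fun (Subsingleton.elim (phiL.comp RatFunc.C)
      ((HahnSeries.ofPowerSeries ℤ ℚ).comp (PowerSeries.C (R := ℚ)))) r
  rw [hC, map_sum] at e
  simp only [map_mul, map_intCast, hh] at e
  have e2 : ∑ p : P, ((ε p : ℤ) : PowerSeries ℚ) * (1 + PowerSeries.X ^ a *
      (((2 * (Finset.univ.filter fun i => w p i = a).card : ℕ) : PowerSeries ℚ)
        + PowerSeries.X * h p)) = PowerSeries.C r := by
    apply HahnSeries.ofPowerSeries_injective (Γ := ℤ)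
    rw [← e, map_sum]
    simp only [map_mul, map_intCast]
  have e3 := congrArg (PowerSeries.coeff (R := ℚ) a) e2
  have hterm : ∀ p, PowerSeries.coeff (R := ℚ) a (((ε p : ℤ) : PowerSeries ℚ) *
      (1 + PowerSeries.X ^ a *
      (((2 * (Finset.univ.filter fun i => w p i = a).card : ℕ) : PowerSeries ℚ)
        + PowerSeries.X * h p)))
      = (ε p : ℚ) * (2 * ((Finset.univ.filter fun i => w p i = a).card : ℚ)) := by
    intro p
    generalize (Finset.univ.filter fun i => w p i = a).card = d
    rw [← map_intCast (PowerSeries.C (R := ℚ)), ← map_natCast (PowerSeries.C (R := ℚ)),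
      PowerSeries.coeff_C_mul, map_add, PowerSeries.coeff_X_pow_mul']
    have : a ≠ 0 := by omega
    simp [PowerSeries.coeff_one, this]
  rw [map_sum, Finset.sum_congr rfl (fun p _ => hterm p), PowerSeries.coeff_C,
    if_neg (by omega)] at e3
  have e4 : ∑ p : P, ε p * ((Finset.univ.filter fun i => w p i = a).card : ℤ) = 0 := by
    have : (∑ p : P, (ε p : ℚ) * ((Finset.univ.filter fun i => w p i = a).card : ℚ)) = 0 := by
      have e5 : 2 * (∑ p : P, (ε p : ℚ) * ((Finset.univ.filter fun i => w p i = a).card : ℚ))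
          = 0 := by
        rw [← e3, Finset.mul_sum]
        exact Finset.sum_congr rfl fun p _ => by ring
      linarith
    exact_mod_cast this
  have e6 : ∑ p : P, ε p * ((Finset.univ.filter fun i => w p i = a).card : ℤ)
      = ∑ p ∈ Finset.univ.filter (fun p => ε p = 1),
          ((Finset.univ.filter fun i => w p i = a).card : ℤ)
        - ∑ p ∈ Finset.univ.filter (fun p => ε p = -1),
          ((Finset.univ.filter fun i => w p i = a).card : ℤ) := by
    rw [Finset.sum_filter, Finset.sum_filter, ← Finset.sum_sub_distrib]
    refine Finset.sum_congr rfl fun p _ => ?_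
    rcases hε p with h1 | h1 <;> simp [h1]
  rw [e6] at e4
  have e7 := sub_eq_zero.mp e4
  exact_mod_cast e7
end

section
/- Let n be a positive integer, let ε_p, ε_q ∈ {1, -1}, and let u, v : Fin n → ℕ with u(i) ≥ 1 and v(i) ≥ 1 for all i. If the rational function ε_p · ∏_{i=1}^{n} f_{u(i)} + ε_q · ∏_{i=1}^{n} f_{v(i)} in RatFunc ℚ is constant, then the multiset {u(1),…,u(n)} equals the multiset {v(1),…,v(n)} and ε_p = -ε_q. (This is the combinatorial content of Theorem 2.8 (Kosniowski): for a circle action on a compact oriented manifold with exactly two fixed points p and q, the weights at p and q are equal as multisets and ε(p) = -ε(q).) -/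
open Polynomial in
theorem aux_mem (M : ℕ) (hM : 1 ≤ M) (s t : Multiset ℕ)
    (hs : ∀ w ∈ s, 1 ≤ w ∧ w ≤ M) (ht : ∀ w ∈ t, 1 ≤ w ∧ w ≤ M)
    (h : (s.map (fun w => (1 + X ^ w : ℚ[X]))).prod * (t.map (fun w => (1 - X ^ w : ℚ[X]))).prod
      = (t.map (fun w => (1 + X ^ w : ℚ[X]))).prod * (s.map (fun w => (1 - X ^ w : ℚ[X]))).prod)
    (hMs : M ∈ s) : M ∈ t := by
  have hprim := Complex.isPrimitiveRoot_exp (2 * M) (by omega)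
  set z := Complex.exp (2 * Real.pi * Complex.I / ((2 * M : ℕ) : ℂ)) with hz
  have hzM : z ^ M = -1 := by
    have h1 : (z ^ M) ^ 2 = 1 := by
      rw [← pow_mul, mul_comm]; exact hprim.pow_eq_one
    rcases ((by simpa using h1) : z ^ M = 1 ∨ z ^ M = -1) with h | h
    · have := Nat.le_of_dvd (by omega) (hprim.dvd_of_pow_eq_one M h)
      omega
    · exact h
  have hdvd : ∀ w, 1 ≤ w → w ≤ M → (z ^ w) ^ 2 = 1 → w = M := by
    intro w h1 h2 h3
    rw [← pow_mul] at h3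
    have := Nat.le_of_dvd (by omega) (hprim.dvd_of_pow_eq_one _ h3)
    omega
  have hB : ∀ s : Multiset ℕ, (∀ w ∈ s, 1 ≤ w ∧ w ≤ M) →
      aeval z (s.map (fun w => (1 - X ^ w : ℚ[X]))).prod ≠ 0 := by
    intro s hs h0
    rw [map_multiset_prod, Multiset.prod_eq_zero_iff, Multiset.map_map, Multiset.mem_map] at h0
    obtain ⟨w, hw, h0⟩ := h0
    simp only [Function.comp, map_sub, map_one, map_pow, aeval_X] at h0
    have h4 : z ^ w = 1 := (sub_eq_zero.mp h0).symm
    have := hdvd w (hs w hw).1 (hs w hw).2 (by rw [h4]; norm_num)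
    rw [this, hzM] at h4
    norm_num at h4
  have h0 := congrArg (aeval z) h
  rw [map_mul, map_mul] at h0
  have hA : aeval z (s.map (fun w => (1 + X ^ w : ℚ[X]))).prod = 0 := by
    rw [map_multiset_prod, Multiset.prod_eq_zero_iff, Multiset.map_map, Multiset.mem_map]
    exact ⟨M, hMs, by simp [hzM]⟩
  rw [hA, zero_mul] at h0
  have h5 := (mul_eq_zero.mp h0.symm).resolve_right (hB s hs)
  rw [map_multiset_prod, Multiset.prod_eq_zero_iff, Multiset.map_map, Multiset.mem_map] at h5
  obtain ⟨w, hw, h5⟩ := h5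
  simp only [Function.comp, map_add, map_one, map_pow, aeval_X] at h5
  have h4 : z ^ w = -1 := by linear_combination h5
  have := hdvd w (ht w hw).1 (ht w hw).2 (by rw [h4]; norm_num)
  exact this ▸ hw

open Polynomial in
theorem one_sub_ne (w : ℕ) (hw : 1 ≤ w) : (1 - X ^ w : ℚ[X]) ≠ 0 := by
  intro h
  have := congrArg (eval 0) h
  simp [show w ≠ 0 by omega] at this

open Polynomial in
theorem one_add_ne (w : ℕ) (hw : 1 ≤ w) : (1 + X ^ w : ℚ[X]) ≠ 0 := by
  intro h
  have := congrArg (eval 0) h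
  simp [show w ≠ 0 by omega] at this

open Polynomial in
theorem aux_eq (k : ℕ) : ∀ s t : Multiset ℕ, s.card + t.card ≤ k →
    (∀ w ∈ s, 1 ≤ w) → (∀ w ∈ t, 1 ≤ w) →
    (s.map (fun w => (1 + X ^ w : ℚ[X]))).prod * (t.map (fun w => (1 - X ^ w : ℚ[X]))).prod
      = (t.map (fun w => (1 + X ^ w : ℚ[X]))).prod * (s.map (fun w => (1 - X ^ w : ℚ[X]))).prod →
    s = t := by
  induction k with
  | zero =>
    intro s t h _ _ _
    rw [Multiset.card_eq_zero.mp (by omega : s.card = 0),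
      Multiset.card_eq_zero.mp (by omega : t.card = 0)]
  | succ k ih =>
    intro s t hc hs ht h
    by_cases he : s + t = 0
    · have h1 := congrArg Multiset.card he
      simp only [Multiset.card_add, Multiset.card_zero] at h1
      rw [Multiset.card_eq_zero.mp (by omega : s.card = 0),
        Multiset.card_eq_zero.mp (by omega : t.card = 0)]
    · have hne : (s + t).toFinset.Nonempty := by
        rw [Multiset.toFinset_nonempty]; exact he
      obtain ⟨M, hM, hmax⟩ := Finset.exists_max_image _ id hne
      simp only [Multiset.mem_toFinset, Multiset.mem_add, id] at hM hmax
      have hs' : ∀ w ∈ s, 1 ≤ w ∧ w ≤ M := fun w hw => ⟨hs w hw, hmax w (Or.inl hw)⟩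
      have ht' : ∀ w ∈ t, 1 ≤ w ∧ w ≤ M := fun w hw => ⟨ht w hw, hmax w (Or.inr hw)⟩
      have hM1 : 1 ≤ M := hM.elim (hs M) (ht M)
      have hboth : M ∈ s ∧ M ∈ t := by
        rcases hM with hM | hM
        · exact ⟨hM, aux_mem M hM1 s t hs' ht' h hM⟩
        · exact ⟨aux_mem M hM1 t s ht' hs' h.symm hM, hM⟩
      obtain ⟨s', rfl⟩ := Multiset.exists_cons_of_mem hboth.1
      obtain ⟨t', rfl⟩ := Multiset.exists_cons_of_mem hboth.2
      congr 1
      simp only [Multiset.card_cons] at hc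
      apply ih s' t' (by omega) (fun w hw => hs w (Multiset.mem_cons_of_mem hw))
        (fun w hw => ht w (Multiset.mem_cons_of_mem hw))
      simp only [Multiset.map_cons, Multiset.prod_cons] at h
      apply mul_left_cancel₀ (mul_ne_zero (one_add_ne M hM1) (one_sub_ne M hM1))
      linear_combination h

open Polynomial in
theorem prod_f (n : ℕ) (u : Fin n → ℕ) :
    ∏ i, f (u i) = algebraMap ℚ[X] (RatFunc ℚ) (∏ i, (1 + X ^ u i)) /
      algebraMap ℚ[X] (RatFunc ℚ) (∏ i, (1 - X ^ u i)) := by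
  simp [f, map_prod, Finset.prod_div_distrib]

open Polynomial in
theorem poly_id (n : ℕ) (a b : ℤ) (u v : Fin n → ℕ) (hu : ∀ i, 1 ≤ u i) (hv : ∀ i, 1 ≤ v i)
    (r : ℚ) (h : (a : RatFunc ℚ) * ∏ i : Fin n, f (u i)
        + (b : RatFunc ℚ) * ∏ i : Fin n, f (v i) = RatFunc.C r) :
    (a : ℚ[X]) * (∏ i, (1 + X ^ u i)) * (∏ i, (1 - X ^ v i))
      + (b : ℚ[X]) * (∏ i, (1 + X ^ v i)) * (∏ i, (1 - X ^ u i))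
      = C r * (∏ i, (1 - X ^ u i)) * (∏ i, (1 - X ^ v i)) := by
  apply RatFunc.algebraMap_injective ℚ
  rw [prod_f, prod_f, ← RatFunc.algebraMap_C] at h
  have h1 : algebraMap ℚ[X] (RatFunc ℚ) (∏ i, (1 - X ^ u i)) ≠ 0 :=
    RatFunc.algebraMap_ne_zero (Finset.prod_ne_zero_iff.mpr fun i _ => one_sub_ne _ (hu i))
  have h2 : algebraMap ℚ[X] (RatFunc ℚ) (∏ i, (1 - X ^ v i)) ≠ 0 :=
    RatFunc.algebraMap_ne_zero (Finset.prod_ne_zero_iff.mpr fun i _ => one_sub_ne _ (hv i))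
  simp only [map_add, map_mul, map_intCast]
  rw [← h]
  field_simp

open Polynomial in
theorem same_sign (n : ℕ) (hn : 0 < n) (u v : Fin n → ℕ) (hu : ∀ i, 1 ≤ u i) (hv : ∀ i, 1 ≤ v i)
    (h : (∏ i, (1 + X ^ u i)) * (∏ i, (1 - X ^ v i))
      + (∏ i, (1 + X ^ v i)) * (∏ i, (1 - X ^ u i))
      = 2 * (∏ i, (1 - X ^ u i)) * (∏ i, (1 - X ^ v i) : ℚ[X])) : False := by
  have h0 := congrArg (eval (1/2)) h
  simp only [eval_add, eval_mul, eval_prod, eval_sub, eval_one, eval_pow, eval_X,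
    eval_ofNat] at h0
  have key : ∀ w : Fin n → ℕ, (∀ i, 1 ≤ w i) → 0 < ∏ i, (1 - (1/2 : ℚ) ^ w i) ∧
      ∏ i, (1 - (1/2 : ℚ) ^ w i) < ∏ i, (1 + (1/2 : ℚ) ^ w i) := by
    intro w hw
    have hp : ∀ i, 0 < 1 - (1/2 : ℚ) ^ w i := fun i =>
      sub_pos.mpr (pow_lt_one₀ (by norm_num) (by norm_num) (by have := hw i; omega))
    have hq : ∀ i, 0 < (1/2 : ℚ) ^ w i := fun i => by positivity
    refine ⟨Finset.prod_pos fun i _ => hp i, Finset.prod_lt_prod_of_nonempty (fun i _ => hp i)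
      (fun i _ => ?_) ⟨⟨0, hn⟩, Finset.mem_univ _⟩⟩
    linarith [hq i]
  obtain ⟨a, b⟩ := key u hu
  obtain ⟨c, d⟩ := key v hv
  nlinarith [mul_lt_mul_of_pos_right b c, mul_lt_mul_of_pos_right d a]

/-- Combinatorial content of Theorem 2.8 (Kosniowski): for a circle action on a compact
oriented manifold with exactly two fixed points `p` and `q`, the weights at `p` and `q`
agree as multisets and `ε(p) = -ε(q)`. -/
theorem stmt2 (n : ℕ) (hn : 0 < n) (εp εq : ℤ)
    (hεp : εp = 1 ∨ εp = -1) (hεq : εq = 1 ∨ εq = -1)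
    (u v : Fin n → ℕ) (hu : ∀ i, 1 ≤ u i) (hv : ∀ i, 1 ≤ v i)
    (hconst : ∃ r : ℚ,
      (εp : RatFunc ℚ) * ∏ i : Fin n, f (u i)
        + (εq : RatFunc ℚ) * ∏ i : Fin n, f (v i) = RatFunc.C r) :
    Multiset.map u Finset.univ.val = Multiset.map v Finset.univ.val ∧ εp = -εq := by
  obtain ⟨r, hr⟩ := hconst
  have h := poly_id n εp εq u v hu hv r hr
  have hr0 : (εp : ℚ) + εq = r := by
    have h0 := congrArg (Polynomial.eval 0) h
    have hu' : ∀ i, u i ≠ 0 := fun i => by have := hu i; omega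
    have hv' : ∀ i, v i ≠ 0 := fun i => by have := hv i; omega
    simpa [Polynomial.eval_prod, hu', hv'] using h0
  have opp : (∏ i, (1 + Polynomial.X ^ u i : Polynomial ℚ)) * ∏ i, (1 - Polynomial.X ^ v i)
      = (∏ i, (1 + Polynomial.X ^ v i)) * ∏ i, (1 - Polynomial.X ^ u i) →
      Multiset.map u Finset.univ.val = Multiset.map v Finset.univ.val := by
    intro h
    apply aux_eq _ _ _ le_rfl
    · simpa using hu
    · simpa using hv
    · simp only [Multiset.map_map]; exact h
  subst hr0
  rcases hεp with rfl | rfl <;> rcases hεq with rfl | rfl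
  · exfalso
    apply same_sign n hn u v hu hv
    simp at h
    linear_combination h
  · refine ⟨opp ?_, by norm_num⟩
    simp at h
    linear_combination h
  · refine ⟨opp ?_, by norm_num⟩
    simp at h
    linear_combination -h
  · exfalso
    apply same_sign n hn u v hu hv
    simp at h
    linear_combination -h
end

section
/- Let n be a positive integer, let a_1, …, a_n be positive integers, let P be a finite set, and let ε : P → ℤ with ε(p) ∈ {1, -1} for all p. If the rational function (∑_{p ∈ P} ε(p)) · ∏_{i=1}^{n} f_{a_i} in RatFunc ℚ is constant, then ∑_{p ∈ P} ε(p) = 0 and the constant is 0; equivalently, the number of p with ε(p) = 1 equals the number of p with ε(p) = -1. (This is the combinatorial content of Theorem 2.9: for a circle action on a 2n-dimensional compact oriented manifold with a discrete fixed point set such that the weights at every fixed point are {a_1,…,a_n}, the fixed points with sign +1 and sign -1 are equinumerous, and the signature of the manifold vanishes.) -/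
/-- Combinatorial content of Theorem 2.9: if the weights at every fixed point are
`{a_1, …, a_n}`, so that the signature sum is `(∑ p ε(p)) · ∏ i f_{a i}`, and this is a
constant `r`, then `∑ p ε(p) = 0`, the constant `r` is `0`, and the fixed points with
sign `+1` and sign `-1` are equinumerous. -/
theorem stmt3 (n : ℕ) (hn : 0 < n) (a : Fin n → ℕ) (ha : ∀ i, 1 ≤ a i)
    (P : Type) [Fintype P] (ε : P → ℤ) (hε : ∀ p, ε p = 1 ∨ ε p = -1)
    (r : ℚ)
    (hconst : ((∑ p : P, ε p : ℤ) : RatFunc ℚ) * ∏ i : Fin n, f (a i) = RatFunc.C r) :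
    ∑ p : P, ε p = 0 ∧ r = 0 ∧
    (Finset.univ.filter fun p => ε p = 1).card
      = (Finset.univ.filter fun p => ε p = -1).card := by
  have hne : ∀ w : ℕ, 1 ≤ w → (1 - RatFunc.X ^ w : RatFunc ℚ) ≠ 0 := by
    intro w hw h
    have h1 : algebraMap (Polynomial ℚ) (RatFunc ℚ) (1 - Polynomial.X ^ w)
        = algebraMap (Polynomial ℚ) (RatFunc ℚ) 0 := by
      simpa using h
    have h2 := congrArg (Polynomial.eval 0) (RatFunc.algebraMap_injective ℚ h1)
    have hw0 : w ≠ 0 := by omega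
    simp [hw0] at h2
  have hprod : (∏ i : Fin n, (1 - RatFunc.X ^ (a i) : RatFunc ℚ)) ≠ 0 :=
    Finset.prod_ne_zero_iff.mpr fun i _ => hne _ (ha i)
  have hk : ∑ p : P, ε p = 0 := by
    generalize (∑ p : P, ε p) = k at hconst ⊢
    simp only [f, Finset.prod_div_distrib] at hconst
    rw [← mul_div_assoc, div_eq_iff hprod] at hconst
    have h1 : algebraMap (Polynomial ℚ) (RatFunc ℚ)
          ((k : Polynomial ℚ) * ∏ i : Fin n, (1 + Polynomial.X ^ (a i)))
        = algebraMap (Polynomial ℚ) (RatFunc ℚ)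
          (Polynomial.C r * ∏ i : Fin n, (1 - Polynomial.X ^ (a i))) := by
      simpa [map_prod] using hconst
    have h2 := congrArg (Polynomial.eval 1) (RatFunc.algebraMap_injective ℚ h1)
    have hn0 : n ≠ 0 := by omega
    norm_num [Polynomial.eval_prod, hn0] at h2
    exact h2
  refine ⟨hk, ?_, ?_⟩
  · rw [hk] at hconst
    have h0 : RatFunc.C r = RatFunc.C (0 : ℚ) := by simpa using hconst.symm
    exact RatFunc.C_injective h0
  · have h : ∀ p, ε p = (if ε p = 1 then (1 : ℤ) else 0) - (if ε p = -1 then 1 else 0) := by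
      intro p
      rcases hε p with h | h <;> simp [h]
    rw [Finset.sum_congr rfl fun p _ => h p, Finset.sum_sub_distrib, Finset.sum_boole,
      Finset.sum_boole] at hk
    exact_mod_cast sub_eq_zero.mp hk
end

section
/- Let n be a positive integer and let w_1, …, w_n be positive integers. Then the rational function ∏_{i=1}^{n} f_{w_i} in RatFunc ℚ is not constant, i.e., it does not lie in the range of the constant map C : ℚ → RatFunc ℚ. (This is the key nonconstancy fact underlying the proofs of Theorems 2.8 and 2.9; in particular it implies that a compact oriented S^1-manifold of positive dimension cannot have exactly one fixed point.) -/
/-- The key nonconstancy fact underlying Theorems 2.8 and 2.9: a nonempty product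
`∏ i f_{w i}` of the rational functions `f_w` (with all weights positive) is never a
constant rational function. -/
theorem stmt4 (n : ℕ) (hn : 0 < n) (w : Fin n → ℕ) (hw : ∀ i, 1 ≤ w i) :
    (∏ i : Fin n, f (w i)) ∉ Set.range (RatFunc.C : ℚ →+* RatFunc ℚ) := by
  rintro ⟨c, hc⟩
  have hne : ∀ i, (1 - RatFunc.X ^ (w i) : RatFunc ℚ) ≠ 0 := by
    intro i h
    have h2 : algebraMap (Polynomial ℚ) (RatFunc ℚ) (1 - Polynomial.X ^ (w i)) =
        algebraMap (Polynomial ℚ) (RatFunc ℚ) 0 := by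
      simpa using h
    have h3 := congrArg (Polynomial.eval 0) (RatFunc.algebraMap_injective ℚ h2)
    have h4 : w i ≠ 0 := by have := hw i; omega
    simp [h4] at h3
  simp only [f, Finset.prod_div_distrib] at hc
  rw [eq_div_iff (Finset.prod_ne_zero_iff.mpr fun i _ => hne i)] at hc
  have h2 : algebraMap (Polynomial ℚ) (RatFunc ℚ)
        (Polynomial.C c * ∏ i, (1 - Polynomial.X ^ (w i))) =
      algebraMap (Polynomial ℚ) (RatFunc ℚ) (∏ i, (1 + Polynomial.X ^ (w i))) := by
    simpa [map_prod] using hc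
  have h3 := congrArg (Polynomial.eval 1) (RatFunc.algebraMap_injective ℚ h2)
  have h4 : n ≠ 0 := by omega
  norm_num [Polynomial.eval_prod, h4] at h3
  exact absurd h3.symm (pow_ne_zero n two_ne_zero)
end

section
/- Let a, b, c be integers with 0 < a < b < c, and consider the action of the circle group on the complex projective space ℙ(ℂ⁴) = Projectivization ℂ (Fin 4 → ℂ) induced by g • v := (v 0, g^a·v 1, g^b·v 2, g^c·v 3) on nonzero vectors v ∈ Fin 4 → ℂ (this scaling action descends to projectivization). Then the set of points L ∈ ℙ(ℂ⁴) fixed by every element of the circle group is exactly the four coordinate points { [e₀], [e₁], [e₂], [e₃] }, where eᵢ = Pi.single i 1 is the i-th standard basis vector. (This is the fixed point set computation of Example 3.2.) -/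
/-- The `i`-th standard basis vector of `ℂ⁴` is nonzero. -/
lemma single_ne_zero' (i : Fin 4) : (Pi.single i 1 : Fin 4 → ℂ) ≠ 0 := by
  intro h
  have := congrFun h i
  simp at this

lemma aux_circle (n : ℤ) (hn : n ≠ 0) : ∃ g : Circle, (g : ℂ) ^ n ≠ 1 := by
  refine ⟨Circle.exp (Real.pi / n), ?_⟩
  have hn' : (n : ℂ) ≠ 0 := by exact_mod_cast hn
  rw [Circle.coe_exp, ← Complex.exp_int_mul]
  have : (n : ℂ) * (((Real.pi / n : ℝ) : ℂ) * Complex.I) = Real.pi * Complex.I := by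
    push_cast
    field_simp
  rw [this, Complex.exp_pi_mul_I]
  norm_num

lemma aux_mk (v : Fin 4 → ℂ) (hv : v ≠ 0) (i : Fin 4) (h : ∀ j, j ≠ i → v j = 0) :
    Projectivization.mk ℂ v hv = Projectivization.mk ℂ (Pi.single i 1) (single_ne_zero' i) := by
  rw [Projectivization.mk_eq_mk_iff']
  refine ⟨v i, ?_⟩
  ext j
  by_cases hj : j = i
  · subst hj; simp
  · simp [hj, h j hj]

lemma aux_fixed (w : Fin 4 → ℤ) (i : Fin 4) (g : Circle) (v : Fin 4 → ℂ) (hv : v ≠ 0)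
    (hgv : (fun i => (g : ℂ) ^ (w i) * v i) ≠ 0)
    (h : Projectivization.mk ℂ v hv = Projectivization.mk ℂ (Pi.single i 1) (single_ne_zero' i)) :
    Projectivization.mk ℂ (fun i => (g : ℂ) ^ (w i) * v i) hgv
      = Projectivization.mk ℂ (Pi.single i 1) (single_ne_zero' i) := by
  rw [Projectivization.mk_eq_mk_iff'] at h
  obtain ⟨u, hu⟩ := h
  apply aux_mk
  intro j hj
  simp [← hu, hj]

lemma aux_main (w : Fin 4 → ℤ) (hw : Function.Injective w) (v : Fin 4 → ℂ) (hv : v ≠ 0)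
    (h : ∀ (g : Circle) (hgv : (fun i => (g : ℂ) ^ (w i) * v i) ≠ 0),
      Projectivization.mk ℂ (fun i => (g : ℂ) ^ (w i) * v i) hgv = Projectivization.mk ℂ v hv) :
    ∃ i, Projectivization.mk ℂ v hv
      = Projectivization.mk ℂ (Pi.single i 1) (single_ne_zero' i) := by
  obtain ⟨i, hi⟩ := Function.ne_iff.mp hv
  simp only [Pi.zero_apply] at hi
  refine ⟨i, aux_mk v hv i fun j hj => ?_⟩
  by_contra hvj
  obtain ⟨g, hg⟩ := aux_circle (w j - w i) (sub_ne_zero.mpr fun e => hj (hw e))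
  have hg0 : (g : ℂ) ≠ 0 := g.coe_ne_zero
  have hgv : (fun i => (g : ℂ) ^ (w i) * v i) ≠ 0 := fun e =>
    mul_ne_zero (zpow_ne_zero _ hg0) hi (congrFun e i)
  have := h g hgv
  rw [Projectivization.mk_eq_mk_iff'] at this
  obtain ⟨u, hu⟩ := this
  have h1 : u = (g : ℂ) ^ w i := mul_right_cancel₀ hi (congrFun hu i)
  have h2 : u = (g : ℂ) ^ w j := mul_right_cancel₀ hvj (congrFun hu j)
  apply hg
  rw [zpow_sub₀ hg0, ← h1, ← h2, div_self]
  rw [h1]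
  exact zpow_ne_zero _ hg0

/-- Fixed point set computation of Example 3.2: for the circle action on
`ℙ(ℂ⁴) = Projectivization ℂ (Fin 4 → ℂ)` induced by
`g • v = (v 0, gᵃ·v 1, gᵇ·v 2, g^c·v 3)` with `0 < a < b < c`, the fixed points are
exactly the four coordinate points `[e₀], [e₁], [e₂], [e₃]`. -/
theorem stmt13 (a b c : ℤ) (ha : 0 < a) (hab : a < b) (hbc : b < c) :
    {L : Projectivization ℂ (Fin 4 → ℂ) |
        ∀ (g : Circle) (v : Fin 4 → ℂ) (hv : v ≠ 0)
          (hgv : (fun i => (g : ℂ) ^ (![0, a, b, c] i) * v i) ≠ 0),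
          Projectivization.mk ℂ v hv = L →
            Projectivization.mk ℂ (fun i => (g : ℂ) ^ (![0, a, b, c] i) * v i) hgv = L}
      = {Projectivization.mk ℂ (Pi.single 0 1) (single_ne_zero' 0),
         Projectivization.mk ℂ (Pi.single 1 1) (single_ne_zero' 1),
         Projectivization.mk ℂ (Pi.single 2 1) (single_ne_zero' 2),
         Projectivization.mk ℂ (Pi.single 3 1) (single_ne_zero' 3)} := by
  have hw : Function.Injective ![0, a, b, c] := by
    intro i j hij
    fin_cases i <;> fin_cases j <;> simp at hij ⊢ <;> omega
  ext L
  simp only [Set.mem_setOf_eq, Set.mem_insert_iff, Set.mem_singleton_iff]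
  constructor
  · intro h
    induction L using Projectivization.ind with
    | h v hv =>
      obtain ⟨i, hi⟩ := aux_main _ hw v hv fun g hgv => h g v hv hgv rfl
      fin_cases i
      · exact Or.inl hi
      · exact Or.inr (Or.inl hi)
      · exact Or.inr (Or.inr (Or.inl hi))
      · exact Or.inr (Or.inr (Or.inr hi))
  · rintro (rfl | rfl | rfl | rfl) g v hv hgv h <;> exact aux_fixed _ _ g v hv hgv h
end

section
/- Let the circle group act on the 2-sphere S² (the unit sphere in ℝ³ = EuclideanSpace ℝ (Fin 3), with its standard smooth manifold structure) by a smooth action, i.e., the map (g, x) ↦ g • x from Circle × S² to S² is smooth. If the action is nontrivial (there exist g ∈ Circle and x ∈ S² with g • x ≠ x), then the fixed point set { x ∈ S² : ∀ g ∈ Circle, g • x = x } has exactly two elements. (This is part (1) of Lemma 2.15.) -/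
open scoped Manifold

noncomputable instance : Fact (Module.finrank ℝ (EuclideanSpace ℝ (Fin 3)) = 2 + 1) :=
  ⟨by simp⟩

section
open Set Filter Topology
open scoped Manifold ContDiff RealInnerProductSpace

structure FlowData {E : Type*} [NormedAddCommGroup E] [InnerProductSpace ℝ E] (Φ : ℝ × E → E) : Prop where
  smooth : ∀ t x, x ≠ 0 → ContDiffAt ℝ ∞ Φ (t, x)
  zero : ∀ x, Φ (0, x) = x
  add : ∀ t s x, Φ (t + s, x) = Φ (t, Φ (s, x))
  per : ∀ x, Φ (2 * Real.pi, x) = x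
  norm : ∀ t x, ‖Φ (t, x)‖ = ‖x‖
  hom : ∀ t (c : ℝ) x, 0 < c → Φ (t, c • x) = c • Φ (t, x)

variable {E : Type*} [NormedAddCommGroup E] [InnerProductSpace ℝ E]

noncomputable def gen (Φ : ℝ × E → E) (x : E) : E := fderiv ℝ Φ (0, x) (1, 0)

noncomputable def lin (Φ : ℝ × E → E) (t : ℝ) (x : E) : E →L[ℝ] E :=
  (fderiv ℝ Φ (t, x)).comp (ContinuousLinearMap.inr ℝ ℝ E)

theorem two_le_infty : (2 : WithTop ℕ∞) ≤ ∞ := WithTop.coe_le_coe.2 (le_top : (2 : ℕ∞) ≤ ⊤)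

namespace FlowData
variable {Φ : ℝ × E → E} (F : FlowData Φ)
include F

theorem ne_zero {t : ℝ} {x : E} (hx : x ≠ 0) : Φ (t, x) ≠ 0 := by
  rw [← norm_ne_zero_iff, F.norm]; exact norm_ne_zero_iff.2 hx

theorem hasFDerivAt {t : ℝ} {x : E} (hx : x ≠ 0) : HasFDerivAt Φ (fderiv ℝ Φ (t, x)) (t, x) :=
  ((F.smooth t x hx).differentiableAt (by simp)).hasFDerivAt

theorem hasFDerivAt_lin {t : ℝ} {x : E} (hx : x ≠ 0) :
    HasFDerivAt (fun y => Φ (t, y)) (lin Φ t x) x :=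
  (F.hasFDerivAt hx).comp x (hasFDerivAt_prodMk_right t x)

theorem hasDerivAt_fst {t : ℝ} {x : E} (hx : x ≠ 0) :
    HasDerivAt (fun s => Φ (s, x)) (fderiv ℝ Φ (t, x) (1, 0)) t := by
  have := (F.hasFDerivAt (t := t) hx).comp t (hasFDerivAt_prodMk_left (𝕜 := ℝ) t x)
  have h2 := this.hasDerivAt
  simp only [ContinuousLinearMap.comp_apply, ContinuousLinearMap.inl_apply] at h2
  exact h2

theorem hasDerivAt {t : ℝ} {x : E} (hx : x ≠ 0) :
    HasDerivAt (fun s => Φ (s, x)) (gen Φ (Φ (t, x))) t := by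
  have h1 := F.hasDerivAt_fst (t := 0) (F.ne_zero (t := t) hx)
  have h2 : HasDerivAt (fun s => Φ (s - t, Φ (t, x))) (gen Φ (Φ (t, x))) t := by
    have h3 : HasDerivAt (fun s : ℝ => s - t) 1 t := (hasDerivAt_id t).sub_const t
    have := HasDerivAt.scomp t (g₁ := fun s => Φ (s, Φ (t, x))) (h := fun s => s - t) (by simpa using h1) h3
    rw [one_smul] at this
    exact this
  refine h2.congr_of_eventuallyEq (Eventually.of_forall fun s => ?_)
  simp only [← F.add, sub_add_cancel]

theorem fderiv_fst {t : ℝ} {x : E} (hx : x ≠ 0) :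
    fderiv ℝ Φ (t, x) (1, 0) = gen Φ (Φ (t, x)) :=
  (F.hasDerivAt_fst hx).unique (F.hasDerivAt hx)

theorem lin_gen {t : ℝ} {x : E} (hx : x ≠ 0) :
    lin Φ t x (gen Φ x) = gen Φ (Φ (t, x)) := by
  have h1 : HasDerivAt (fun s => Φ (t, Φ (s, x))) (lin Φ t x (gen Φ x)) 0 := by
    have h2 := F.hasDerivAt (t := 0) hx
    have h3 := F.hasFDerivAt_lin (t := t) hx
    rw [F.zero] at h2
    have h4 : HasFDerivAt (fun y => Φ (t, y)) (lin Φ t x) (Φ (0, x)) := by rw [F.zero]; exact h3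
    have h5 := h4.comp_hasDerivAt (0 : ℝ) h2
    exact h5
  have h2 : HasDerivAt (fun s => Φ (t, Φ (s, x))) (gen Φ (Φ (t, x))) 0 := by
    have h3 := F.hasDerivAt (t := 0) (F.ne_zero (t := t) hx)
    rw [F.zero] at h3
    refine h3.congr_of_eventuallyEq (Eventually.of_forall fun s => ?_)
    simp only [← F.add, add_comm]
  exact h1.unique h2

theorem lin_self {t : ℝ} {x : E} (hx : x ≠ 0) : lin Φ t x x = Φ (t, x) := by
  have h1 : HasDerivAt (fun s : ℝ => Φ (t, s • x)) (lin Φ t x x) 1 := by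
    have h3 := F.hasFDerivAt_lin (t := t) hx
    have h2 : HasDerivAt (fun s : ℝ => s • x) x 1 := by
      simpa using (hasDerivAt_id (1:ℝ)).smul_const x
    have h4 : HasFDerivAt (fun y => Φ (t, y)) (lin Φ t x) ((1 : ℝ) • x) := by rw [one_smul]; exact h3
    have h5 := h4.comp_hasDerivAt (1 : ℝ) h2
    exact h5
  have h2 : HasDerivAt (fun s : ℝ => Φ (t, s • x)) (Φ (t, x)) 1 := by
    have h3 : HasDerivAt (fun s : ℝ => s • Φ (t, x)) (Φ (t, x)) 1 := by
      simpa using (hasDerivAt_id (1:ℝ)).smul_const (Φ (t, x))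
    refine h3.congr_of_eventuallyEq ?_
    filter_upwards [lt_mem_nhds (zero_lt_one' ℝ)] with s hs
    exact F.hom t s x hs
  exact h1.unique h2

theorem lin_zero {x : E} (hx : x ≠ 0) : lin Φ 0 x = ContinuousLinearMap.id ℝ E := by
  have h1 := F.hasFDerivAt_lin (t := 0) hx
  refine h1.unique ((hasFDerivAt_id x).congr_of_eventuallyEq (Eventually.of_forall fun y => ?_))
  exact F.zero y

theorem lin_per {x : E} (hx : x ≠ 0) : lin Φ (2 * Real.pi) x = ContinuousLinearMap.id ℝ E := by
  have h1 := F.hasFDerivAt_lin (t := 2 * Real.pi) hx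
  refine h1.unique ((hasFDerivAt_id x).congr_of_eventuallyEq (Eventually.of_forall fun y => ?_))
  exact F.per y

theorem lin_comp {t : ℝ} {x : E} (hx : x ≠ 0) :
    (lin Φ (-t) (Φ (t, x))).comp (lin Φ t x) = ContinuousLinearMap.id ℝ E := by
  have h1 := (F.hasFDerivAt_lin (t := -t) (F.ne_zero (t := t) hx)).comp x (F.hasFDerivAt_lin (t := t) hx)
  refine h1.unique ((hasFDerivAt_id x).congr_of_eventuallyEq (Eventually.of_forall fun y => ?_))
  simp [← F.add, F.zero]

theorem contDiffAt_fderiv (t : ℝ) {x : E} (hx : x ≠ 0) : ContDiffAt ℝ ∞ (fderiv ℝ Φ) (t, x) :=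
  (F.smooth t x hx).fderiv_right (by simp)

theorem contDiffAt_gen {x : E} (hx : x ≠ 0) : ContDiffAt ℝ ∞ (gen Φ) x := by
  have h1 : ContDiffAt ℝ ∞ (fun y : E => fderiv ℝ Φ (0, y)) x :=
    (F.contDiffAt_fderiv 0 hx).comp x (contDiffAt_const.prodMk contDiffAt_id)
  exact h1.clm_apply contDiffAt_const

theorem inner_gen {x : E} (hx : x ≠ 0) : ⟪x, gen Φ x⟫ = 0 := by
  have h := F.hasDerivAt (t := 0) hx
  rw [F.zero] at h
  have h2 := h.norm_sq
  have h3 : HasDerivAt (fun s => ‖Φ (s, x)‖ ^ 2) 0 0 := by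
    simp only [F.norm]; exact hasDerivAt_const _ _
  have := h2.unique h3
  simp only [F.zero] at this
  linarith

theorem gen_smul {x : E} (hx : x ≠ 0) {c : ℝ} (hc : 0 < c) : gen Φ (c • x) = c • gen Φ x := by
  have h := F.hasDerivAt (t := 0) (smul_ne_zero hc.ne' hx)
  have h2 := (F.hasDerivAt (t := 0) hx).const_smul c
  rw [F.zero] at h h2
  refine h.unique (h2.congr_of_eventuallyEq (Eventually.of_forall fun s => ?_))
  exact F.hom s c x hc

theorem fixed_of_gen {x : E} (hx : x ≠ 0) (h : gen Φ x = 0) (t : ℝ) : Φ (t, x) = x := by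
  have h1 : ∀ t, HasDerivAt (fun s => Φ (s, x)) 0 t := by
    intro t
    have := F.hasDerivAt (t := t) hx
    rwa [← F.lin_gen hx, h, map_zero] at this
  have := is_const_of_deriv_eq_zero (fun t => (h1 t).differentiableAt) (fun t => (h1 t).deriv) t 0
  simpa [F.zero] using this

theorem gen_of_fixed {x : E} (hx : x ≠ 0) (h : ∀ t, Φ (t, x) = x) : gen Φ x = 0 := by
  have h1 := F.hasDerivAt (t := 0) hx
  simp only [h] at h1
  exact h1.unique (hasDerivAt_const _ _)

/-- linearised flow ODE at a fixed point -/
theorem hasDerivAt_lin {q : E} (hq : q ≠ 0) (h : gen Φ q = 0) (w : E) (t : ℝ) :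
    HasDerivAt (fun s => lin Φ s q w) (fderiv ℝ (gen Φ) q (lin Φ t q w)) t := by
  have hfix := F.fixed_of_gen hq h
  have hD : HasFDerivAt (fderiv ℝ Φ) (fderiv ℝ (fderiv ℝ Φ) (t, q)) (t, q) :=
    ((F.contDiffAt_fderiv t hq).differentiableAt (by simp)).hasFDerivAt
  have hsym : fderiv ℝ (fderiv ℝ Φ) (t, q) (1, 0) (0, w) = fderiv ℝ (fderiv ℝ Φ) (t, q) (0, w) (1, 0) := by
    apply ((F.smooth t q hq).isSymmSndFDerivAt
      (by simpa using two_le_infty)).eq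
  have h1 : HasDerivAt (fun s => lin Φ s q w) (fderiv ℝ (fderiv ℝ Φ) (t, q) (1, 0) (0, w)) t := by
    have h2 := (HasFDerivAt.comp (G := ℝ × E →L[ℝ] E) t hD (hasFDerivAt_prodMk_left (𝕜 := ℝ) t q)).hasDerivAt
    have h3 := h2.clm_apply (hasDerivAt_const t ((0, w) : ℝ × E))
    simpa [lin] using h3
  have h2 : fderiv ℝ (fderiv ℝ Φ) (t, q) (0, w) (1, 0) = fderiv ℝ (gen Φ) q (lin Φ t q w) := by
    have h3 : HasFDerivAt (fun y => fderiv ℝ Φ (t, y) (1, 0))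
        (((ContinuousLinearMap.apply ℝ E ((1, 0) : ℝ × E)).comp (fderiv ℝ (fderiv ℝ Φ) (t, q))).comp
          (ContinuousLinearMap.inr ℝ ℝ E)) q := by
      have := (HasFDerivAt.comp (G := ℝ × E →L[ℝ] E) q hD (hasFDerivAt_prodMk_right (𝕜 := ℝ) t q))
      exact (ContinuousLinearMap.apply ℝ E ((1, 0) : ℝ × E)).hasFDerivAt.comp q this
    have h4 : HasFDerivAt (fun y => gen Φ (Φ (t, y))) ((fderiv ℝ (gen Φ) q).comp (lin Φ t q)) q := by
      have h5 : HasFDerivAt (gen Φ) (fderiv ℝ (gen Φ) q) (Φ (t, q)) := by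
        rw [hfix]; exact ((F.contDiffAt_gen hq).differentiableAt (by simp)).hasFDerivAt
      exact h5.comp q (F.hasFDerivAt_lin hq)
    have h6 : HasFDerivAt (fun y => fderiv ℝ Φ (t, y) (1, 0)) ((fderiv ℝ (gen Φ) q).comp (lin Φ t q)) q := by
      refine h4.congr_of_eventuallyEq ?_
      filter_upwards [isOpen_ne.mem_nhds hq] with y hy
      exact F.fderiv_fst hy
    have := congrArg (fun l : E →L[ℝ] E => l w) (h3.unique h6)
    simpa using this
  rw [← h2, ← hsym]; exact h1

end FlowData
end

section
open Set Filter Topology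
open scoped Manifold ContDiff RealInnerProductSpace

abbrev E3 := EuclideanSpace ℝ (Fin 3)


abbrev S2 := Metric.sphere (0 : EuclideanSpace ℝ (Fin 3)) 1

theorem npt_mem (x : E3) (hx : x ≠ 0) : (‖x‖⁻¹ • x) ∈ Metric.sphere (0 : EuclideanSpace ℝ (Fin 3)) 1 := by
  simp [norm_smul, hx]

open Classical in
noncomputable def prj (x : E3) : S2 :=
  if hx : x ≠ 0 then ⟨‖x‖⁻¹ • x, npt_mem x hx⟩ else ⟨EuclideanSpace.single 0 1, by simp⟩

theorem prj_coe (x : E3) (hx : x ≠ 0) : (prj x : E3) = ‖x‖⁻¹ • x := by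
  simp [prj, hx]

theorem smul_prj (x : E3) : ‖x‖ • (prj x : E3) = x := by
  by_cases hx : x = 0
  · simp [hx]
  · rw [prj_coe x hx, smul_smul, mul_inv_cancel₀ (norm_ne_zero_iff.2 hx), one_smul]

theorem S2.ne_zero (y : S2) : (y : E3) ≠ 0 := ne_zero_of_mem_unit_sphere y

theorem prj_smul (c : ℝ) (hc : 0 < c) (y : S2) : prj (c • (y : E3)) = y := by
  apply Subtype.ext
  have : c • (y : E3) ≠ 0 := smul_ne_zero hc.ne' (S2.ne_zero y)
  rw [prj_coe _ this, norm_smul, smul_smul]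
  simp [abs_of_pos hc, hc.ne']

theorem prj_contMDiffAt (x : E3) (hx : x ≠ 0) : ContMDiffAt 𝓘(ℝ, E3) (𝓡 2) ∞ prj x := by
  let U : TopologicalSpace.Opens E3 := ⟨{0}ᶜ, isOpen_compl_singleton⟩
  have h1 : ContMDiff 𝓘(ℝ, E3) 𝓘(ℝ, E3) ∞ (fun y : U => ‖(y : E3)‖⁻¹ • (y : E3)) := by
    intro y
    have hy : (y : E3) ≠ 0 := y.2
    apply contMDiffAt_subtype_iff (f := fun y : E3 => ‖y‖⁻¹ • y).2
    apply ContDiffAt.contMDiffAt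
    exact ((contDiffAt_norm ℝ hy).inv (norm_ne_zero_iff.2 hy)).smul contDiffAt_id
  have h2 := ContMDiff.codRestrict_sphere (n := 2) h1 (fun y => npt_mem y y.2)
  have h3 := h2 ⟨x, hx⟩
  have h4 : (Set.codRestrict _ _ (fun y : U => npt_mem y y.2) : U → S2) = fun y : U => prj y := by
    funext y
    apply Subtype.ext
    have hy : (y : E3) ≠ 0 := y.2
    rw [prj_coe _ hy]; rfl
  rw [h4] at h3
  exact contMDiffAt_subtype_iff.1 h3

noncomputable def mkFlow (act : Circle → S2 → S2) (p : ℝ × E3) : E3 :=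
  ‖p.2‖ • (act (Circle.exp p.1) (prj p.2) : E3)

theorem mkFlow_flow (act : Circle → S2 → S2) 
    (hone : ∀ x, act 1 x = x)
    (hmul : ∀ g h x, act (g * h) x = act g (act h x))
    (hsmooth : ContMDiff ((𝓡 1).prod (𝓡 2)) (𝓡 2) (⊤ : ℕ∞)
      (fun p : Circle × (Metric.sphere (0 : EuclideanSpace ℝ (Fin 3)) 1) =>
        act p.1 p.2)) : FlowData (mkFlow act) := by
  have hz : ∀ t, mkFlow act (t, 0) = 0 := by intro t; simp [mkFlow]
  have hp : ∀ t x, x ≠ 0 → prj (mkFlow act (t, x)) = act (Circle.exp t) (prj x) := by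
    intro t x hx
    exact prj_smul _ (norm_pos_iff.2 hx) _
  have hn : ∀ t x, ‖mkFlow act (t, x)‖ = ‖x‖ := by
    intro t x
    simp [mkFlow, norm_smul]
  refine ⟨?_, ?_, ?_, ?_, hn, ?_⟩
  · intro t x hx
    have h1 : ContMDiffAt 𝓘(ℝ, ℝ × E3) (𝓡 1) ∞ (fun p : ℝ × E3 => Circle.exp p.1) (t, x) :=
      contMDiff_circleExp.contMDiffAt.comp (t, x) contDiff_fst.contMDiff.contMDiffAt
    have h2 : ContMDiffAt 𝓘(ℝ, ℝ × E3) (𝓡 2) ∞ (fun p : ℝ × E3 => prj p.2) (t, x) :=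
      (prj_contMDiffAt x hx).comp (t, x) contDiff_snd.contMDiff.contMDiffAt
    have h3 := (hsmooth (Circle.exp t, prj x)).comp (t, x) (h1.prodMk h2)
    have h4 := (contMDiff_coe_sphere (E := E3) (n := 2) (m := ∞)).contMDiffAt.comp (t, x) h3
    have h5 := h4.contDiffAt
    exact ((contDiffAt_norm ℝ hx).comp (t, x) contDiffAt_snd).smul h5
  · intro x; simp [mkFlow, hone, smul_prj]
  · intro t s x
    by_cases hx : x = 0
    · simp [hx, hz]
    · conv_rhs => rw [mkFlow]
      simp only [hp s x hx, hn]
      simp [mkFlow, Circle.exp_add, hmul]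
  · intro x; simp [mkFlow, hone, smul_prj]
  · intro t c x hc
    by_cases hx : x = 0
    · simp [hx, hz]
    · have : prj (c • x) = prj x := by
        conv_lhs => rw [← smul_prj x, smul_smul]
        exact prj_smul _ (mul_pos hc (norm_pos_iff.2 hx)) _
      simp [mkFlow, this, norm_smul, abs_of_pos hc, smul_smul]
end

section
set_option maxSynthPendingDepth 3
open Set Filter Topology
open scoped Manifold ContDiff RealInnerProductSpace

section tri
variable {E : Type*} [NormedAddCommGroup E] [InnerProductSpace ℝ E] (b : OrthonormalBasis (Fin 3) ℝ E)

noncomputable def cc (i : Fin 3) : E →L[ℝ] ℝ := innerSL ℝ (b i)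

theorem cc_apply (i : Fin 3) (x : E) : cc b i x = ⟪b i, x⟫ := rfl

noncomputable def tri : E →L[ℝ] E →L[ℝ] E →L[ℝ] ℝ :=
  (cc b 0).smulRight ((cc b 1).smulRight (cc b 2) - (cc b 2).smulRight (cc b 1)) +
  (cc b 1).smulRight ((cc b 2).smulRight (cc b 0) - (cc b 0).smulRight (cc b 2)) +
  (cc b 2).smulRight ((cc b 0).smulRight (cc b 1) - (cc b 1).smulRight (cc b 0))

theorem tri_apply (x y z : E) : tri b x y z =
    cc b 0 x * (cc b 1 y * cc b 2 z - cc b 2 y * cc b 1 z)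
      + cc b 1 x * (cc b 2 y * cc b 0 z - cc b 0 y * cc b 2 z)
      + cc b 2 x * (cc b 0 y * cc b 1 z - cc b 1 y * cc b 0 z) := by
  simp [tri]

theorem tri_det (L : E →L[ℝ] E) (x y z : E) :
    tri b (L x) (L y) (L z) = L.det * tri b x y z := by
  have key : ∀ x y z : E, tri b x y z = b.toBasis.det ![x, y, z] := by
    intro x y z
    rw [tri_apply, Module.Basis.det_apply, Matrix.det_fin_three]
    simp [Module.Basis.toMatrix_apply, OrthonormalBasis.repr_apply_apply, cc_apply]
    ring
  have := b.toBasis.det_comp (L : E →ₗ[ℝ] E) ![x, y, z]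
  rw [key, key, ContinuousLinearMap.det, ← this]
  congr 1
  ext i
  fin_cases i <;> simp

noncomputable def om (y : E) : E →L[ℝ] E →L[ℝ] ℝ := (‖y‖ ^ 3)⁻¹ • tri b y

theorem om_apply (y u v : E) : om b y u v = (‖y‖ ^ 3)⁻¹ * tri b y u v := by
  simp [om]

theorem om_alt (y u v : E) : om b y u v = - om b y v u := by
  simp only [om_apply, tri_apply]; ring

theorem om_contDiffAt {y : E} (hy : y ≠ 0) : ContDiffAt ℝ ∞ (om b) y :=
  (((contDiffAt_norm ℝ hy).pow 3).inv (pow_ne_zero 3 (norm_ne_zero_iff.2 hy))).smul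
    (tri b).contDiff.contDiffAt

theorem inner3 (y u : E) : ⟪y, u⟫ = cc b 0 y * cc b 0 u + cc b 1 y * cc b 1 u + cc b 2 y * cc b 2 u := by
  have := b.sum_inner_mul_inner y u
  rw [← this, Fin.sum_univ_three]
  simp only [cc_apply, real_inner_comm]

theorem norm_sq3 (y : E) : ‖y‖ ^ 2 = cc b 0 y ^ 2 + cc b 1 y ^ 2 + cc b 2 y ^ 2 := by
  rw [← real_inner_self_eq_norm_sq, inner3 b]; ring

set_option maxHeartbeats 2000000 in
theorem om_fderiv {y : E} (hy : y ≠ 0) (u v w : E) : fderiv ℝ (om b) y u v w =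
    (‖y‖ ^ 3)⁻¹ * tri b u v w - 3 * ⟪y, u⟫ * (‖y‖ ^ 5)⁻¹ * tri b y v w := by
  have hn : ‖y‖ ≠ 0 := norm_ne_zero_iff.2 hy
  have h1 : HasFDerivAt (om b) (fderiv ℝ (om b) y) y :=
    ((om_contDiffAt b hy).differentiableAt (by simp)).hasFDerivAt
  have hl : HasDerivAt (fun s : ℝ => y + s • u) u 0 := by
    simpa using ((hasDerivAt_id (0:ℝ)).smul_const u).const_add y
  have h1' : HasFDerivAt (om b) (fderiv ℝ (om b) y) (y + (0:ℝ) • u) := by simpa using h1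
  have h2 := ((h1'.comp_hasDerivAt (0:ℝ) hl).clm_apply (hasDerivAt_const (0:ℝ) v)).clm_apply (hasDerivAt_const (0:ℝ) w)
  have h3 : HasDerivAt (fun s : ℝ => ‖y + s • u‖ ^ 2) (2 * ⟪y, u⟫) 0 := by
    have := hl.norm_sq; simpa using this
  have h4 : HasDerivAt (fun s : ℝ => ‖y + s • u‖) (⟪y, u⟫ / ‖y‖) 0 := by
    have := h3.sqrt (by simpa using hn)
    simp only [zero_smul, add_zero, Real.sqrt_sq (norm_nonneg _)] at this
    convert this using 1
    field_simp
  have h5 : HasDerivAt (fun s : ℝ => tri b (y + s • u) v w) (tri b u v w) 0 := by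
    have := (((tri b).hasFDerivAt.comp_hasDerivAt (0:ℝ) hl).clm_apply (hasDerivAt_const (0:ℝ) v)).clm_apply (hasDerivAt_const (0:ℝ) w)
    simpa using this
  have h6 := ((h4.pow 3).inv (by simpa using hn)).mul h5
  have h7 : HasDerivAt (fun s : ℝ => om b (y + s • u) v w) (fderiv ℝ (om b) y u v w) 0 := by
    simpa using h2
  have h8 : HasDerivAt (fun s : ℝ => om b (y + s • u) v w) _ 0 :=
    h6.congr_of_eventuallyEq (Eventually.of_forall fun s => by simp [om_apply])
  rw [h7.unique h8]
  simp
  field_simp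
  ring

theorem om_closed {y : E} (hy : y ≠ 0) (u v w : E) :
    fderiv ℝ (om b) y u v w + fderiv ℝ (om b) y v w u + fderiv ℝ (om b) y w u v = 0 := by
  have hn : ‖y‖ ≠ 0 := norm_ne_zero_iff.2 hy
  rw [om_fderiv b hy, om_fderiv b hy, om_fderiv b hy]
  have e : (‖y‖ ^ 3)⁻¹ = ‖y‖ ^ 2 * (‖y‖ ^ 5)⁻¹ := by field_simp
  rw [e, norm_sq3 b]
  simp only [tri_apply, inner3 b]
  ring

end tri
end

section
set_option maxSynthPendingDepth 3
open Set Filter Topology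
open scoped Manifold ContDiff RealInnerProductSpace

section param
variable {V G : Type*} [NormedAddCommGroup V] [NormedSpace ℝ V] [NormedAddCommGroup G] [NormedSpace ℝ G]

theorem param_hasFDerivAt (a : ℝ × V → G) (ha : ∀ t x, x ≠ 0 → ContDiffAt ℝ ∞ a (t, x))
    {x : V} (hx : x ≠ 0) (T : ℝ) :
    HasFDerivAt (fun y => ∫ t in (0:ℝ)..T, a (t, y))
      (∫ t in (0:ℝ)..T, (fderiv ℝ a (t, x)).comp (ContinuousLinearMap.inr ℝ ℝ V)) x := by
  have hc : ∀ y : V, y ≠ 0 → Continuous fun t : ℝ => a (t, y) := fun y hy =>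
    continuous_iff_continuousAt.2 fun t =>
      ((ha t y hy).continuousAt.comp (f := fun s : ℝ => (s, y)) (by fun_prop))
  have hd : ∀ t (y : V), y ≠ 0 → ContinuousAt (fderiv ℝ a) (t, y) := fun t y hy =>
    ((ha t y hy).fderiv_right (m := ∞) (by simp)).continuousAt
  have hd' : ∀ t (y : V), y ≠ 0 → ContinuousAt (fun p => (fderiv ℝ a p).comp (ContinuousLinearMap.inr ℝ ℝ V)) (t, y) :=
    fun t y hy => (hd t y hy).clm_comp continuousAt_const
  have hcd : ∀ y : V, y ≠ 0 → Continuous fun t : ℝ => (fderiv ℝ a (t, y)).comp (ContinuousLinearMap.inr ℝ ℝ V) :=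
    fun y hy => continuous_iff_continuousAt.2 fun t =>
      ((hd' t y hy).comp (f := fun s : ℝ => (s, y)) (by fun_prop))
  obtain ⟨C, hC⟩ := (isCompact_uIcc (a := (0:ℝ)) (b := T)).exists_bound_of_continuousOn (hcd x hx).continuousOn
  have hev : ∀ᶠ y in 𝓝 x, ∀ t ∈ uIcc (0:ℝ) T, y ≠ 0 ∧
      ‖(fderiv ℝ a (t, y)).comp (ContinuousLinearMap.inr ℝ ℝ V)‖ < C + 1 := by
    apply isCompact_uIcc.eventually_forall_of_forall_eventually
    intro t ht
    have h1 : ContinuousAt (fun z : V × ℝ => ‖(fderiv ℝ a (z.2, z.1)).comp (ContinuousLinearMap.inr ℝ ℝ V)‖) (x, t) :=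
      ((hd' t x hx).comp (f := fun z : V × ℝ => (z.2, z.1)) (x := (x, t)) (by fun_prop)).norm
    have h2 := h1.eventually_lt_const (u := C + 1) (by have := hC t ht; linarith)
    have h3 : ∀ᶠ z : V × ℝ in 𝓝 (x, t), z.1 ≠ 0 := continuousAt_fst.eventually_ne hx
    exact h3.and h2
  refine intervalIntegral.hasFDerivAt_integral_of_dominated_of_fderiv_le
    (F := fun y t => a (t, y))
    (F' := fun y t => (fderiv ℝ a (t, y)).comp (ContinuousLinearMap.inr ℝ ℝ V))
    (bound := fun _ => C + 1) hev ?_ ?_ ?_ ?_ ?_ ?_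
  · filter_upwards [isOpen_ne.mem_nhds hx] with y hy
    exact (hc y hy).aestronglyMeasurable
  · exact (hc x hx).intervalIntegrable _ _
  · exact (hcd x hx).aestronglyMeasurable
  · exact Eventually.of_forall fun t ht y hy => (hy t (uIoc_subset_uIcc ht)).2.le
  · exact intervalIntegrable_const
  · refine Eventually.of_forall fun t ht y hy => ?_
    have hy0 := (hy t (uIoc_subset_uIcc ht)).1
    have h1 := ((ha t y hy0).differentiableAt (by simp)).hasFDerivAt
    exact h1.comp y (hasFDerivAt_prodMk_right (𝕜 := ℝ) t y)

theorem pullback_fderiv {W : Type*} [NormedAddCommGroup W] [NormedSpace ℝ W]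
    (om' : V → V →L[ℝ] V →L[ℝ] ℝ) (Ψ : W → V) (p : W) (hom : DifferentiableAt ℝ om' (Ψ p))
    (hΨ : ContDiffAt ℝ ∞ Ψ p) (ζ ξ η : W) :
    fderiv ℝ (fun p => om' (Ψ p) (fderiv ℝ Ψ p ξ) (fderiv ℝ Ψ p η)) p ζ
      = fderiv ℝ om' (Ψ p) (fderiv ℝ Ψ p ζ) (fderiv ℝ Ψ p ξ) (fderiv ℝ Ψ p η)
       + om' (Ψ p) (fderiv ℝ (fderiv ℝ Ψ) p ζ ξ) (fderiv ℝ Ψ p η)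
       + om' (Ψ p) (fderiv ℝ Ψ p ξ) (fderiv ℝ (fderiv ℝ Ψ) p ζ η) := by
  have h1 : HasFDerivAt Ψ (fderiv ℝ Ψ p) p := (hΨ.differentiableAt (by simp)).hasFDerivAt
  have h2 : HasFDerivAt (fderiv ℝ Ψ) (fderiv ℝ (fderiv ℝ Ψ) p) p :=
    ((hΨ.fderiv_right (m := ∞) (by simp)).differentiableAt (by simp)).hasFDerivAt
  have h3 : HasFDerivAt (fun p => om' (Ψ p)) ((fderiv ℝ om' (Ψ p)).comp (fderiv ℝ Ψ p)) p :=
    hom.hasFDerivAt.comp p h1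
  have h4 := (h3.clm_apply (h2.clm_apply (hasFDerivAt_const ξ p))).clm_apply
    (h2.clm_apply (hasFDerivAt_const η p))
  rw [h4.fderiv]
  simp
  ring

theorem pullback_closed {W : Type*} [NormedAddCommGroup W] [NormedSpace ℝ W]
    (om' : V → V →L[ℝ] V →L[ℝ] ℝ) (Ψ : W → V) (p : W) (hom : DifferentiableAt ℝ om' (Ψ p))
    (hΨ : ContDiffAt ℝ ∞ Ψ p) (ζ ξ η : W) (halt : ∀ u v, om' (Ψ p) u v = - om' (Ψ p) v u)
    (hcl : ∀ u v w, fderiv ℝ om' (Ψ p) u v w + fderiv ℝ om' (Ψ p) v w u + fderiv ℝ om' (Ψ p) w u v = 0) :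
    fderiv ℝ (fun p => om' (Ψ p) (fderiv ℝ Ψ p ξ) (fderiv ℝ Ψ p η)) p ζ
    + fderiv ℝ (fun p => om' (Ψ p) (fderiv ℝ Ψ p η) (fderiv ℝ Ψ p ζ)) p ξ
    + fderiv ℝ (fun p => om' (Ψ p) (fderiv ℝ Ψ p ζ) (fderiv ℝ Ψ p ξ)) p η = 0 := by
  rw [pullback_fderiv om' Ψ p hom hΨ, pullback_fderiv om' Ψ p hom hΨ, pullback_fderiv om' Ψ p hom hΨ]
  have hs : ∀ u v, fderiv ℝ (fderiv ℝ Ψ) p u v = fderiv ℝ (fderiv ℝ Ψ) p v u := by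
    intro u v
    exact (hΨ.isSymmSndFDerivAt (by simpa using two_le_infty)).eq u v
  have := hcl (fderiv ℝ Ψ p ζ) (fderiv ℝ Ψ p ξ) (fderiv ℝ Ψ p η)
  rw [hs ξ ζ, hs η ζ, hs η ξ, halt (fderiv ℝ Ψ p η) (fderiv ℝ (fderiv ℝ Ψ) p ζ ξ),
    halt (fderiv ℝ Ψ p ζ) (fderiv ℝ (fderiv ℝ Ψ) p ξ η),
    halt (fderiv ℝ Ψ p ξ) (fderiv ℝ (fderiv ℝ Ψ) p ζ η)]
  linarith
end param
end

section
set_option maxSynthPendingDepth 3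
open Set Filter Topology
open scoped Manifold ContDiff RealInnerProductSpace

section alph
variable {E : Type*} [NormedAddCommGroup E] [InnerProductSpace ℝ E] (b : OrthonormalBasis (Fin 3) ℝ E)

noncomputable def aform (Φ : ℝ × E → E) (p : ℝ × E) : E →L[ℝ] ℝ :=
  (om b (Φ p) (fderiv ℝ Φ p (1,0))).comp ((fderiv ℝ Φ p).comp (ContinuousLinearMap.inr ℝ ℝ E))

noncomputable def alph (Φ : ℝ × E → E) (x : E) : E →L[ℝ] ℝ :=
  ∫ t in (0:ℝ)..(2 * Real.pi), aform b Φ (t, x)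

noncomputable def pb (Φ : ℝ × E → E) (ξ η : ℝ × E) (p : ℝ × E) : ℝ :=
  om b (Φ p) (fderiv ℝ Φ p ξ) (fderiv ℝ Φ p η)

variable {Φ : ℝ × E → E} (F : FlowData Φ)
include F

theorem pb_contDiffAt (ξ η : ℝ × E) (t : ℝ) (x : E) (hx : x ≠ 0) : ContDiffAt ℝ ∞ (pb b Φ ξ η) (t, x) := by
  have h1 : ContDiffAt ℝ ∞ (fun p => om b (Φ p)) (t, x) :=
    (om_contDiffAt b (F.ne_zero (t := t) hx)).comp (t, x) (F.smooth t x hx)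
  have h2 := F.contDiffAt_fderiv t hx
  exact (h1.clm_apply (h2.clm_apply contDiffAt_const)).clm_apply (h2.clm_apply contDiffAt_const)

theorem aform_contDiffAt (t : ℝ) (x : E) (hx : x ≠ 0) : ContDiffAt ℝ ∞ (aform b Φ) (t, x) := by
  have h1 : ContDiffAt ℝ ∞ (fun p => om b (Φ p)) (t, x) :=
    (om_contDiffAt b (F.ne_zero (t := t) hx)).comp (t, x) (F.smooth t x hx)
  have h2 := F.contDiffAt_fderiv t hx
  exact (h1.clm_apply (h2.clm_apply contDiffAt_const)).clm_comp (h2.clm_comp contDiffAt_const)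

theorem aform_cont (x : E) (hx : x ≠ 0) : Continuous fun t => aform b Φ (t, x) :=
  continuous_iff_continuousAt.2 fun t =>
      ((aform_contDiffAt b F t x hx).continuousAt.comp (f := fun s : ℝ => (s, x)) (by fun_prop))

theorem aform_fderiv (t : ℝ) (x : E) (hx : x ≠ 0) (ζ : ℝ × E) (v : E) :
    fderiv ℝ (aform b Φ) (t, x) ζ v = fderiv ℝ (pb b Φ (1,0) (0,v)) (t,x) ζ := by
  have h1 := ((aform_contDiffAt b F t x hx).differentiableAt (by simp)).hasFDerivAt
  have h2 := h1.clm_apply (hasFDerivAt_const v (t, x))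
  have h3 : pb b Φ (1,0) (0,v) = fun p => aform b Φ p v := by
    funext p; simp [pb, aform]
  rw [h3, h2.fderiv]
  simp

theorem alph_hasFDerivAt (x : E) (hx : x ≠ 0) : HasFDerivAt (alph b Φ)
      (∫ t in (0:ℝ)..(2 * Real.pi), (fderiv ℝ (aform b Φ) (t, x)).comp (ContinuousLinearMap.inr ℝ ℝ E)) x :=
  param_hasFDerivAt (aform b Φ) (aform_contDiffAt b F) hx _

theorem fderiv_cont {G : Type*} [NormedAddCommGroup G] [NormedSpace ℝ G] (a : ℝ × E → G)
    (ha : ∀ t x, x ≠ 0 → ContDiffAt ℝ ∞ a (t, x)) (x : E) (hx : x ≠ 0) :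
    Continuous fun t : ℝ => fderiv ℝ a (t, x) :=
  continuous_iff_continuousAt.2 fun t =>
    (((ha t x hx).fderiv_right (m := ∞) (by simp)).continuousAt.comp (f := fun s : ℝ => (s, x)) (by fun_prop))

theorem alph_fderiv (x : E) (hx : x ≠ 0) (u v : E) : fderiv ℝ (alph b Φ) x u v =
    ∫ t in (0:ℝ)..(2 * Real.pi), fderiv ℝ (pb b Φ (1,0) (0,v)) (t,x) (0,u) := by
  rw [(alph_hasFDerivAt b F x hx).fderiv]
  have hc := fderiv_cont F (aform b Φ) (aform_contDiffAt b F) x hx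
  have hc' : Continuous fun t : ℝ => (fderiv ℝ (aform b Φ) (t, x)).comp (ContinuousLinearMap.inr ℝ ℝ E) :=
    hc.clm_comp continuous_const
  rw [ContinuousLinearMap.intervalIntegral_apply (hc'.intervalIntegrable _ _),
    ContinuousLinearMap.intervalIntegral_apply ((hc'.clm_apply continuous_const).intervalIntegrable _ _)]
  congr 1
  funext t
  rw [← aform_fderiv b F t x hx]
  simp

theorem alph_symm (x : E) (hx : x ≠ 0) (u v : E) : fderiv ℝ (alph b Φ) x u v = fderiv ℝ (alph b Φ) x v u := by
  rw [alph_fderiv b F x hx, alph_fderiv b F x hx, ← sub_eq_zero]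
  have hI : ∀ (ξ η ζ : ℝ × E), IntervalIntegrable (fun t => fderiv ℝ (pb b Φ ξ η) (t,x) ζ)
    MeasureTheory.volume 0 (2 * Real.pi) := fun ξ η ζ =>
      (((fderiv_cont F (pb b Φ ξ η) (pb_contDiffAt b F ξ η) x hx).clm_apply continuous_const).intervalIntegrable _ _)
  rw [← intervalIntegral.integral_sub (hI _ _ _) (hI _ _ _)]
  have key : ∀ t, fderiv ℝ (pb b Φ (1,0) (0,v)) (t,x) (0,u) - fderiv ℝ (pb b Φ (1,0) (0,u)) (t,x) (0,v)
      = fderiv ℝ (pb b Φ (0,u) (0,v)) (t,x) (1,0) := by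
    intro t
    have hy := F.ne_zero (t := t) hx
    have h := pullback_closed (om b) Φ (t,x) ((om_contDiffAt b hy).differentiableAt (by simp))
      (F.smooth t x hx) (1,0) (0,u) (0,v) (om_alt b _) (om_closed b hy)
    have e : (fun p => om b (Φ p) (fderiv ℝ Φ p (0,v)) (fderiv ℝ Φ p (1,0))) = fun p => - pb b Φ (1,0) (0,v) p := by
      funext p; rw [om_alt]; rfl
    rw [e, fderiv_fun_neg] at h
    have h' : fderiv ℝ (pb b Φ (0,u) (0,v)) (t,x) (1,0) - fderiv ℝ (pb b Φ (1,0) (0,v)) (t,x) (0,u) 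
       + fderiv ℝ (pb b Φ (1,0) (0,u)) (t,x) (0,v) = 0 := by
      rw [sub_eq_add_neg]; exact h
    linarith
  simp only [key]
  rw [intervalIntegral.integral_eq_sub_of_hasDerivAt (f := fun t => pb b Φ (0,u) (0,v) (t,x)) _ (hI _ _ _)]
  · have e1 := congrArg (fun l : E →L[ℝ] E => l u) (F.lin_per hx)
    have e2 := congrArg (fun l : E →L[ℝ] E => l v) (F.lin_per hx)
    have e3 := congrArg (fun l : E →L[ℝ] E => l u) (F.lin_zero hx)
    have e4 := congrArg (fun l : E →L[ℝ] E => l v) (F.lin_zero hx)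
    simp [lin] at e1 e2 e3 e4
    simp [pb, e1, e2, e3, e4, F.per, F.zero]
  · intro t _
    have h1 := ((pb_contDiffAt b F (0,u) (0,v) t x hx).differentiableAt (by simp)).hasFDerivAt
    have h2 := (h1.comp t (hasFDerivAt_prodMk_left (𝕜 := ℝ) t x)).hasDerivAt
    simp only [ContinuousLinearMap.comp_apply, ContinuousLinearMap.inl_apply] at h2
    exact h2

/-- value of the one form -/
theorem alph_apply (x : E) (hx : x ≠ 0) (v : E) : alph b Φ x v =
    (∫ t in (0:ℝ)..(2 * Real.pi), (lin Φ t x).det) * (‖x‖ ^ 3)⁻¹ * tri b x (gen Φ x) v := by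
  rw [alph, ContinuousLinearMap.intervalIntegral_apply ((aform_cont b F x hx).intervalIntegrable _ _),
    mul_assoc, ← intervalIntegral.integral_mul_const]
  congr 1
  funext t
  have h1 : aform b Φ (t, x) v = om b (Φ (t,x)) (gen Φ (Φ (t,x))) (lin Φ t x v) := by
    simp only [aform, F.fderiv_fst hx]; rfl
  rw [h1, om_apply, F.norm, ← F.lin_gen hx]
  nth_rw 1 [← F.lin_self hx]
  rw [tri_det]; ring

theorem det_pos [FiniteDimensional ℝ E] (x : E) (hx : x ≠ 0) (t : ℝ) : 0 < (lin Φ t x).det := by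
  have hne : ∀ s, (lin Φ s x).det ≠ 0 := by
    intro s h
    have := congrArg ContinuousLinearMap.det (F.lin_comp (t := s) hx)
    have e : ((lin Φ (-s) (Φ (s, x))).comp (lin Φ s x)).det = (lin Φ (-s) (Φ (s, x))).det * (lin Φ s x).det := by
      simp only [ContinuousLinearMap.det]
      exact LinearMap.det_comp _ _
    rw [e, h, mul_zero] at this
    simp [ContinuousLinearMap.det] at this
  have hc : Continuous fun s => (lin Φ s x).det := by
    have h1 : Continuous fun s => lin Φ s x := (fderiv_cont F Φ F.smooth x hx).clm_comp continuous_const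
    exact ContinuousLinearMap.continuous_det.comp h1
  have h0 : (lin Φ 0 x).det = 1 := by rw [F.lin_zero hx]; simp [ContinuousLinearMap.det]
  by_contra hneg
  have h1 := mem_range_of_exists_le_of_exists_ge hc ⟨t, not_lt.1 hneg⟩ ⟨0, by rw [h0]; exact zero_le_one⟩
  obtain ⟨s, hs⟩ := h1
  exact hne s hs

theorem alph_apply' (x : E) (hx : x ≠ 0) : ∃ κ : ℝ, 0 < κ ∧ ∀ v, alph b Φ x v = κ * tri b x (gen Φ x) v := by
  have : FiniteDimensional ℝ E := b.toBasis.finiteDimensional_of_finite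
  refine ⟨_, mul_pos ?_ (inv_pos.2 (pow_pos (norm_pos_iff.2 hx) 3)), alph_apply b F x hx⟩
  have hc : Continuous fun s => (lin Φ s x).det := by
    have h1 : Continuous fun s => lin Φ s x := (fderiv_cont F Φ F.smooth x hx).clm_comp continuous_const
    exact ContinuousLinearMap.continuous_det.comp h1
  exact intervalIntegral.intervalIntegral_pos_of_pos (hc.intervalIntegrable _ _) (fun t => det_pos F x hx t) Real.two_pi_pos

end alph
end

section
set_option maxSynthPendingDepth 3
open Set Filter Topology
open scoped Manifold ContDiff RealInnerProductSpace

section glue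
variable {V : Type*} [NormedAddCommGroup V] [NormedSpace ℝ V]

theorem glue (α : V → V →L[ℝ] ℝ) {U W : Set V} (hU : IsOpen U) (hW : IsOpen W)
    (hc : IsPreconnected (U ∩ W)) (h1 : ∃ f, ∀ a ∈ U, HasFDerivAt f (α a) a)
    (h2 : ∃ f, ∀ a ∈ W, HasFDerivAt f (α a) a) : ∃ f, ∀ a ∈ U ∪ W, HasFDerivAt f (α a) a := by
  classical
  obtain ⟨f, hf⟩ := h1
  obtain ⟨g, hg⟩ := h2
  obtain ⟨c, hc'⟩ := (hU.inter hW).exists_eq_add_of_fderiv_eq (𝕜 := ℝ) hc (f := f) (g := g)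
    (fun a ha => (hf a ha.1).differentiableAt.differentiableWithinAt)
    (fun a ha => (hg a ha.2).differentiableAt.differentiableWithinAt)
    (fun a ha => by rw [(hf a ha.1).fderiv, (hg a ha.2).fderiv])
  refine ⟨fun x => if x ∈ U then f x else g x + c, fun a ha => ?_⟩
  rcases ha with ha | ha
  · refine (hf a ha).congr_of_eventuallyEq ?_
    filter_upwards [hU.mem_nhds ha] with x hx
    simp [hx]
  · refine ((hg a ha).add_const c).congr_of_eventuallyEq ?_
    filter_upwards [hW.mem_nhds ha] with x hx
    by_cases hxU : x ∈ U
    · simpa [hxU] using hc' ⟨hxU, hx⟩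
    · simp [hxU]

theorem half_convex (f : V →L[ℝ] ℝ) : Convex ℝ {x | 0 < f x} :=
  convex_halfSpace_gt f.isLinear 0

theorem half_open (f : V →L[ℝ] ℝ) : IsOpen {x | 0 < f x} :=
  isOpen_lt continuous_const f.continuous

theorem poincare4 (α : V → V →L[ℝ] ℝ) (hα : ∀ x, x ≠ 0 → DifferentiableAt ℝ α x)
    (hs : ∀ x, x ≠ 0 → ∀ u v, fderiv ℝ α x u v = fderiv ℝ α x v u)
    (f1 f2 f3 f4 : V →L[ℝ] ℝ) (p3 p2 p1 : V) 
    (h3 : 0 < f1 p3 ∧ 0 < f2 p3 ∧ 0 < f3 p3)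
    (h2 : 0 < f1 p2 ∧ 0 < f2 p2 ∧ 0 < f4 p2)
    (h1 : 0 < f1 p1 ∧ 0 < f3 p1 ∧ 0 < f4 p1)
    (hcov : ∀ x, x ≠ 0 → 0 < f1 x ∨ 0 < f2 x ∨ 0 < f3 x ∨ 0 < f4 x) :
    ∃ H : V → ℝ, ∀ x, x ≠ 0 → HasFDerivAt H (α x) x := by
  have hl : ∀ f : V →L[ℝ] ℝ, ∃ H, ∀ x ∈ {x | 0 < f x}, HasFDerivAt H (α x) x := by
    intro f
    have hne : ∀ x ∈ {x | 0 < f x}, x ≠ 0 := by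
      intro x hx h
      have hx' : 0 < f x := hx
      simp [h] at hx'
    exact (half_convex f).exists_forall_hasFDerivAt_of_fderiv_symmetric (half_open f)
      (fun x hx => (hα x (hne x hx)).differentiableWithinAt) (fun x hx => hs x (hne x hx))
  have hcc : ∀ f g : V →L[ℝ] ℝ, IsPreconnected ({x | 0 < f x} ∩ {x | 0 < g x}) := fun f g =>
    ((half_convex f).inter (half_convex g)).isPreconnected
  have g12 := glue α (half_open f1) (half_open f2) (hcc _ _) (hl f1) (hl f2)
  have g123 := glue α ((half_open f1).union (half_open f2)) (half_open f3) (by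
    rw [union_inter_distrib_right]
    exact IsPreconnected.union p3 ⟨h3.1, h3.2.2⟩ ⟨h3.2.1, h3.2.2⟩ (hcc _ _) (hcc _ _)) g12 (hl f3)
  have g1234 := glue α (((half_open f1).union (half_open f2)).union (half_open f3)) (half_open f4) (by
    rw [union_inter_distrib_right, union_inter_distrib_right]
    refine IsPreconnected.union p1 (Or.inl ⟨h1.1, h1.2.2⟩) ⟨h1.2.1, h1.2.2⟩ ?_ (hcc _ _)
    exact IsPreconnected.union p2 ⟨h2.1, h2.2.2⟩ ⟨h2.2.1, h2.2.2⟩ (hcc _ _) (hcc _ _)) g123 (hl f4)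
  obtain ⟨H, hH⟩ := g1234
  refine ⟨H, fun x hx => hH x ?_⟩
  rcases hcov x hx with h | h | h | h
  · exact Or.inl (Or.inl (Or.inl h))
  · exact Or.inl (Or.inl (Or.inr h))
  · exact Or.inl (Or.inr h)
  · exact Or.inr h
end glue

section prim
variable {E : Type*} [NormedAddCommGroup E] [InnerProductSpace ℝ E] (b : OrthonormalBasis (Fin 3) ℝ E)

theorem cc_b (i j : Fin 3) : cc b i (b j) = if i = j then 1 else 0 := by
  rw [cc_apply]; exact orthonormal_iff_ite.1 b.orthonormal i j

theorem exists_prim {Φ : ℝ × E → E} (F : FlowData Φ) :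
    ∃ H : E → ℝ, ∀ x, x ≠ 0 → HasFDerivAt H (alph b Φ x) x := by
  refine poincare4 _ (fun x hx => (alph_hasFDerivAt b F x hx).differentiableAt) (alph_symm b F)
    (cc b 0) (cc b 1) (cc b 2) (-(cc b 0 + cc b 1 + cc b 2))
    (b 0 + b 1 + b 2) (b 0 + b 1 - (3:ℝ) • b 2) (b 0 + b 2 - (3:ℝ) • b 1) ?_ ?_ ?_ ?_
  · simp [cc_b]
  · simp [cc_b]; norm_num
  · simp [cc_b]; norm_num
  · intro x hx
    by_contra! h
    obtain ⟨h0, h1, h2, h3⟩ := h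
    simp at h3
    have e0 : cc b 0 x = 0 := by linarith
    have e1 : cc b 1 x = 0 := by linarith
    have e2 : cc b 2 x = 0 := by linarith
    have := norm_sq3 b x
    simp [e0, e1, e2] at this
    exact hx this
end prim
end

section
set_option maxSynthPendingDepth 3
open Set Filter Topology
open scoped Manifold ContDiff RealInnerProductSpace

section nondeg
variable {E : Type*} [NormedAddCommGroup E] [InnerProductSpace ℝ E] (b : OrthonormalBasis (Fin 3) ℝ E)

theorem lagrange3 (q w v : E) (hqw : ⟪q, w⟫ = 0) (hqv : ⟪q, v⟫ = 0) :
    (tri b q w v) ^ 2 = ‖q‖ ^ 2 * (‖w‖ ^ 2 * ‖v‖ ^ 2 - ⟪w, v⟫ ^ 2) := by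
  have key : (tri b q w v) ^ 2 = ‖q‖ ^ 2 * (‖w‖ ^ 2 * ‖v‖ ^ 2 - ⟪w, v⟫ ^ 2)
      - ⟪q, w⟫ * (⟪q, w⟫ * ‖v‖ ^ 2 - ⟪w, v⟫ * ⟪q, v⟫) + ⟪q, v⟫ * (⟪q, w⟫ * ⟪w, v⟫ - ‖w‖ ^ 2 * ⟪q, v⟫) := by
    simp only [norm_sq3 b, inner3 b, tri_apply]
    ring
  rw [key, hqw, hqv]; ring

theorem tri_eq_zero {q w v : E} (hq : q ≠ 0) (hw : w ≠ 0) (hqw : ⟪q, w⟫ = 0) (hqv : ⟪q, v⟫ = 0)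
    (h1 : tri b q w v = 0) (h2 : ⟪w, v⟫ = 0) : v = 0 := by
  have h := lagrange3 b q w v hqw hqv
  rw [h1, h2] at h
  have hq' := pow_pos (norm_pos_iff.2 hq) 2
  have hw' := pow_pos (norm_pos_iff.2 hw) 2
  have h3 : (‖q‖ ^ 2 * ‖w‖ ^ 2) * ‖v‖ ^ 2 = 0 := by linarith
  have := (mul_eq_zero.1 h3).resolve_left (by positivity)
  simpa using this

noncomputable def crs (q w : E) : E := ∑ i, (tri b q w (b i)) • b i

theorem inner_crs (q w v : E) : ⟪crs b q w, v⟫ = tri b q w v := by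
  rw [crs, Fin.sum_univ_three]
  simp only [inner_add_left, real_inner_smul_left, ← cc_apply, tri_apply, cc_b]
  simp
  ring

theorem crs_ne {q w : E} (hq : q ≠ 0) (hw : w ≠ 0) (hqw : ⟪q, w⟫ = 0) : 0 < tri b q w (crs b q w) := by
  have h1 : tri b q w (crs b q w) = ‖q‖ ^ 2 * ‖w‖ ^ 2 - ⟪q, w⟫ ^ 2 := by
    rw [crs, Fin.sum_univ_three]
    simp only [norm_sq3 b, inner3 b, tri_apply, map_add, map_smul, cc_b]
    simp
    ring
  rw [h1, hqw]
  have hq' := pow_pos (norm_pos_iff.2 hq) 2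
  have hw' := pow_pos (norm_pos_iff.2 hw) 2
  have := mul_pos hq' hw'
  linarith

theorem tri_self1 (q v : E) : tri b q v q = 0 := by simp only [tri_apply]; ring
theorem tri_self2 (q v : E) : tri b q v v = 0 := by simp only [tri_apply]; ring
theorem tri_swap (q v w : E) : tri b q v w = - tri b q w v := by simp only [tri_apply]; ring

theorem decomp {q w : E} (hq : q ≠ 0) (hw : w ≠ 0) (hqw : ⟪q, w⟫ = 0) (v : E) :
    v = (⟪q, v⟫ / ⟪q, q⟫) • q + (⟪w, v⟫ / ⟪w, w⟫) • w
      + (tri b q w v / tri b q w (crs b q w)) • crs b q w := by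
  set u := crs b q w with hu
  have hup := crs_ne b hq hw hqw
  rw [← hu] at hup
  have hqq : ⟪q, q⟫ ≠ 0 := inner_self_ne_zero.2 hq
  have hww : ⟪w, w⟫ ≠ 0 := inner_self_ne_zero.2 hw
  have hqu : ⟪q, u⟫ = 0 := by rw [real_inner_comm, hu, inner_crs, tri_self1]
  have hwu : ⟪w, u⟫ = 0 := by rw [real_inner_comm, hu, inner_crs, tri_self2]
  have hwq : ⟪w, q⟫ = 0 := by rw [real_inner_comm]; exact hqw
  rw [← sub_eq_zero]
  apply tri_eq_zero b hq hw hqw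
  · simp only [inner_sub_right, inner_add_right, real_inner_smul_right, hqw, hqu]
    field_simp; ring
  · simp only [map_sub, map_add, map_smul, tri_self1, tri_self2, smul_eq_mul]
    field_simp; ring
  · simp only [inner_sub_right, inner_add_right, real_inner_smul_right, hwq, hwu]
    field_simp; ring

theorem ode_per {f : ℝ → ℝ} {β : ℝ} (hf : ∀ t, HasDerivAt f (β * f t) t) {T : ℝ} (hT : 0 < T)
    (hper : f T = f 0) (h0 : f 0 ≠ 0) : β = 0 := by
  have h1 : ∀ t, HasDerivAt (fun t => Real.exp (-β * t) * f t) 0 t := by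
    intro t
    have h2 : HasDerivAt (fun t : ℝ => Real.exp (-β * t)) (Real.exp (-β * t) * (-β)) t := by
      have := ((hasDerivAt_id t).const_mul (-β)).exp
      simpa using this
    have h3 := h2.mul (hf t)
    exact h3.congr_deriv (by ring)
  have h2 := is_const_of_deriv_eq_zero (fun t => (h1 t).differentiableAt) (fun t => (h1 t).deriv) T 0
  simp only [hper, mul_zero, Real.exp_zero, one_mul] at h2
  have h3 : Real.exp (-β * T) = 1 := by
    have : (Real.exp (-β * T) - 1) * f 0 = 0 := by linarith
    have := (mul_eq_zero.1 this).resolve_right h0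
    linarith
  have h4 := Real.exp_eq_one_iff _ |>.1 h3
  have := (mul_eq_zero.1 h4).resolve_right hT.ne'
  linarith

variable {Φ : ℝ × E → E} (F : FlowData Φ)
include F

theorem gen_hasFDerivAt {x : E} (hx : x ≠ 0) : HasFDerivAt (gen Φ) (fderiv ℝ (gen Φ) x) x :=
  ((F.contDiffAt_gen hx).differentiableAt (by simp)).hasFDerivAt

theorem B_self {q : E} (hq : q ≠ 0) (h : gen Φ q = 0) : fderiv ℝ (gen Φ) q q = 0 := by
  have h2 : HasDerivAt (fun s : ℝ => s • q) q 1 := by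
    simpa using (hasDerivAt_id (1:ℝ)).smul_const q
  have h4 : HasFDerivAt (gen Φ) (fderiv ℝ (gen Φ) q) ((1 : ℝ) • q) := by
    rw [one_smul]; exact gen_hasFDerivAt F hq
  have h5 := h4.comp_hasDerivAt (1 : ℝ) h2
  have h6 : HasDerivAt (fun s : ℝ => gen Φ (s • q)) 0 1 := by
    refine (hasDerivAt_const (1:ℝ) (0:E)).congr_of_eventuallyEq ?_
    filter_upwards [lt_mem_nhds (zero_lt_one' ℝ)] with s hs
    rw [F.gen_smul hq hs, h, smul_zero]
  exact h5.unique h6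

theorem B_orth {q : E} (hq : q ≠ 0) (h : gen Φ q = 0) (v : E) : ⟪q, fderiv ℝ (gen Φ) q v⟫ = 0 := by
  have h1 := (hasFDerivAt_id q).inner ℝ (gen_hasFDerivAt F hq)
  have h2 : HasFDerivAt (fun x : E => ⟪id x, gen Φ x⟫) (0 : E →L[ℝ] ℝ) q := by
    refine (hasFDerivAt_const (0:ℝ) q).congr_of_eventuallyEq ?_
    filter_upwards [isOpen_ne.mem_nhds hq] with x hx
    exact F.inner_gen hx
  have := congrArg (fun l : E →L[ℝ] ℝ => l v) (h1.unique h2)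
  simpa [h, fderivInnerCLM_apply] using this

theorem nondeg {q w : E} (hq : q ≠ 0) (h : gen Φ q = 0) (hw : w ≠ 0) (hqw : ⟪q, w⟫ = 0)
    (hz : tri b q (fderiv ℝ (gen Φ) q w) w = 0) : fderiv ℝ (gen Φ) q = 0 := by
  set B := fderiv ℝ (gen Φ) q with hB
  set u := crs b q w with hu
  have hup := crs_ne b hq hw hqw
  rw [← hu] at hup
  have hww : ⟪w, w⟫ ≠ 0 := inner_self_ne_zero.2 hw
  have hwu : ⟪w, u⟫ = 0 := by rw [real_inner_comm, hu, inner_crs, tri_self2]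
  have hBq : B q = 0 := B_self F hq h
  have hBo : ∀ v, ⟪q, B v⟫ = 0 := B_orth F hq h
  have hdec : ∀ v, B v = (⟪w, v⟫ / ⟪w, w⟫) • B w + (tri b q w v / tri b q w u) • B u := by
    intro v
    conv_lhs => rw [decomp b hq hw hqw v]
    simp only [map_add, map_smul, hBq, smul_zero, zero_add, ← hu]
  have hode : ∀ v t, HasDerivAt (fun s => lin Φ s q v) (B (lin Φ t q v)) t := F.hasDerivAt_lin hq h
  have hψ : ∀ v t, HasDerivAt (fun s => tri b q w (lin Φ s q v)) (tri b q w (B (lin Φ t q v))) t := by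
    intro v t
    exact (tri b q w).hasFDerivAt.comp_hasDerivAt t (hode v t)
  have hχ : ∀ v t, HasDerivAt (fun s => ⟪w, lin Φ s q v⟫) ⟪w, B (lin Φ t q v)⟫ t := by
    intro v t
    exact (innerSL ℝ w).hasFDerivAt.comp_hasDerivAt t (hode v t)
  have hl0 : ∀ v, lin Φ 0 q v = v := fun v => by rw [F.lin_zero hq]; rfl
  have hl1 : ∀ v, lin Φ (2 * Real.pi) q v = v := fun v => by rw [F.lin_per hq]; rfl
  have hψw : tri b q w (B w) = 0 := by rw [tri_swap, hz, neg_zero]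
  -- beta
  have hβ : tri b q w (B u) = 0 := by
    have hb : ∀ v, tri b q w (B v) = (tri b q w (B u) / tri b q w u) * tri b q w v := by
      intro v
      rw [hdec v]
      simp only [map_add, map_smul, hψw, smul_eq_mul]
      ring
    have := ode_per (f := fun s => tri b q w (lin Φ s q u)) (fun t => by rw [← hb]; exact hψ u t)
      Real.two_pi_pos (by rw [hl0, hl1]) (by rw [hl0]; exact hup.ne')
    exact (div_eq_zero_iff.1 this).resolve_right hup.ne'
  have hψB : ∀ v, tri b q w (B v) = 0 := by
    intro v
    rw [hdec v]
    simp only [map_add, map_smul, hψw, hβ, smul_zero, add_zero]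
  have hψc : ∀ v t, tri b q w (lin Φ t q v) = tri b q w v := by
    intro v t
    have := is_const_of_deriv_eq_zero (fun t => (hψ v t).differentiableAt)
      (fun t => by rw [(hψ v t).deriv, hψB]) t 0
    rw [this, hl0]
  have hlam : ⟪w, B w⟫ = 0 := by
    have hb : ∀ t, ⟪w, B (lin Φ t q w)⟫ = (⟪w, B w⟫ / ⟪w, w⟫) * ⟪w, lin Φ t q w⟫ := by
      intro t
      rw [hdec (lin Φ t q w), hψc, tri_self2]
      simp only [inner_add_right, real_inner_smul_right]
      ring
    have := ode_per (f := fun s => ⟪w, lin Φ s q w⟫) (fun t => by rw [← hb]; exact hχ w t)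
      Real.two_pi_pos (by rw [hl0, hl1]) (by rw [hl0]; exact hww)
    exact (div_eq_zero_iff.1 this).resolve_right hww
  have hc : ⟪w, B u⟫ = 0 := by
    have hb : ∀ t, ⟪w, B (lin Φ t q u)⟫ = ⟪w, B u⟫ := by
      intro t
      rw [hdec (lin Φ t q u), hψc]
      simp only [inner_add_right, real_inner_smul_right, hlam, div_self hup.ne']
      ring
    obtain ⟨t, _, ht⟩ := exists_hasDerivAt_eq_zero (f := fun s => ⟪w, lin Φ s q u⟫) Real.two_pi_pos
      (fun t _ => (hχ u t).continuousAt.continuousWithinAt) (by rw [hl0, hl1]) (fun t _ => hχ u t)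
    rw [hb] at ht; exact ht
  ext v
  apply tri_eq_zero b hq hw hqw (hBo v) (hψB v)
  rw [hdec v]
  simp only [inner_add_right, real_inner_smul_right, hlam, hc, mul_zero, add_zero]

end nondeg
end

section
set_option maxSynthPendingDepth 3
open Set Filter Topology
open scoped Manifold ContDiff RealInnerProductSpace

section yorke
variable {E : Type*} [NormedAddCommGroup E] [InnerProductSpace ℝ E]
variable {Φ : ℝ × E → E} (F : FlowData Φ)
include F

theorem flow_cont {x : E} (hx : x ≠ 0) : Continuous fun t => Φ (t, x) :=
  continuous_iff_continuousAt.2 fun _ => (F.hasDerivAt hx).continuousAt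

theorem yorke {q : E} (hq : q ≠ 0) (h : gen Φ q = 0) (hB : fderiv ℝ (gen Φ) q = 0) :
    ∀ᶠ x in 𝓝 q, gen Φ x = 0 := by
  have hstr : HasStrictFDerivAt (gen Φ) (0 : E →L[ℝ] E) q := by
    rw [← hB]; exact (F.contDiffAt_gen hq).hasStrictFDerivAt (by simp)
  obtain ⟨s, hs, hlip⟩ := hstr.exists_lipschitzOnWith_of_nnnorm_lt (1/10) (by simp)
  have hfix := F.fixed_of_gen hq h
  have hev : ∀ᶠ x in 𝓝 q, ∀ t ∈ Icc (0:ℝ) (2 * Real.pi), Φ (t, x) ∈ s := by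
    apply isCompact_Icc.eventually_forall_of_forall_eventually
    intro t _
    have h1 : ContinuousAt (fun z : E × ℝ => Φ (z.2, z.1)) (q, t) :=
      (F.smooth t q hq).continuousAt.comp (f := fun z : E × ℝ => (z.2, z.1)) (x := (q, t)) (by fun_prop)
    apply h1
    simpa [hfix] using hs
  filter_upwards [hev, isOpen_ne.mem_nhds hq] with x hxs hx0
  have hpi : (0:ℝ) < 2 * Real.pi := Real.two_pi_pos
  have hpi10 : 2 * Real.pi < 8 := by have := Real.pi_lt_four; linarith
  set y : ℝ → E := fun t => Φ (t, x) with hy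
  have hd : ∀ t, HasDerivAt y (gen Φ (y t)) t := fun t => F.hasDerivAt hx0
  have hgc : Continuous fun t => gen Φ (y t) := continuous_iff_continuousAt.2 fun t =>
    (F.contDiffAt_gen (F.ne_zero (t := t) hx0)).continuousAt.comp (f := y) (hd t).continuousAt
  obtain ⟨t0, ht0, hmax⟩ := isCompact_Icc.exists_isMaxOn (⟨0, left_mem_Icc.2 hpi.le⟩ : (Icc (0:ℝ) (2 * Real.pi)).Nonempty) hgc.norm.continuousOn
  set M := ‖gen Φ (y t0)‖ with hM
  have hmax' : ∀ t ∈ Icc (0:ℝ) (2 * Real.pi), ‖gen Φ (y t)‖ ≤ M := fun t ht => hmax ht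
  have hM0 : 0 ≤ M := norm_nonneg _
  have hφ : ∀ t, HasDerivAt (fun s => ⟪gen Φ (y t0), y s⟫) ⟪gen Φ (y t0), gen Φ (y t)⟫ t := fun t =>
    (innerSL ℝ (gen Φ (y t0))).hasFDerivAt.comp_hasDerivAt t (hd t)
  obtain ⟨s0, hs0, hs0'⟩ := exists_hasDerivAt_eq_zero hpi
      (fun t _ => (hφ t).continuousAt.continuousWithinAt) (by simp only [hy, F.zero, F.per]) (fun t _ => hφ t)
  have hs0m : s0 ∈ Icc (0:ℝ) (2 * Real.pi) := Ioo_subset_Icc_self hs0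
  have hdist : ‖y t0 - y s0‖ ≤ M * 8 := by
    have h1 := (convex_Icc (0:ℝ) (2 * Real.pi)).norm_image_sub_le_of_norm_hasDerivWithin_le
      (f := y) (f' := fun t => gen Φ (y t)) (C := M) (fun t _ => (hd t).hasDerivWithinAt) hmax' hs0m ht0
    refine h1.trans (mul_le_mul_of_nonneg_left ?_ hM0)
    rw [Real.norm_eq_abs, abs_le]
    constructor <;> [linarith [ht0.1, hs0m.2]; linarith [ht0.2, hs0m.1]]
  have hl := hlip.norm_sub_le (hxs t0 ht0) (hxs s0 hs0m)
  have hl' : ‖gen Φ (y t0) - gen Φ (y s0)‖ ≤ (1/10) * (M * 8) := by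
    refine hl.trans ?_
    have : (((1/10 : NNReal)) : ℝ) = 1/10 := by norm_num
    rw [this]
    exact mul_le_mul_of_nonneg_left hdist (by norm_num)
  have h5 : M ^ 2 ≤ M * ((1/10) * (M * 8)) := by
    have e : M ^ 2 = ⟪gen Φ (y t0), gen Φ (y t0) - gen Φ (y s0)⟫ := by
      rw [inner_sub_right, hs0', sub_zero, real_inner_self_eq_norm_sq]
    rw [e]
    exact (real_inner_le_norm _ _).trans (mul_le_mul_of_nonneg_left hl' hM0)
  have hM00 : M = 0 := by nlinarith
  have h6 := hmax' 0 (left_mem_Icc.2 hpi.le)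
  rw [hM00, norm_le_zero_iff] at h6
  simpa [hy, F.zero] using h6

theorem gen_zero_of_flat (hrank : 1 < Module.rank ℝ E) {q : E} (hq : q ≠ 0) (h : gen Φ q = 0)
    (hB : fderiv ℝ (gen Φ) q = 0) (x : E) (hx : x ≠ 0) : gen Φ x = 0 := by
  have hc := (isConnected_compl_singleton_of_one_lt_rank hrank (0:E)).isPreconnected
  have hsub : ({0}ᶜ : Set E) ⊆ {x | ∀ᶠ y in 𝓝 x, gen Φ y = 0} := by
    apply hc.subset_of_closure_inter_subset isOpen_setOfPred_eventually_nhds ⟨q, hq, yorke F hq h hB⟩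
    rintro z ⟨hz, hz0⟩
    have hz0' : z ≠ 0 := hz0
    have hfr := mem_closure_iff_frequently.1 hz
    apply yorke F hz0'
    · by_contra hne
      have := (F.contDiffAt_gen hz0').continuousAt.eventually_ne hne
      obtain ⟨y, hy1, hy2⟩ := (hfr.and_eventually this).exists
      have hy1' : ∀ᶠ z in 𝓝 y, gen Φ z = 0 := hy1
      exact hy2 hy1'.self_of_nhds
    · by_contra hne
      have := ((F.contDiffAt_gen hz0').fderiv_right (m := ∞) (by simp)).continuousAt.eventually_ne hne
      obtain ⟨y, hy1, hy2⟩ := (hfr.and_eventually this).exists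
      apply hy2
      have hy1' : gen Φ =ᶠ[𝓝 y] fun _ => (0:E) := hy1
      rw [hy1'.fderiv_eq]; simp
  have h1 : ∀ᶠ y in 𝓝 x, gen Φ y = 0 := hsub hx
  exact h1.self_of_nhds

end yorke
end

section
open Set Filter Topology

theorem mountain_pass {X : Type*} [TopologicalSpace X] [CompactSpace X] [T2Space X]
    [LocallyConnectedSpace X] [PreconnectedSpace X] (h : X → ℝ) (hc : Continuous h)
    (hd : ∀ z, (∀ᶠ y in 𝓝 z, y ≠ z → h z < h y) ∨
      ((∀ᶠ y in 𝓝 z, h y = h z → y ∈ closure {x | h x < h y}) ∧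
        ∃ U ∈ 𝓝 z, IsPreconnected (U ∩ {x | h x < h z})))
    {m1 m2 : X} (hm1 : ∀ᶠ y in 𝓝 m1, y ≠ m1 → h m1 < h y)
    (hm2 : ∀ᶠ y in 𝓝 m2, y ≠ m2 → h m2 < h y) : m1 = m2 := by
  by_contra hne
  set S : Set ℝ := {c | ∃ C : Set X, IsPreconnected C ∧ m1 ∈ C ∧ m2 ∈ C ∧ C ⊆ {x | h x < c}} with hS
  have hSne : S.Nonempty := by
    obtain ⟨M, hM⟩ := (isCompact_univ.image hc).bddAbove
    refine ⟨M + 1, univ, isPreconnected_univ, mem_univ _, mem_univ _, fun x _ => ?_⟩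
    have := hM (mem_image_of_mem h (mem_univ x))
    simp only [mem_ofPred_eq]; linarith
  have hb1 : ∀ c ∈ S, h m1 ≤ c := by
    rintro c ⟨C, -, h1, -, h3⟩; exact (h3 h1).le
  have hb2 : ∀ c ∈ S, h m2 ≤ c := by
    rintro c ⟨C, -, -, h1, h3⟩; exact (h3 h1).le
  have hbdd : BddBelow S := ⟨_, hb1⟩
  set c := sInf S with hcdef
  have hc1 : h m1 ≤ c := le_csInf hSne hb1
  have hc2 : h m2 ≤ c := le_csInf hSne hb2
  set A : Set X := {y | ∃ c' < c, ∃ C : Set X, IsPreconnected C ∧ m1 ∈ C ∧ y ∈ C ∧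
    C ⊆ {x | h x < c'}} with hA
  have hm2A : m2 ∉ A := by
    rintro ⟨c', hc', C, h1, h2, h3, h4⟩
    exact absurd (csInf_le hbdd (show c' ∈ S from ⟨C, h1, h2, h3, h4⟩)) (not_le.2 hc')
  have hAO : ∀ y ∈ A, h y < c := by
    rintro y ⟨c', hc', C, h1, h2, h3, h4⟩
    exact lt_trans (h4 h3) hc'
  -- key extension
  have hext : ∀ y, h y < c → ∃ V, IsOpen V ∧ y ∈ V ∧ ((V ∩ A).Nonempty → V ⊆ A) := by
    intro y hy
    obtain ⟨c', hc'1, hc'2⟩ := exists_between hy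
    have hopen : IsOpen {x | h x < c'} := isOpen_lt hc continuous_const
    refine ⟨connectedComponentIn {x | h x < c'} y, hopen.connectedComponentIn,
      mem_connectedComponentIn hc'1, ?_⟩
    rintro ⟨w, hw1, c2, hc2', C, h1, h2, h3, h4⟩ v hv
    refine ⟨max c' c2, max_lt hc'2 hc2', C ∪ connectedComponentIn {x | h x < c'} y,
      IsPreconnected.union w h3 hw1 h1 isPreconnected_connectedComponentIn, Or.inl h2, Or.inr hv, ?_⟩
    rintro x (hx | hx)
    · have h5 : h x < c2 := h4 hx
      exact lt_of_lt_of_le h5 (le_max_right _ _)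
    · have h5 : h x < c' := connectedComponentIn_subset {x | h x < c'} y hx
      exact lt_of_lt_of_le h5 (le_max_left _ _)
  have hAopen : IsOpen A := by
    rw [isOpen_iff_mem_nhds]
    intro y hy
    obtain ⟨V, h1, h2, h3⟩ := hext y (hAO y hy)
    exact mem_of_superset (h1.mem_nhds h2) (h3 ⟨y, h2, hy⟩)
  have hAcl : ∀ y ∈ closure A, h y < c → y ∈ A := by
    intro y hy hyc
    obtain ⟨V, h1, h2, h3⟩ := hext y hyc
    exact h3 (mem_closure_iff.1 hy V h1 h2) h2
  have hnostrict : ∀ z ∈ closure A, h z = c → ¬ (∀ᶠ y in 𝓝 z, y ≠ z → h z < h y) := by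
    intro z hz hzc hev
    obtain ⟨y, hy, hyA⟩ := mem_closure_iff_nhds.1 hz _ hev
    have h1 := hAO y hyA
    have h2 : y ≠ z := by rintro rfl; linarith
    have := hy h2
    linarith
  have hAle : ∀ y ∈ closure A, h y ≤ c := by
    intro y hy
    have : closure A ⊆ {x | h x ≤ c} :=
      closure_minimal (fun y hy => (hAO y hy).le) (isClosed_le hc continuous_const)
    exact this hy
  set A1 := insert m1 (closure A) with hA1
  have hA1closed : IsClosed A1 := by
    rw [hA1, insert_eq]; exact isClosed_singleton.union isClosed_closure
  have hm2A1 : m2 ∉ A1 := by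
    rintro (h1 | h1)
    · exact hne h1.symm
    · rcases lt_or_eq_of_le hc2 with h2 | h2
      · exact hm2A (hAcl _ h1 h2)
      · exact hnostrict _ h1 h2 hm2
  have hclaim : ∀ z ∈ A1, ∃ V, IsOpen V ∧ z ∈ V ∧ ∀ y ∈ V, h y ≤ c → y ∈ A1 := by
    have hinA : ∀ z ∈ A, ∃ V, IsOpen V ∧ z ∈ V ∧ ∀ y ∈ V, h y ≤ c → y ∈ A1 :=
      fun z hz => ⟨A, hAopen, hz, fun y hy _ => Or.inr (subset_closure hy)⟩
    rintro z (rfl | hz)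
    · rcases lt_or_eq_of_le hc1 with h2 | h2
      · apply hinA
        obtain ⟨c', hc'1, hc'2⟩ := exists_between h2
        exact ⟨c', hc'2, {z}, isPreconnected_singleton, rfl, rfl, by rintro x rfl; exact hc'1⟩
      · obtain ⟨V, hV, h3, h4⟩ := eventually_nhds_iff.1 hm1
        refine ⟨V, h3, h4, fun y hy hyc => ?_⟩
        by_contra h5
        have : y ≠ z := by rintro rfl; exact h5 (Or.inl rfl)
        have := hV y hy this
        linarith
    · rcases lt_or_eq_of_le (hAle z hz) with h2 | h2
      · exact hinA z (hAcl z hz h2)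
      · rcases hd z with h3 | ⟨h3, U, hU, hUp⟩
        · exact absurd h3 (hnostrict z hz h2)
        · have hsub : U ∩ {x | h x < h z} ⊆ A := by
            apply hUp.subset_of_closure_inter_subset hAopen
            · obtain ⟨y, hy1, hy2⟩ := mem_closure_iff_nhds.1 hz U hU
              exact ⟨y, ⟨hy1, by simpa [h2] using hAO y hy2⟩, hy2⟩
            · rintro y ⟨hy1, hy2, hy3⟩
              exact hAcl y hy1 (by simpa [h2] using hy3)
          obtain ⟨V, hV, h5, h6⟩ := eventually_nhds_iff.1 (h3.and hU)
          refine ⟨V, h5, h6, fun y hy hyc => Or.inr ?_⟩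
          rcases lt_or_eq_of_le hyc with h7 | h7
          · exact subset_closure (hsub ⟨(hV y hy).2, by simpa [h2] using h7⟩)
          · have h8 := (hV y hy).1 (h7.trans h2.symm)
            rw [mem_closure_iff] at h8 ⊢
            intro o ho hyo
            obtain ⟨x, ⟨hx1, hx2⟩, hx3⟩ := h8 (o ∩ V) (ho.inter h5) ⟨hyo, hy⟩
            exact ⟨x, hx1, hsub ⟨(hV x hx2).2, by simpa [h2, h7] using hx3⟩⟩
  choose! V hV1 hV2 hV3 using hclaim
  set W := ⋃ z ∈ A1, V z with hW
  have hWo : IsOpen W := isOpen_biUnion hV1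
  have hA1W : A1 ⊆ W := fun z hz => mem_biUnion hz (hV2 z hz)
  have hWA : ∀ y ∈ W, h y ≤ c → y ∈ A1 := by
    intro y hy hyc
    obtain ⟨z, hz, hyz⟩ := mem_iUnion₂.1 hy
    exact hV3 z hz y hyz hyc
  obtain ⟨V', hV'o, hV'1, hV'2⟩ := normal_exists_closure_subset hA1closed hWo hA1W
  have hfr : ∃ c1 > c, ∀ y ∈ closure V' \ V', c1 ≤ h y := by
    have hcomp : IsCompact (closure V' \ V') := isClosed_closure.isCompact.diff hV'o
    rcases (closure V' \ V').eq_empty_or_nonempty with he | hne'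
    · exact ⟨c + 1, by linarith, by simp [he]⟩
    · obtain ⟨y, hy, hymin⟩ := hcomp.exists_isMinOn hne' hc.continuousOn
      refine ⟨h y, ?_, fun z hz => hymin hz⟩
      by_contra hcon
      exact hy.2 (hV'1 (hWA y (hV'2 hy.1) (not_lt.1 hcon)))
  obtain ⟨c1, hc1', hfr⟩ := hfr
  obtain ⟨c2, ⟨C, hC1, hC2, hC3, hC4⟩, hc2'⟩ := exists_lt_of_csInf_lt hSne hc1'
  have : C ⊆ V' := by
    apply hC1.subset_of_closure_inter_subset hV'o ⟨m1, hC2, hV'1 (Or.inl rfl)⟩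
    rintro y ⟨hy1, hy2⟩
    by_contra hy3
    have := hfr y ⟨hy1, hy3⟩
    have := hC4 hy2
    simp only [mem_ofPred_eq] at this
    linarith
  exact hm2A1 (hWA m2 (hV'2 (subset_closure (this hC3))) hc2)
end

section
set_option maxSynthPendingDepth 3
open Set Filter Topology
open scoped Manifold ContDiff RealInnerProductSpace

section punct
theorem rank_E2 : 1 < Module.rank ℝ (EuclideanSpace ℝ (Fin 2)) := by
  rw [← Module.finrank_eq_rank]; simp

theorem punct {X : Type*} [TopologicalSpace X] [ChartedSpace (EuclideanSpace ℝ (Fin 2)) X] (q : X)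
    (N : Set X) (hN : N ∈ 𝓝 q) : ∃ U ∈ 𝓝 q, U ⊆ N ∧ IsPreconnected (U \ {q}) := by
  set e := chartAt (EuclideanSpace ℝ (Fin 2)) q with he
  have hq : q ∈ e.source := mem_chart_source _ q
  have hs : ContinuousAt e.symm (e q) := e.continuousAt_symm (e.map_source hq)
  have hA : e.target ∩ e.symm ⁻¹' N ∈ 𝓝 (e q) := by
    refine inter_mem (e.open_target.mem_nhds (e.map_source hq)) (hs ?_)
    rwa [e.left_inv hq]
  obtain ⟨r, hr, hball⟩ := Metric.mem_nhds_iff.1 hA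
  refine ⟨e.symm '' Metric.ball (e q) r, ?_, ?_, ?_⟩
  · have h1 : e.source ∩ e ⁻¹' Metric.ball (e q) r ∈ 𝓝 q :=
      inter_mem (e.open_source.mem_nhds hq) (e.continuousAt hq (Metric.ball_mem_nhds _ hr))
    refine mem_of_superset h1 ?_
    rintro x ⟨hx, hx2⟩
    exact ⟨e x, hx2, e.left_inv hx⟩
  · rintro _ ⟨y, hy, rfl⟩
    exact (hball hy).2
  · set u := OpenPartialHomeomorph.univBall (e q) r with hu
    have hus : u.source = univ := OpenPartialHomeomorph.univBall_source _ _
    have hut : u.target = Metric.ball (e q) r := OpenPartialHomeomorph.univBall_target _ hr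
    have hu0 : u 0 = e q := OpenPartialHomeomorph.univBall_apply_zero _ _
    have hum : ∀ x, u x ∈ Metric.ball (e q) r := fun x => by
      rw [← hut]; exact u.map_source (by rw [hus]; trivial)
    have heq : e.symm '' Metric.ball (e q) r \ {q} = (fun x => e.symm (u x)) '' {0}ᶜ := by
      ext x
      constructor
      · rintro ⟨⟨y, hy, rfl⟩, hne⟩
        have hy' : y ∈ u.target := by rw [hut]; exact hy
        refine ⟨u.symm y, ?_, by simp only [u.right_inv hy']⟩
        intro h0
        have h0' : u.symm y = 0 := h0
        apply hne
        have : y = e q := by rw [← u.right_inv hy', h0', hu0]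
        rw [this, e.left_inv hq]; rfl
      · rintro ⟨y, hy, rfl⟩
        refine ⟨⟨u y, hum y, rfl⟩, ?_⟩
        intro h0
        have h0' : e.symm (u y) = q := h0
        apply hy
        have h1 : u y = e q := by rw [← h0', e.right_inv (hball (hum y)).1]
        rw [← hu0] at h1
        exact u.injOn (by rw [hus]; trivial) (by rw [hus]; trivial) h1
    rw [heq]
    refine (isConnected_compl_singleton_of_one_lt_rank rank_E2 0).isPreconnected.image _ ?_
    have hc : Continuous u := by
      rw [← continuousOn_univ, ← hus]; exact u.continuousOn
    exact (e.continuousOn_symm.comp hc.continuousOn fun x _ => (hball (hum x)).1)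
end punct

section regular
variable {V : Type*} [NormedAddCommGroup V] [NormedSpace ℝ V] [FiniteDimensional ℝ V]

theorem regular_nhd (H : V → ℝ) (H' : V →L[ℝ] ℝ) (z : V) (hH : HasStrictFDerivAt H H' z) (hne : H' ≠ 0)
    (N : Set V) (hN : N ∈ 𝓝 z) :
    ∃ U ∈ 𝓝 z, U ⊆ N ∧ IsPreconnected (U ∩ {x | H x < H z}) := by
  haveI : CompleteSpace V := FiniteDimensional.complete ℝ V
  have hr : H'.range = ⊤ := by
    apply LinearMap.range_eq_top.2
    apply LinearMap.surjective
    intro h; apply hne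
    ext v
    exact congrArg (fun l : V →ₗ[ℝ] ℝ => l v) h
  set e := hH.implicitToOpenPartialHomeomorph H H' hr with he
  have hfst : ∀ x, (e x).1 = H x := hH.implicitToOpenPartialHomeomorph_fst hr
  have hz : z ∈ e.source := hH.mem_implicitToOpenPartialHomeomorph_source hr
  have hs : ContinuousAt e.symm (e z) := e.continuousAt_symm (e.map_source hz)
  have hA : e.target ∩ e.symm ⁻¹' N ∈ 𝓝 (e z) := by
    refine inter_mem (e.open_target.mem_nhds (e.map_source hz)) (hs ?_)
    rwa [e.left_inv hz]
  obtain ⟨r, hr, hball⟩ := Metric.mem_nhds_iff.1 hA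
  refine ⟨e.symm '' Metric.ball (e z) r, ?_, ?_, ?_⟩
  · have h1 : e.source ∩ e ⁻¹' Metric.ball (e z) r ∈ 𝓝 z :=
      inter_mem (e.open_source.mem_nhds hz) (e.continuousAt hz (Metric.ball_mem_nhds _ hr))
    refine mem_of_superset h1 ?_
    rintro x ⟨hx, hx2⟩
    exact ⟨e x, hx2, e.left_inv hx⟩
  · rintro _ ⟨y, hy, rfl⟩
    exact (hball hy).2
  · have heq : e.symm '' Metric.ball (e z) r ∩ {x | H x < H z}
        = e.symm '' (Metric.ball (e z) r ∩ {p | p.1 < H z}) := by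
      ext x
      constructor
      · rintro ⟨⟨y, hy, rfl⟩, hlt⟩
        refine ⟨y, ⟨hy, ?_⟩, rfl⟩
        have hlt' : H (e.symm y) < H z := hlt
        rw [← hfst, e.right_inv (hball hy).1] at hlt'
        exact hlt'
      · rintro ⟨y, ⟨hy, hlt⟩, rfl⟩
        refine ⟨⟨y, hy, rfl⟩, ?_⟩
        have hlt' : y.1 < H z := hlt
        change H (e.symm y) < H z
        rw [← hfst, e.right_inv (hball hy).1]
        exact hlt'
    rw [heq]
    refine IsPreconnected.image ?_ _ (e.continuousOn_symm.mono fun x hx => (hball hx.1).1)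
    refine ((convex_ball _ _).inter ?_).isPreconnected
    exact convex_halfSpace_lt (LinearMap.fst ℝ ℝ _).isLinear (H z)
end regular
end

section
set_option maxSynthPendingDepth 3
open Set Filter Topology
open scoped Manifold ContDiff RealInnerProductSpace

section pot
variable {E : Type*} [NormedAddCommGroup E] [InnerProductSpace ℝ E]

structure PotData (H : E → ℝ) (α : E → E →L[ℝ] ℝ) : Prop where
  der : ∀ x, x ≠ 0 → HasFDerivAt H (α x) x
  cont : ∀ x, x ≠ 0 → ContinuousAt α x
  self : ∀ x, x ≠ 0 → α x x = 0

theorem PotData.neg {H : E → ℝ} {α : E → E →L[ℝ] ℝ} (P : PotData H α) :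
    PotData (fun x => - H x) (fun x => - α x) :=
  ⟨fun x hx => (P.der x hx).neg, fun x hx => (P.cont x hx).neg, fun x hx => by simp [P.self x hx]⟩

theorem PotData.hom {H : E → ℝ} {α : E → E →L[ℝ] ℝ} (P : PotData H α) {x : E} (hx : x ≠ 0) {c : ℝ}
    (hc : 0 < c) : H (c • x) = H x := by
  have h1 : ∀ s ∈ Ioi (0:ℝ), HasDerivAt (fun s : ℝ => H (s • x)) 0 s := by
    intro s hs
    have hs' : (0:ℝ) < s := hs
    have hne : s • x ≠ 0 := smul_ne_zero hs'.ne' hx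
    have h2 : HasDerivAt (fun s : ℝ => s • x) x s := by
      simpa using (hasDerivAt_id s).smul_const x
    have h3 := (P.der _ hne).comp_hasDerivAt s h2
    have h4 : α (s • x) x = 0 := by
      have := P.self _ hne
      rw [map_smul, smul_eq_mul] at this
      exact (mul_eq_zero.1 this).resolve_left hs'.ne'
    rw [h4] at h3
    exact h3
  have := isOpen_Ioi.is_const_of_deriv_eq_zero (convex_Ioi (0:ℝ)).isPreconnected
    (fun s hs => (h1 s hs).differentiableAt.differentiableWithinAt) (fun s hs => (h1 s hs).deriv)
    (x := c) (y := 1) hc (zero_lt_one' ℝ)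
  simpa using this

open Classical in
noncomputable def pr (z : Metric.sphere (0:E) 1) (x : E) : Metric.sphere (0:E) 1 :=
  if hx : x ≠ 0 then ⟨‖x‖⁻¹ • x, by simp [norm_smul, hx]⟩ else z

theorem pr_coe (z : Metric.sphere (0:E) 1) {x : E} (hx : x ≠ 0) : (pr z x : E) = ‖x‖⁻¹ • x := by
  simp [pr, hx]

theorem sph_ne (z : Metric.sphere (0:E) 1) : (z : E) ≠ 0 := ne_zero_of_mem_unit_sphere z

theorem pr_self (z y : Metric.sphere (0:E) 1) : pr z y = y := by
  apply Subtype.ext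
  rw [pr_coe z (sph_ne y)]; simp

theorem pr_cont (z : Metric.sphere (0:E) 1) {x : E} (hx : x ≠ 0) : ContinuousAt (pr z) x := by
  rw [Topology.IsInducing.subtypeVal.continuousAt_iff]
  have h1 : ContinuousAt (fun y : E => ‖y‖⁻¹ • y) x :=
    (continuousAt_id.norm.inv₀ (norm_ne_zero_iff.2 hx)).smul continuousAt_id
  refine h1.congr ?_
  filter_upwards [isOpen_ne.mem_nhds hx] with y hy
  exact (pr_coe z hy).symm

variable {H : E → ℝ} {α : E → E →L[ℝ] ℝ} (P : PotData H α)
include P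

theorem PotData.pr (z : Metric.sphere (0:E) 1) {x : E} (hx : x ≠ 0) : H (pr z x) = H x := by
  rw [pr_coe z hx, P.hom hx (inv_pos.2 (norm_pos_iff.2 hx))]

theorem PotData.crit (y : Metric.sphere (0:E) 1) (h : ∀ᶠ x : Metric.sphere (0:E) 1 in 𝓝 y, H y ≤ H x) :
    α y = 0 := by
  have hy := sph_ne y
  have h1 : Tendsto (_root_.pr y) (𝓝 (y:E)) (𝓝 y) := by
    have := pr_cont y hy
    rwa [ContinuousAt, pr_self] at this
  have h2 : IsLocalMin H (y:E) := by
    filter_upwards [h1.eventually h, isOpen_ne.mem_nhds hy] with x hx hx0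
    rwa [P.pr y hx0] at hx
  exact h2.hasFDerivAt_eq_zero (P.der _ hy)

theorem PotData.contS : Continuous fun x : Metric.sphere (0:E) 1 => H x :=
  continuous_iff_continuousAt.2 fun x =>
    (P.der _ (sph_ne x)).continuousAt.comp (f := ((↑) : Metric.sphere (0:E) 1 → E)) continuous_subtype_val.continuousAt

variable [hfr : Fact (Module.finrank ℝ E = 2 + 1)]
omit P in
theorem finE : FiniteDimensional ℝ E := Module.finite_of_finrank_eq_succ hfr.out

omit P in
theorem rankE : 1 < Module.rank ℝ E := by
  haveI : FiniteDimensional ℝ E := finE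
  rw [← Module.finrank_eq_rank, hfr.out]; norm_num

omit P in
theorem connS : ConnectedSpace (Metric.sphere (0:E) 1) :=
  isConnected_iff_connectedSpace.1 (isConnected_sphere rankE 0 zero_le_one)

omit P in
theorem nontrS : Nontrivial (Metric.sphere (0:E) 1) := by
  haveI : ConnectedSpace (Metric.sphere (0:E) 1) := connS
  obtain ⟨x⟩ : Nonempty (Metric.sphere (0:E) 1) := inferInstance
  refine ⟨x, -x, fun h => ?_⟩
  have h1 := congrArg (Subtype.val) h
  have h2 : (x:E) = -(x:E) := h1
  have h3 : (2:ℝ) • (x:E) = 0 := by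
    rw [two_smul]; nth_rw 2 [h2]; simp
  exact sph_ne x ((smul_eq_zero.1 h3).resolve_left two_ne_zero)

omit P in
theorem nonisol (q : Metric.sphere (0:E) 1) : (𝓝[≠] q).NeBot := by
  haveI : ConnectedSpace (Metric.sphere (0:E) 1) := connS
  haveI : Nontrivial (Metric.sphere (0:E) 1) := nontrS
  infer_instance

def SMin (H : E → ℝ) (q : Metric.sphere (0:E) 1) : Prop := ∀ᶠ y : Metric.sphere (0:E) 1 in 𝓝 q, y ≠ q → H q < H y

theorem PotData.hd (hcl : ∀ z : Metric.sphere (0:E) 1, α z ≠ 0 ∨ SMin H z ∨ SMin (fun x => - H x) z)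
    (z : Metric.sphere (0:E) 1) : SMin H z ∨
      ((∀ᶠ y : Metric.sphere (0:E) 1 in 𝓝 z, H y = H z → y ∈ closure {x : Metric.sphere (0:E) 1 | H x < H y}) ∧
        ∃ U ∈ 𝓝 z, IsPreconnected (U ∩ {x : Metric.sphere (0:E) 1 | H x < H z})) := by
  haveI : FiniteDimensional ℝ E := finE
  rcases hcl z with hz | hz | hz
  · right
    have hz0 := sph_ne z
    constructor
    · have h1 : ∀ᶠ y : Metric.sphere (0:E) 1 in 𝓝 z, α y ≠ 0 :=
        ((P.cont _ hz0).comp (f := ((↑) : Metric.sphere (0:E) 1 → E)) continuous_subtype_val.continuousAt).eventually_ne hz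
      filter_upwards [h1] with y hy _
      by_contra hcl
      rw [mem_closure_iff_frequently, not_frequently] at hcl
      apply hy
      apply P.crit
      filter_upwards [hcl] with x hx
      exact not_lt.1 fun h => hx h
    · have hst : HasStrictFDerivAt H (α z) z := hasStrictFDerivAt_of_hasFDerivAt_of_continuousAt
        (by filter_upwards [isOpen_ne.mem_nhds hz0] with x hx using P.der x hx) (P.cont _ hz0)
      obtain ⟨U, hU, hUN, hUc⟩ := regular_nhd H (α z) z hst hz {0}ᶜ (isOpen_ne.mem_nhds hz0)
      refine ⟨_root_.pr z '' U, ?_, ?_⟩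
      · have : ((↑) : Metric.sphere (0:E) 1 → E) ⁻¹' U ∈ 𝓝 z := continuous_subtype_val.continuousAt hU
        refine mem_of_superset this fun x hx => ⟨x, hx, pr_self z x⟩
      · have heq : _root_.pr z '' U ∩ {x : Metric.sphere (0:E) 1 | H x < H z} = _root_.pr z '' (U ∩ {x | H x < H z}) := by
          ext x
          constructor
          · rintro ⟨⟨y, hy, rfl⟩, hlt⟩
            refine ⟨y, ⟨hy, ?_⟩, rfl⟩
            have hlt' : H (_root_.pr z y) < H z := hlt
            rw [P.pr z (hUN hy)] at hlt'
            exact hlt'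
          · rintro ⟨y, ⟨hy, hlt⟩, rfl⟩
            refine ⟨⟨y, hy, rfl⟩, ?_⟩
            change H (_root_.pr z y) < H z
            rw [P.pr z (hUN hy)]
            exact hlt
        rw [heq]
        exact hUc.image _ fun x hx => (pr_cont z (hUN hx.1)).continuousWithinAt
  · exact Or.inl hz
  · right
    have hz' : ∀ᶠ y : Metric.sphere (0:E) 1 in 𝓝 z, y ≠ z → H y < H z := by
      filter_upwards [hz] with y hy hne
      have := hy hne
      linarith
    haveI := nonisol z
    constructor
    · filter_upwards [hz'] with y hy heq
      have hyz : y = z := by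
        by_contra hne
        exact (hy hne).ne heq
      subst hyz
      rw [mem_closure_iff_frequently]
      have h1 : ∀ᶠ x in 𝓝[≠] y, x ∈ {x : Metric.sphere (0:E) 1 | H x < H y} := by
        filter_upwards [hz'.filter_mono nhdsWithin_le_nhds, self_mem_nhdsWithin] with x hx hne
        exact hx hne
      exact h1.frequently.filter_mono nhdsWithin_le_nhds
    · obtain ⟨U, hU, hUN, hUc⟩ := punct z _ hz'
      refine ⟨U, hU, ?_⟩
      convert hUc using 1
      ext x
      constructor
      · rintro ⟨hx, hlt⟩
        refine ⟨hx, fun h => ?_⟩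
        have h' : x = z := h
        have hlt' : H x < H z := hlt
        rw [h'] at hlt'
        exact lt_irrefl _ hlt'
      · rintro ⟨hx, hne⟩
        exact ⟨hx, hUN hx hne⟩

omit P in
theorem not_both {q : Metric.sphere (0:E) 1} (h : SMin H q) (h2 : ∀ᶠ y : Metric.sphere (0:E) 1 in 𝓝 q, H y ≤ H q) : False := by
  haveI := nonisol q
  have h1 : ∀ᶠ x in 𝓝[≠] q, False := by
    filter_upwards [Eventually.filter_mono nhdsWithin_le_nhds h, h2.filter_mono nhdsWithin_le_nhds, self_mem_nhdsWithin] with x hx hx2 hne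
    exact absurd (hx hne) (not_lt.2 hx2)
  exact h1.exists.elim fun _ h => h

theorem PotData.uniq (hcl : ∀ z : Metric.sphere (0:E) 1, α z ≠ 0 ∨ SMin H z ∨ SMin (fun x => - H x) z)
    {m1 m2 : Metric.sphere (0:E) 1} (h1 : SMin H m1) (h2 : SMin H m2) : m1 = m2 := by
  haveI : FiniteDimensional ℝ E := finE
  haveI : ProperSpace E := FiniteDimensional.proper ℝ E
  haveI : ConnectedSpace (Metric.sphere (0:E) 1) := connS
  haveI : CompactSpace (Metric.sphere (0:E) 1) := isCompact_iff_compactSpace.1 (isCompact_sphere 0 1)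
  haveI : LocallyConnectedSpace (Metric.sphere (0:E) 1) :=
    ChartedSpace.locallyConnectedSpace (EuclideanSpace ℝ (Fin 2)) _
  exact mountain_pass (fun x : Metric.sphere (0:E) 1 => H x) P.contS (P.hd hcl) h1 h2

theorem PotData.two (hcl : ∀ z : Metric.sphere (0:E) 1, α z ≠ 0 ∨ SMin H z ∨ SMin (fun x => - H x) z) :
    {z : Metric.sphere (0:E) 1 | α z = 0}.ncard = 2 := by
  haveI : FiniteDimensional ℝ E := finE
  haveI : ProperSpace E := FiniteDimensional.proper ℝ E
  haveI : ConnectedSpace (Metric.sphere (0:E) 1) := connS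
  haveI : CompactSpace (Metric.sphere (0:E) 1) := isCompact_iff_compactSpace.1 (isCompact_sphere 0 1)
  have hcl' : ∀ z : Metric.sphere (0:E) 1, (fun x => - α x) z ≠ 0 ∨ SMin (fun x => - H x) z ∨ SMin (fun x => - - H x) z := by
    intro z
    simp only [neg_neg, ne_eq, neg_eq_zero]
    rcases hcl z with h | h | h
    · exact Or.inl h
    · exact Or.inr (Or.inr h)
    · exact Or.inr (Or.inl h)
  obtain ⟨m, _, hm⟩ := isCompact_univ.exists_isMinOn univ_nonempty P.contS.continuousOn
  obtain ⟨M, _, hM⟩ := isCompact_univ.exists_isMaxOn univ_nonempty P.contS.continuousOn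
  have hm' : ∀ x : Metric.sphere (0:E) 1, H m ≤ H x := fun x => hm (mem_univ x)
  have hM' : ∀ x : Metric.sphere (0:E) 1, H x ≤ H M := fun x => hM (mem_univ x)
  have am : α m = 0 := P.crit m (Eventually.of_forall hm')
  have aM : α M = 0 := by
    have := P.neg.crit M (Eventually.of_forall fun x => neg_le_neg (hM' x))
    exact neg_eq_zero.1 this
  have sm : SMin H m := by
    rcases hcl m with h | h | h
    · exact absurd am h
    · exact h
    · exact (not_both h (Eventually.of_forall fun x => neg_le_neg (hm' x))).elim
  have sM : SMin (fun x => - H x) M := by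
    rcases hcl M with h | h | h
    · exact absurd aM h
    · exact (not_both h (Eventually.of_forall hM')).elim
    · exact h
  have hne : m ≠ M := by
    intro h
    rw [h] at sm
    exact not_both sm (Eventually.of_forall hM')
  rw [ncard_eq_two]
  refine ⟨m, M, hne, ?_⟩
  ext z
  constructor
  · intro hz
    have hz' : α z = 0 := hz
    rcases hcl z with h | h | h
    · exact absurd hz' h
    · exact Or.inl (P.uniq hcl h sm)
    · exact Or.inr (P.neg.uniq hcl' h sM)
  · rintro (h | h)
    · have h' : z = m := h
      rw [h']; exact am
    · have h' : z = M := h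
      rw [h']; exact aM

end pot
end

section
set_option maxSynthPendingDepth 3
open Set Filter Topology
open scoped Manifold ContDiff RealInnerProductSpace

section smin
variable {E : Type*} [NormedAddCommGroup E] [InnerProductSpace ℝ E]

theorem PotData.smin {H : E → ℝ} {α : E → E →L[ℝ] ℝ} (P : PotData H α) (q : Metric.sphere (0:E) 1)
    {r : ℝ} (hr : 0 < r) (h : ∀ w : E, ⟪(q:E), w⟫ = 0 → w ≠ 0 → ‖w‖ < r → 0 < α (q + w) w) : SMin H q := by
  have hqq : ⟪(q:E), (q:E)⟫ = 1 := by
    rw [real_inner_self_eq_norm_sq]; simp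
  have hc : Continuous fun y : Metric.sphere (0:E) 1 => ⟪(q:E), (y:E)⟫ := by fun_prop
  have h1 : ∀ᶠ y : Metric.sphere (0:E) 1 in 𝓝 q, 0 < ⟪(q:E), (y:E)⟫ :=
    hc.continuousAt.eventually (isOpen_Ioi.mem_nhds (by simp [hqq] : (fun y : Metric.sphere (0:E) 1 => ⟪(q:E), (y:E)⟫) q ∈ Ioi (0:ℝ)))
  have h2 : ContinuousAt (fun y : Metric.sphere (0:E) 1 => ‖(⟪(q:E), (y:E)⟫)⁻¹ • (y:E) - q‖) q := by
    have : ContinuousAt (fun y : Metric.sphere (0:E) 1 => (⟪(q:E), (y:E)⟫)⁻¹) q :=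
      hc.continuousAt.inv₀ (by simp [hqq])
    exact ((this.smul continuous_subtype_val.continuousAt).sub continuousAt_const).norm
  have h3 : ∀ᶠ y : Metric.sphere (0:E) 1 in 𝓝 q, ‖(⟪(q:E), (y:E)⟫)⁻¹ • (y:E) - q‖ < r := by
    refine h2.eventually (isOpen_Iio.mem_nhds ?_)
    simp only [hqq]; simpa using hr
  unfold SMin
  filter_upwards [h1, h3] with y hy1 hy3 hne
  set c := ⟪(q:E), (y:E)⟫ with hcd
  set w := c⁻¹ • (y:E) - q with hw
  have hqw : ⟪(q:E), w⟫ = 0 := by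
    rw [hw, inner_sub_right, real_inner_smul_right, hqq, ← hcd, inv_mul_cancel₀ hy1.ne', sub_self]
  have hw0 : w ≠ 0 := by
    intro h0
    apply hne
    rw [hw, sub_eq_zero] at h0
    have hn := congrArg norm h0
    rw [norm_smul, norm_inv, Real.norm_of_nonneg hy1.le] at hn
    have e1 : ‖(y:E)‖ = 1 := by simp
    have e2 : ‖(q:E)‖ = 1 := by simp
    rw [e1, e2, mul_one] at hn
    rw [hn, one_smul] at h0
    exact Subtype.ext h0
  have hHy : H y = H (q + w) := by
    rw [hw, add_sub_cancel, P.hom (sph_ne y) (inv_pos.2 hy1)]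
  rw [hHy]
  have hne' : ∀ s : ℝ, (q:E) + s • w ≠ 0 := by
    intro s h0
    have := congrArg (fun v => ⟪(q:E), v⟫) h0
    simp only [inner_add_right, real_inner_smul_right, hqq, hqw, inner_zero_right] at this
    norm_num at this
  have hd : ∀ s : ℝ, HasDerivAt (fun s : ℝ => H (q + s • w)) (α (q + s • w) w) s := by
    intro s
    have h2 : HasDerivAt (fun s : ℝ => (q:E) + s • w) w s := by
      simpa using ((hasDerivAt_id s).smul_const w).const_add (q:E)
    exact (P.der _ (hne' s)).comp_hasDerivAt s h2
  have hmono : StrictMonoOn (fun s : ℝ => H (q + s • w)) (Icc 0 1) := by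
    apply strictMonoOn_of_deriv_pos (convex_Icc 0 1)
    · exact fun s _ => (hd s).continuousAt.continuousWithinAt
    · intro s hs
      rw [interior_Icc] at hs
      rw [(hd s).deriv]
      have := h (s • w) (by rw [real_inner_smul_right, hqw, mul_zero]) (smul_ne_zero hs.1.ne' hw0)
        (by
          rw [norm_smul, Real.norm_of_nonneg hs.1.le]
          calc s * ‖w‖ ≤ 1 * ‖w‖ := by gcongr; exact hs.2.le
            _ = ‖w‖ := one_mul _
            _ < r := hy3)
      rw [map_smul, smul_eq_mul] at this
      exact pos_of_mul_pos_right this hs.1.le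
  have := hmono (left_mem_Icc.2 zero_le_one) (right_mem_Icc.2 zero_le_one) zero_lt_one
  simpa using this

theorem sgn_lem {K : Type*} [NormedAddCommGroup K] [InnerProductSpace ℝ K] [FiniteDimensional ℝ K]
    (hK : 1 < Module.rank ℝ K) (f : K → ℝ) (hf : Continuous f) (h0 : ∀ w, w ≠ 0 → f w ≠ 0) :
    ∃ σ : ℝ, (σ = 1 ∨ σ = -1) ∧ ∃ c > 0, ∀ w, ‖w‖ = 1 → c ≤ σ * f w := by
  have hconn := isConnected_sphere hK 0 (zero_le_one' ℝ)
  have hcomp : IsCompact (Metric.sphere (0:K) 1) := isCompact_sphere 0 1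
  have hne : ∀ w ∈ Metric.sphere (0:K) 1, f w ≠ 0 := fun w hw => h0 w (by
    rintro rfl; simp at hw)
  obtain ⟨w0, hw0⟩ := hconn.nonempty
  have main : ∀ σ : ℝ, 0 < σ * f w0 → ∃ c > 0, ∀ w, ‖w‖ = 1 → c ≤ σ * f w := by
    intro σ hσ
    have hσ0 : σ ≠ 0 := by rintro rfl; simp at hσ
    obtain ⟨w1, hw1, hmin⟩ := hcomp.exists_isMinOn hconn.nonempty (f := fun w => σ * f w) (by fun_prop)
    refine ⟨σ * f w1, ?_, fun w hw => hmin (by simpa using hw)⟩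
    by_contra hcon
    push Not at hcon
    have hI := hconn.isPreconnected.intermediate_value hw1 hw0 (f := fun w => σ * f w) (by fun_prop)
    obtain ⟨w2, hw2, h2⟩ := hI ⟨hcon, hσ.le⟩
    exact (mul_ne_zero hσ0 (hne w2 hw2)) h2
  rcases lt_or_gt_of_ne (hne w0 hw0) with hlt | hgt
  · exact ⟨-1, Or.inr rfl, main (-1) (by linarith)⟩
  · exact ⟨1, Or.inl rfl, main 1 (by linarith)⟩

variable (b : OrthonormalBasis (Fin 3) ℝ E) {Φ : ℝ × E → E} (F : FlowData Φ)

theorem alph_zero_iff (b : OrthonormalBasis (Fin 3) ℝ E) {Φ : ℝ × E → E} (F : FlowData Φ)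
    {x : E} (hx : x ≠ 0) : alph b Φ x = 0 ↔ gen Φ x = 0 := by
  obtain ⟨κ, hκ, h⟩ := alph_apply' b F x hx
  constructor
  · intro h0
    by_contra hg
    have h1 := crs_ne b hx hg (F.inner_gen hx)
    have h2 := h (crs b x (gen Φ x))
    rw [h0] at h2
    have := mul_pos hκ h1
    simp only [ContinuousLinearMap.zero_apply] at h2
    linarith
  · intro h0
    ext v
    rw [h v, h0]; simp

theorem potData_alph (b : OrthonormalBasis (Fin 3) ℝ E) {Φ : ℝ × E → E} (F : FlowData Φ) :
    ∃ H, PotData H (alph b Φ) := by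
  obtain ⟨H, hH⟩ := exists_prim b F
  refine ⟨H, hH, fun x hx => (alph_hasFDerivAt b F x hx).continuousAt, fun x hx => ?_⟩
  obtain ⟨κ, hκ, h⟩ := alph_apply' b F x hx
  rw [h, tri_self1, mul_zero]

theorem sign_near [Fact (Module.finrank ℝ E = 2 + 1)] (b : OrthonormalBasis (Fin 3) ℝ E)
    {Φ : ℝ × E → E} (F : FlowData Φ)
    (q : Metric.sphere (0:E) 1) (h0 : gen Φ q = 0) (hB : fderiv ℝ (gen Φ) q ≠ 0) :
    ∃ σ : ℝ, (σ = 1 ∨ σ = -1) ∧ ∃ r > 0, ∀ w : E, ⟪(q:E), w⟫ = 0 → w ≠ 0 → ‖w‖ < r →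
      0 < σ * alph b Φ (q + w) w := by
  haveI : FiniteDimensional ℝ E := b.toBasis.finiteDimensional_of_finite
  have hq := sph_ne q
  have hqq : ⟪(q:E), (q:E)⟫ = 1 := by
    rw [real_inner_self_eq_norm_sq]; simp
  set B := fderiv ℝ (gen Φ) q with hBd
  have hfr : Module.finrank ℝ (ℝ ∙ (q:E))ᗮ = 2 := Submodule.finrank_orthogonal_span_singleton hq
  have hK : 1 < Module.rank ℝ (ℝ ∙ (q:E))ᗮ := by
    rw [← Module.finrank_eq_rank, hfr]; norm_num
  obtain ⟨σ, hσ, c, hc, hcw⟩ := sgn_lem hK (fun w => tri b q (B w) (w:E)) (by fun_prop) (by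
    intro w hw hz
    have hqw : ⟪(q:E), (w:E)⟫ = 0 := Submodule.mem_orthogonal_singleton_iff_inner_right.1 w.2
    exact hB (nondeg b F hq h0 (by simpa using hw) hqw hz))
  refine ⟨σ, hσ, ?_⟩
  have hσ1 : |σ| = 1 := by rcases hσ with rfl | rfl <;> simp
  set M := ‖tri b (q:E)‖ + 1 with hM
  have hMp : 0 < M := by positivity
  have hlo := (gen_hasFDerivAt F hq).isLittleO
  have hev := hlo.def (c := c / (2 * M)) (by positivity)
  obtain ⟨r, hr, hball⟩ := Metric.eventually_nhds_iff.1 hev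
  refine ⟨r, hr, fun w hqw hw hwr => ?_⟩
  have hne : (q:E) + w ≠ 0 := by
    intro hz
    have := congrArg (fun v => ⟪(q:E), v⟫) hz
    simp only [inner_add_right, hqq, hqw, inner_zero_right] at this
    norm_num at this
  obtain ⟨κ, hκ, ha⟩ := alph_apply' b F _ hne
  rw [ha w]
  have e1 : tri b (q + w) (gen Φ (q + w)) w = tri b q (gen Φ (q + w)) w := by
    rw [tri_apply, tri_apply]; simp only [map_add (cc b _)]; ring
  rw [e1]
  set R := gen Φ (q + w) - B w with hR
  have hRb : ‖R‖ ≤ c / (2 * M) * ‖w‖ := by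
    have := hball (y := (q:E) + w) (by simpa [dist_eq_norm] using hwr)
    rw [h0, sub_zero, add_sub_cancel_left] at this
    exact this
  have e2 : gen Φ (q + w) = B w + R := by rw [hR]; abel
  rw [e2, map_add, ContinuousLinearMap.add_apply]
  have hwn : 0 < ‖w‖ := norm_pos_iff.2 hw
  have hmain : c * ‖w‖ ^ 2 ≤ σ * tri b q (B w) w := by
    have hm : ‖w‖⁻¹ • w ∈ (ℝ ∙ (q:E))ᗮ := by
      rw [Submodule.mem_orthogonal_singleton_iff_inner_right, real_inner_smul_right, hqw, mul_zero]
    have := hcw ⟨‖w‖⁻¹ • w, hm⟩ (by simp [norm_smul, hwn.ne'])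
    simp only [map_smul, ContinuousLinearMap.smul_apply, smul_eq_mul] at this
    have h3 := mul_le_mul_of_nonneg_right this (sq_nonneg ‖w‖)
    refine h3.trans (le_of_eq ?_)
    field_simp
  have herr : |σ * tri b q R w| ≤ c / 2 * ‖w‖ ^ 2 := by
    rw [abs_mul, hσ1, one_mul]
    have h1 : |tri b q R w| ≤ ‖tri b (q:E)‖ * ‖R‖ * ‖w‖ := (tri b (q:E)).le_opNorm₂ R w
    calc |tri b q R w| ≤ ‖tri b (q:E)‖ * ‖R‖ * ‖w‖ := h1
      _ ≤ M * (c / (2 * M) * ‖w‖) * ‖w‖ := by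
        gcongr
        rw [hM]; linarith
      _ = c / 2 * ‖w‖ ^ 2 := by field_simp
  have h5 := (abs_le.1 herr).1
  have h6 : 0 < c * ‖w‖ ^ 2 := by positivity
  have h7 : 0 < σ * (tri b q (B w) w + tri b q R w) := by
    rw [mul_add]; linarith
  calc 0 < κ * (σ * (tri b q (B w) w + tri b q R w)) := mul_pos hκ h7
    _ = _ := by ring

theorem flow_two [Fact (Module.finrank ℝ E = 2 + 1)] (b : OrthonormalBasis (Fin 3) ℝ E)
    {Φ : ℝ × E → E} (F : FlowData Φ) (hnt : ∃ x : E, x ≠ 0 ∧ gen Φ x ≠ 0) :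
    {z : Metric.sphere (0:E) 1 | gen Φ z = 0}.ncard = 2 := by
  haveI : FiniteDimensional ℝ E := b.toBasis.finiteDimensional_of_finite
  obtain ⟨H, P⟩ := potData_alph b F
  have hS : {z : Metric.sphere (0:E) 1 | gen Φ z = 0} = {z : Metric.sphere (0:E) 1 | alph b Φ z = 0} := by
    ext z
    exact (alph_zero_iff b F (sph_ne z)).symm
  rw [hS]
  apply P.two
  intro z
  by_cases hz : alph b Φ z = 0
  swap
  · exact Or.inl hz
  right
  have hg := (alph_zero_iff b F (sph_ne z)).1 hz
  have hB : fderiv ℝ (gen Φ) z ≠ 0 := by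
    intro hB
    obtain ⟨x, hx, hgx⟩ := hnt
    have hrank : 1 < Module.rank ℝ E := by
      rw [← Module.finrank_eq_rank, (Fact.out : Module.finrank ℝ E = 2 + 1)]; norm_num
    exact hgx (gen_zero_of_flat F hrank (sph_ne z) hg hB x hx)
  obtain ⟨σ, hσ, r, hr, h⟩ := sign_near b F z hg hB
  rcases hσ with rfl | rfl
  · left
    exact P.smin z hr (fun w h1 h2 h3 => by simpa using h w h1 h2 h3)
  · right
    exact P.neg.smin z hr (fun w h1 h2 h3 => by simpa using h w h1 h2 h3)
end smin

theorem final (act : Circle → S2 → S2)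
    (F : FlowData (mkFlow act)) (hnontriv : ∃ g x, act g x ≠ x) :
    {x : S2 | ∀ g, act g x = x}.ncard = 2 := by
  have hΦ : ∀ t (z : S2), mkFlow act (t, (z:E3)) = act (Circle.exp t) z := by
    intro t z
    have h1 : prj (z:E3) = z := by simpa using prj_smul 1 one_pos z
    have h2 : ‖(z:E3)‖ = 1 := by simp
    simp only [mkFlow]
    rw [h1, h2, one_smul]
  have hiff : ∀ z : S2, gen (mkFlow act) z = 0 ↔ ∀ g, act g z = z := by
    intro z
    constructor
    · intro h g
      have h1 := F.fixed_of_gen (S2.ne_zero z) h (Complex.arg g)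
      rw [hΦ, Circle.exp_arg] at h1
      exact Subtype.ext h1
    · intro h
      apply F.gen_of_fixed (S2.ne_zero z)
      intro t
      rw [hΦ, h]
  have hS : {x : S2 | ∀ g, act g x = x} = {z : S2 | gen (mkFlow act) z = 0} := by
    ext z; exact (hiff z).symm
  rw [hS]
  apply flow_two (EuclideanSpace.basisFun (Fin 3) ℝ) F
  obtain ⟨g, x, hgx⟩ := hnontriv
  exact ⟨x, S2.ne_zero x, fun h => hgx ((hiff x).1 h g)⟩
end

/-- Part (1) of Lemma 2.15: a nontrivial smooth circle action on the 2-sphere `S²`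
(the unit sphere in `ℝ³ = EuclideanSpace ℝ (Fin 3)`) has exactly two fixed points. -/
theorem stmt16
    (act : Circle → (Metric.sphere (0 : EuclideanSpace ℝ (Fin 3)) 1)
            → (Metric.sphere (0 : EuclideanSpace ℝ (Fin 3)) 1))
    (hone : ∀ x, act 1 x = x)
    (hmul : ∀ g h x, act (g * h) x = act g (act h x))
    (hsmooth : ContMDiff ((𝓡 1).prod (𝓡 2)) (𝓡 2) (⊤ : ℕ∞)
      (fun p : Circle × (Metric.sphere (0 : EuclideanSpace ℝ (Fin 3)) 1) =>
        act p.1 p.2))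
    (hnontriv : ∃ g x, act g x ≠ x) :
    {x | ∀ g, act g x = x}.ncard = 2 := by
  exact final act (mkFlow_flow act hone hmul hsmooth) hnontriv
end

section
/- Let the circle group act on the 2-torus 𝕋² := Circle × Circle (with its product smooth manifold structure) by a smooth action, i.e., the map (g, x) ↦ g • x from Circle × 𝕋² to 𝕋² is smooth. If the action is nontrivial (there exist g ∈ Circle and x ∈ 𝕋² with g • x ≠ x), then the action is fixed point free: there is no x ∈ 𝕋² with g • x = x for all g ∈ Circle. (This is part (2) of Lemma 2.15.) -/
open scoped Manifold

lemma aux_param (n : ℕ) : ∀ {E F : Type} [NormedAddCommGroup E] [NormedSpace ℝ E]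
    [FiniteDimensional ℝ E] [NormedAddCommGroup F] [NormedSpace ℝ F] [CompleteSpace F]
    (g : E × ℝ → F), ContDiff ℝ n g → ContDiff ℝ n (fun x => ∫ u in (0:ℝ)..1, g (x, u)) := by
  induction n with
  | zero =>
    intro E F _ _ _ _ _ _ g hg
    simp only [Nat.cast_zero, contDiff_zero] at hg ⊢
    exact intervalIntegral.continuous_parametric_intervalIntegral_of_continuous' (f := fun x u => g (x, u)) hg 0 1
  | succ n ih =>
    intro E F _ _ _ _ _ _ g hg
    have : ProperSpace E := FiniteDimensional.proper_real E
    have hgc : Continuous g := hg.continuous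
    have hd : Differentiable ℝ g := hg.differentiable (by simp)
    have hg' : ContDiff ℝ n (fun p : E × ℝ => (fderiv ℝ g p).comp (ContinuousLinearMap.inl ℝ E ℝ)) := by
      have : ContDiff ℝ n (fderiv ℝ g) := hg.fderiv_right (by simp)
      exact this.clm_comp contDiff_const
    have hgc' := hg'.continuous
    rw [show ((n + 1 : ℕ) : WithTop ℕ∞) = (n : ℕ) + 1 by simp, contDiff_succ_iff_hasFDerivAt]
    refine ⟨fun x => ∫ u in (0:ℝ)..1, (fderiv ℝ g (x, u)).comp (ContinuousLinearMap.inl ℝ E ℝ),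
      ih _ hg', fun x => ?_⟩
    obtain ⟨C, hC⟩ := ((isCompact_closedBall x 1).prod (isCompact_Icc (a := (0:ℝ)) (b := 1))).exists_bound_of_continuousOn
      hgc'.continuousOn
    refine (intervalIntegral.hasFDerivAt_integral_of_dominated_of_fderiv_le
      (F := fun x u => g (x, u))
      (F' := fun x u => (fderiv ℝ g (x, u)).comp (ContinuousLinearMap.inl ℝ E ℝ))
      (bound := fun _ => C) (Metric.closedBall_mem_nhds x one_pos) ?_ ?_ ?_ ?_ ?_ ?_)
    · exact Filter.Eventually.of_forall fun y => (by fun_prop : Continuous fun u => g (y, u)).aestronglyMeasurable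
    · exact (by fun_prop : Continuous fun u => g (x, u)).intervalIntegrable _ _
    · exact (hgc'.comp (by fun_prop : Continuous fun u : ℝ => (x, u))).aestronglyMeasurable
    · refine Filter.Eventually.of_forall fun u hu y hy => hC (y, u) ⟨hy, ?_⟩
      rw [Set.uIoc_of_le zero_le_one] at hu
      exact ⟨hu.1.le, hu.2⟩
    · simp
    · refine Filter.Eventually.of_forall fun u hu y hy => ?_
      exact (hd (y, u)).hasFDerivAt.comp y (hasFDerivAt_prodMk_left y u)

lemma aux_param_top {E F : Type} [NormedAddCommGroup E] [NormedSpace ℝ E]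
    [FiniteDimensional ℝ E] [NormedAddCommGroup F] [NormedSpace ℝ F] [CompleteSpace F]
    (g : E × ℝ → F) (hg : ContDiff ℝ (⊤ : ℕ∞) g) :
    ContDiff ℝ (⊤ : ℕ∞) (fun x => ∫ u in (0:ℝ)..1, g (x, u)) := by
  rw [contDiff_infty] at hg ⊢
  exact fun n => aux_param n g (hg n)

lemma aux_int {X : Type*} [TopologicalSpace X] [PreconnectedSpace X] (k : X → ℝ)
    (hk : Continuous k) (hi : ∀ x, ∃ n : ℤ, k x = n) (x y : X) : k x = k y := by
  choose n hn using hi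
  have : Continuous n := by
    rw [Int.isClosedEmbedding_coe_real.isEmbedding.continuous_iff]
    exact hk.congr hn
  rw [hn, hn, PreconnectedSpace.constant ‹_› this]

lemma aux_exp (a b : ℝ) (h : Circle.exp (2 * Real.pi * a) = Circle.exp (2 * Real.pi * b)) :
    ∃ n : ℤ, a - b = n := by
  rw [Circle.exp_eq_exp] at h
  obtain ⟨m, hm⟩ := h
  refine ⟨m, ?_⟩
  have := Real.pi_pos
  have : 2 * Real.pi * (a - b - m) = 0 := by linarith
  rcases mul_eq_zero.1 this with h | h
  · linarith
  · linarith

lemma aux_exp_fun {X : Type*} [TopologicalSpace X] [PreconnectedSpace X] (a b : X → ℝ)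
    (ha : Continuous a) (hb : Continuous b)
    (h : ∀ x, Circle.exp (2 * Real.pi * a x) = Circle.exp (2 * Real.pi * b x))
    (x₀ : X) (h0 : a x₀ = b x₀) (x : X) : a x = b x := by
  have := aux_int (fun x => a x - b x) (ha.sub hb) (fun x => aux_exp _ _ (h x)) x x₀
  simp only [h0, sub_self] at this
  linarith

lemma aux_lift {E : Type} [NormedAddCommGroup E] [NormedSpace ℝ E] [FiniteDimensional ℝ E]
    (f : ℝ × E → Circle) (hf : ContDiff ℝ (⊤ : ℕ∞) (fun p => (f p : ℂ))) :
    ∃ D : ℝ × E → ℝ, ContDiff ℝ (⊤ : ℕ∞) D ∧ (∀ v, D (0, v) = 0) ∧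
      ∀ t v, f (t, v) = f (0, v) * Circle.exp (2 * Real.pi * D (t, v)) := by
  set c : ℝ × E → ℂ := fun p => (f p : ℂ) with hc
  set c' : ℝ × E → ℂ := fun p => fderiv ℝ c p (1, 0) with hc'
  have hc's : ContDiff ℝ (⊤ : ℕ∞) c' := by
    have : ContDiff ℝ (⊤ : ℕ∞) (fderiv ℝ c) := hf.fderiv_right (by simp)
    exact this.clm_apply contDiff_const
  set b : ℝ × E → ℝ := fun p => (star (c p) * c' p).im / (2 * Real.pi) with hb
  have hbs : ContDiff ℝ (⊤ : ℕ∞) b := by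
    have h1 : ContDiff ℝ (⊤ : ℕ∞) (fun p => star (c p)) := Complex.conjCLE.contDiff.comp hf
    have h2 : ContDiff ℝ (⊤ : ℕ∞) (fun p => (star (c p) * c' p).im) :=
      Complex.imCLM.contDiff.comp (h1.mul hc's)
    exact h2.div_const _
  have hbc := hbs.continuous
  refine ⟨fun p => ∫ u in (0:ℝ)..1, p.1 * b (u * p.1, p.2), ?_, by simp, ?_⟩
  · refine aux_param_top (fun q : (ℝ × E) × ℝ => q.1.1 * b (q.2 * q.1.1, q.1.2)) ?_
    refine ContDiff.mul (by fun_prop) (hbs.comp (by fun_prop))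
  intro t v
  have hD : ∀ t, (∫ u in (0:ℝ)..1, t * b (u * t, v)) = ∫ s in (0:ℝ)..t, b (s, v) := by
    intro t
    rw [intervalIntegral.integral_const_mul, intervalIntegral.mul_integral_comp_mul_right (f := fun s => b (s, v))]
    simp
  simp only [hD]
  have hDd : ∀ t, HasDerivAt (fun t => ∫ s in (0:ℝ)..t, b (s, v)) (b (t, v)) t := fun t =>
    intervalIntegral.integral_hasDerivAt_right
      ((by fun_prop : Continuous fun s => b (s, v)).intervalIntegrable _ _)
      (by fun_prop : Continuous fun s => b (s, v)).stronglyMeasurable.stronglyMeasurableAtFilter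
      (by fun_prop : Continuous fun s => b (s, v)).continuousAt
  have hcd : ∀ t, HasDerivAt (fun t => c (t, v)) (c' (t, v)) t := by
    intro t
    have h1 : HasFDerivAt c (fderiv ℝ c (t, v)) (t, v) :=
      ((hf.differentiable (by simp)) (t, v)).hasFDerivAt
    have h2 : HasDerivAt (fun t : ℝ => (t, v)) ((1 : ℝ), (0 : E)) t :=
      (hasDerivAt_id t).prodMk (hasDerivAt_const t v)
    exact h1.comp_hasDerivAt t h2
  have hn : ∀ p, star (c p) * c p = 1 := by
    intro p
    have : c p * star (c p) = 1 := by
      simp [hc, Complex.mul_conj]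
    rw [mul_comm]; exact this
  have hre : ∀ t, c' (t, v) = 2 * Real.pi * b (t, v) * Complex.I * c (t, v) := by
    intro t
    have h1 : HasDerivAt (fun t => star (c (t, v)) * c (t, v))
        (star (c' (t, v)) * c (t, v) + star (c (t, v)) * c' (t, v)) t :=
      (hcd t).star.mul (hcd t)
    simp only [hn] at h1
    have h2 := h1.unique (hasDerivAt_const t (1:ℂ))
    have h3 : (star (c (t, v)) * c' (t, v)).re = 0 := by
      have := congrArg Complex.re h2
      simp at this ⊢
      linarith
    have h4 : star (c (t, v)) * c' (t, v) = 2 * Real.pi * b (t, v) * Complex.I := by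
      apply Complex.ext
      · rw [h3]; simp
      · have hb2 : (star (c (t, v)) * c' (t, v)).im = 2 * Real.pi * b (t, v) := by
          simp only [hb]
          have := Real.pi_pos
          field_simp
        rw [hb2]; simp
    calc c' (t, v) = (star (c (t, v)) * c (t, v)) * c' (t, v) := by rw [hn, one_mul]
      _ = (star (c (t, v)) * c' (t, v)) * c (t, v) := by ring
      _ = _ := by rw [h4]
  have hzero : ∀ t, HasDerivAt (fun t => c (t, v) *
      Complex.exp (-(2 * Real.pi * (∫ s in (0:ℝ)..t, b (s, v) : ℝ) * Complex.I))) 0 t := by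
    intro t
    have h1 := (((((hDd t).ofReal_comp).const_mul (2 * Real.pi : ℂ)).mul_const Complex.I).neg.cexp)
    have h2 := (hcd t).mul h1
    refine h2.congr_deriv ?_
    rw [hre]; ring
  have hconst := is_const_of_deriv_eq_zero (fun t => (hzero t).differentiableAt)
    (fun t => (hzero t).deriv) t 0
  simp only [intervalIntegral.integral_same, Complex.ofReal_zero, mul_zero, zero_mul, neg_zero,
    Complex.exp_zero, mul_one, Complex.exp_neg] at hconst
  apply Circle.ext
  rw [Circle.coe_mul, Circle.coe_exp]
  change c (t, v) = c (0, v) * _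
  rw [← hconst]
  push_cast
  rw [mul_assoc, inv_mul_cancel₀ (Complex.exp_ne_zero _), mul_one]

lemma aux_div (u w : ℝ × ℝ → ℝ) (hu : ContDiff ℝ (⊤ : ℕ∞) u) (hw : ContDiff ℝ (⊤ : ℕ∞) w)
    (hu1 : ∀ x y, u (x + 1, y) = u (x, y)) (hu2 : ∀ x y, u (x, y + 1) = u (x, y))
    (hw1 : ∀ x y, w (x + 1, y) = w (x, y)) (hw2 : ∀ x y, w (x, y + 1) = w (x, y)) :
    ∫ x in (0:ℝ)..1, ∫ y in (0:ℝ)..1,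
      (fderiv ℝ u (x, y) (1, 0) + fderiv ℝ w (x, y) (0, 1)
        + fderiv ℝ u (x, y) (1, 0) * fderiv ℝ w (x, y) (0, 1)
        - fderiv ℝ u (x, y) (0, 1) * fderiv ℝ w (x, y) (1, 0)) = 0 := by
  have hdw : ContDiff ℝ (⊤ : ℕ∞) (fderiv ℝ w) := hw.fderiv_right (by simp)
  have hdu : ContDiff ℝ (⊤ : ℕ∞) (fderiv ℝ u) := hu.fderiv_right (by simp)
  have hdw1 : ContDiff ℝ (⊤ : ℕ∞) (fun p => fderiv ℝ w p (1, 0)) := hdw.clm_apply contDiff_const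
  have hdw2 : ContDiff ℝ (⊤ : ℕ∞) (fun p => fderiv ℝ w p (0, 1)) := hdw.clm_apply contDiff_const
  have hud : Differentiable ℝ u := hu.differentiable (by simp)
  have hwd : Differentiable ℝ w := hw.differentiable (by simp)
  have hdwd : Differentiable ℝ (fderiv ℝ w) := hdw.differentiable (by simp)
  have hf : ContDiff ℝ (⊤ : ℕ∞) (fun p => u p + u p * fderiv ℝ w p (0, 1)) := hu.add (hu.mul hdw2)
  have hg : ContDiff ℝ (⊤ : ℕ∞) (fun p => w p - u p * fderiv ℝ w p (1, 0)) := hw.sub (hu.mul hdw1)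
  have pw1 : ∀ x y, fderiv ℝ w (x + 1, y) = fderiv ℝ w (x, y) := by
    intro x y
    have : (fun p => w (p + (1, 0))) = w := by
      funext ⟨x, y⟩; simp [hw1]
    have h2 := fderiv_comp_add_right (𝕜 := ℝ) (f := w) (x := (x, y)) ((1, 0) : ℝ × ℝ)
    rw [this] at h2
    rw [h2]; simp
  have pw2 : ∀ x y, fderiv ℝ w (x, y + 1) = fderiv ℝ w (x, y) := by
    intro x y
    have : (fun p => w (p + (0, 1))) = w := by
      funext ⟨x, y⟩; simp [hw2]
    have h2 := fderiv_comp_add_right (𝕜 := ℝ) (f := w) (x := (x, y)) ((0, 1) : ℝ × ℝ)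
    rw [this] at h2
    rw [h2]; simp
  have sym : ∀ p, fderiv ℝ (fderiv ℝ w) p (1, 0) (0, 1) = fderiv ℝ (fderiv ℝ w) p (0, 1) (1, 0) := by
    intro p
    have : IsSymmSndFDerivAt ℝ w p := hw.contDiffAt.isSymmSndFDerivAt (by simp only [minSmoothness_of_isRCLikeNormedField]; exact WithTop.coe_le_coe.2 (le_top : (2:ℕ∞) ≤ ⊤))
    exact this _ _
  have h := MeasureTheory.integral2_divergence_prod_of_hasFDerivAt
    (fun p => u p + u p * fderiv ℝ w p (0, 1)) (fun p => w p - u p * fderiv ℝ w p (1, 0))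
    (fderiv ℝ (fun p => u p + u p * fderiv ℝ w p (0, 1)))
    (fderiv ℝ (fun p => w p - u p * fderiv ℝ w p (1, 0))) 0 0 1 1
    hf.continuous.continuousOn hg.continuous.continuousOn
    (fun p _ => (hf.differentiable (by simp) p).hasFDerivAt)
    (fun p _ => (hg.differentiable (by simp) p).hasFDerivAt)
    (by
      apply ContinuousOn.integrableOn_compact
      · exact isCompact_uIcc.prod isCompact_uIcc
      · apply Continuous.continuousOn
        have h1 := hf.continuous_fderiv (by simp)
        have h2 := hg.continuous_fderiv (by simp)
        exact (h1.clm_apply continuous_const).add (h2.clm_apply continuous_const))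
  have e1 : ∀ y, u (1, y) = u (0, y) := fun y => by simpa using hu1 0 y
  have e2 : ∀ x, u (x, 1) = u (x, 0) := fun x => by simpa using hu2 x 0
  have e3 : ∀ y, w (1, y) = w (0, y) := fun y => by simpa using hw1 0 y
  have e4 : ∀ x, w (x, 1) = w (x, 0) := fun x => by simpa using hw2 x 0
  have e5 : ∀ y, fderiv ℝ w (1, y) = fderiv ℝ w (0, y) := fun y => by simpa using pw1 0 y
  have e6 : ∀ x, fderiv ℝ w (x, 1) = fderiv ℝ w (x, 0) := fun x => by simpa using pw2 x 0
  simp only [e1, e2, e4, e5, e6, sub_self, zero_add] at h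
  refine Eq.trans ?_ h
  congr 1; funext x; congr 1; funext y
  have k2 : HasFDerivAt (fun p => fderiv ℝ w p (0, 1))
      ((ContinuousLinearMap.apply ℝ ℝ ((0, 1) : ℝ × ℝ)).comp (fderiv ℝ (fderiv ℝ w) (x, y))) (x, y) :=
    (ContinuousLinearMap.apply ℝ ℝ ((0, 1) : ℝ × ℝ)).hasFDerivAt.comp (x, y) (hdwd (x, y)).hasFDerivAt
  have k1 : HasFDerivAt (fun p => fderiv ℝ w p (1, 0))
      ((ContinuousLinearMap.apply ℝ ℝ ((1, 0) : ℝ × ℝ)).comp (fderiv ℝ (fderiv ℝ w) (x, y))) (x, y) :=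
    (ContinuousLinearMap.apply ℝ ℝ ((1, 0) : ℝ × ℝ)).hasFDerivAt.comp (x, y) (hdwd (x, y)).hasFDerivAt
  have ku := (hud (x, y)).hasFDerivAt
  have kw := (hwd (x, y)).hasFDerivAt
  have E1 := (ku.add (ku.mul k2)).fderiv
  have E2 := (kw.sub (ku.mul k1)).fderiv
  have E1' := congrArg (fun L => L ((1, 0) : ℝ × ℝ)) E1
  have E2' := congrArg (fun L => L ((0, 1) : ℝ × ℝ)) E2
  simp only [_root_.add_apply, _root_.sub_apply,
    _root_.smul_apply, ContinuousLinearMap.comp_apply,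
    ContinuousLinearMap.apply_apply, smul_eq_mul] at E1' E2'
  have E1'' : fderiv ℝ (fun p => u p + u p * fderiv ℝ w p (0, 1)) (x, y) (1, 0) = _ := E1'
  have E2'' : fderiv ℝ (fun p => w p - u p * fderiv ℝ w p (1, 0)) (x, y) (0, 1) = _ := E2'
  rw [E1'', E2'', sym]
  ring

lemma aux_core (F : ℝ × (ℝ × ℝ) → ℝ × ℝ) (hF : ContDiff ℝ (⊤ : ℕ∞) F)
    (h0 : ∀ v, F (0, v) = v) (hadd : ∀ t s v, F (t + s, v) = F (t, F (s, v)))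
    (hper : ∀ v, F (1, v) = v)
    (hp1 : ∀ t v, F (t, v + (1, 0)) = F (t, v) + (1, 0))
    (hp2 : ∀ t v, F (t, v + (0, 1)) = F (t, v) + (0, 1)) (t : ℝ) (v : ℝ × ℝ) : F (t, v) = v := by
  have hFd : Differentiable ℝ F := hF.differentiable (by simp)
  have hFc : Continuous F := hF.continuous
  obtain ⟨H, hHdef⟩ : ∃ H : ℝ × ℝ → ℝ × ℝ, ∀ v, H v = ∫ t in (0:ℝ)..1, F (t, v) := ⟨_, fun _ => rfl⟩
  have hint : ∀ v, IntervalIntegrable (fun t => F (t, v)) MeasureTheory.volume 0 1 := fun v =>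
    (by fun_prop : Continuous fun t => F (t, v)).intervalIntegrable _ _
  have hH : ContDiff ℝ (⊤ : ℕ∞) H := by
    have : H = fun v => ∫ t in (0:ℝ)..1, F (t, v) := funext hHdef
    rw [this]
    exact aux_param_top (fun q : (ℝ × ℝ) × ℝ => F (q.2, q.1)) (hF.comp (by fun_prop))
  have hHd : Differentiable ℝ H := hH.differentiable (by simp)
  have hinv : ∀ s v, H (F (s, v)) = H v := by
    intro s v
    simp only [hHdef, ← hadd]
    rw [intervalIntegral.integral_comp_add_right (fun t => F (t, v))]
    have hP : Function.Periodic (fun t => F (t, v)) 1 := fun t => by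
      simp only [hadd, hper]
    have := hP.intervalIntegral_add_eq s 0
    simpa [add_comm] using this
  have hH1 : ∀ v, H (v + (1, 0)) = H v + (1, 0) := by
    intro v
    simp only [hHdef, hp1]
    rw [intervalIntegral.integral_add (hint v) (by simp)]; simp
  have hH2 : ∀ v, H (v + (0, 1)) = H v + (0, 1) := by
    intro v
    simp only [hHdef, hp2]
    rw [intervalIntegral.integral_add (hint v) (by simp)]; simp
  obtain ⟨a, ha⟩ : ∃ a : ℝ × ℝ → ℝ × ℝ, ∀ v, a v = fderiv ℝ F (0, v) (1, 0) := ⟨_, fun _ => rfl⟩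
  have had : ∀ v, HasDerivAt (fun s => F (s, v)) (a v) 0 := by
    intro v
    rw [ha]
    have h2 : HasDerivAt (fun t : ℝ => (t, v)) ((1 : ℝ), (0 : ℝ × ℝ)) 0 :=
      (hasDerivAt_id 0).prodMk (hasDerivAt_const 0 v)
    exact (hFd (0, v)).hasFDerivAt.comp_hasDerivAt (0:ℝ) h2
  have hker : ∀ v, fderiv ℝ H v (a v) = 0 := by
    intro v
    have h1 : HasFDerivAt H (fderiv ℝ H v) (F (0, v)) := by rw [h0]; exact (hHd v).hasFDerivAt
    have h2 := h1.comp_hasDerivAt (0:ℝ) (had v)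
    have h3 : H ∘ (fun s => F (s, v)) = fun _ => H v := by funext s; simp [hinv]
    rw [h3] at h2
    exact h2.unique (hasDerivAt_const _ _)
  have hfix : ∀ v, a v = 0 → ∀ t, F (t, v) = v := by
    intro v hv
    have hz : ∀ t, HasDerivAt (fun s => F (s, v)) 0 t := by
      intro t
      have h1 : HasFDerivAt (fun x => F (t, x)) ((fderiv ℝ F (t, v)).comp (ContinuousLinearMap.inr ℝ ℝ (ℝ × ℝ)))
          (F (0, v)) := by
        rw [h0]
        exact (hFd (t, v)).hasFDerivAt.comp v (hasFDerivAt_prodMk_right t v)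
      have h2 := h1.comp_hasDerivAt (0:ℝ) (had v)
      rw [hv, map_zero] at h2
      have h3 : ((fun x => F (t, x)) ∘ fun s => F (s, v)) = fun s => F (t + s, v) := by
        funext s; simp [hadd]
      rw [h3] at h2
      have h4 := HasDerivAt.comp_sub_const (f := fun s => F (t + s, v)) t t (by simpa using h2)
      simpa using h4
    intro t
    have := is_const_of_deriv_eq_zero (fun t => (hz t).differentiableAt) (fun t => (hz t).deriv) t 0
    simpa [h0] using this
  have hHfix : ∀ v, a v = 0 → H v = v := by
    intro v hv
    rw [hHdef]; simp [hfix v hv]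
  have hLc : Continuous (fderiv ℝ H) := hH.continuous_fderiv (by simp)
  obtain ⟨J, hJ⟩ : ∃ J : ℝ × ℝ → ℝ, ∀ v, J v = (fderiv ℝ H v (1, 0)).1 * (fderiv ℝ H v (0, 1)).2
      - (fderiv ℝ H v (0, 1)).1 * (fderiv ℝ H v (1, 0)).2 := ⟨_, fun _ => rfl⟩
  have hJc : Continuous J := by
    have : J = _ := funext hJ
    rw [this]
    have c1 : Continuous (fun v => fderiv ℝ H v (1, 0)) := hLc.clm_apply continuous_const
    have c2 : Continuous (fun v => fderiv ℝ H v (0, 1)) := hLc.clm_apply continuous_const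
    fun_prop
  have hJ0 : ∀ v, a v ≠ 0 → J v = 0 := by
    intro v hv
    have h1 := hker v
    have h2 : a v = (a v).1 • ((1, 0) : ℝ × ℝ) + (a v).2 • ((0, 1) : ℝ × ℝ) := by
      ext <;> simp
    rw [h2, map_add, map_smul, map_smul, Prod.ext_iff] at h1
    simp only [Prod.fst_add, Prod.smul_fst, smul_eq_mul, Prod.snd_add, Prod.smul_snd, Prod.fst_zero,
      Prod.snd_zero] at h1
    obtain ⟨p, q⟩ := h1
    by_contra hne
    apply hv
    rw [hJ] at hne
    ext
    · refine (mul_eq_zero.1 (?_ : (a v).1 * _ = 0)).resolve_right hne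
      linear_combination (fderiv ℝ H v (0, 1)).2 * p - (fderiv ℝ H v (0, 1)).1 * q
    · refine (mul_eq_zero.1 (?_ : (a v).2 * _ = 0)).resolve_right hne
      linear_combination (fderiv ℝ H v (1, 0)).1 * q - (fderiv ℝ H v (1, 0)).2 * p
  have hJ01 : ∀ v, ∃ n : ℤ, J v = n := by
    intro v
    by_cases hv : v ∈ closure {v | a v ≠ 0}
    · refine ⟨0, ?_⟩
      have : closure {v | a v ≠ 0} ⊆ {v | J v = 0} :=
        closure_minimal hJ0 (isClosed_eq hJc continuous_const)
      simpa using this hv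
    · refine ⟨1, ?_⟩
      have h1 : H =ᶠ[nhds v] id := by
        filter_upwards [isClosed_closure.isOpen_compl.mem_nhds hv] with x hx
        apply hHfix
        by_contra hne
        exact hx (subset_closure hne)
      rw [hJ, h1.fderiv_eq, fderiv_id]; simp
  have hconst := aux_int J hJc hJ01
  have hJ1 : J v = 1 := by
    have hu : ContDiff ℝ (⊤ : ℕ∞) (fun v => (H v).1 - v.1) := by fun_prop
    have hw : ContDiff ℝ (⊤ : ℕ∞) (fun v => (H v).2 - v.2) := by fun_prop
    have hdiv := aux_div _ _ hu hw
      (fun x y => by have := hH1 (x, y); simp at this; simp [this])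
      (fun x y => by have := hH2 (x, y); simp at this; simp [this])
      (fun x y => by have := hH1 (x, y); simp at this; simp [this])
      (fun x y => by have := hH2 (x, y); simp at this; simp [this])
    have eu : ∀ p z, fderiv ℝ (fun v => (H v).1 - v.1) p z = (fderiv ℝ H p z).1 - z.1 := by
      intro p z
      have : HasFDerivAt (fun v => (H v).1 - v.1) _ p := (hHd p).hasFDerivAt.fst.sub (hasFDerivAt_fst)
      rw [this.fderiv]; simp
    have ew : ∀ p z, fderiv ℝ (fun v => (H v).2 - v.2) p z = (fderiv ℝ H p z).2 - z.2 := by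
      intro p z
      have : HasFDerivAt (fun v => (H v).2 - v.2) _ p := (hHd p).hasFDerivAt.snd.sub (hasFDerivAt_snd)
      rw [this.fderiv]; simp
    have : ∀ x y : ℝ, (fderiv ℝ (fun v => (H v).1 - v.1) (x, y) (1, 0) + fderiv ℝ (fun v => (H v).2 - v.2) (x, y) (0, 1)
        + fderiv ℝ (fun v => (H v).1 - v.1) (x, y) (1, 0) * fderiv ℝ (fun v => (H v).2 - v.2) (x, y) (0, 1)
        - fderiv ℝ (fun v => (H v).1 - v.1) (x, y) (0, 1) * fderiv ℝ (fun v => (H v).2 - v.2) (x, y) (1, 0)) = J v - 1 := by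
      intro x y
      rw [hconst v (x, y), hJ]
      simp only [eu, ew]
      ring
    simp only [this] at hdiv
    simp at hdiv
    linarith
  apply hfix
  by_contra hne
  rw [hJ0 v hne] at hJ1
  exact zero_ne_one hJ1

theorem stmt17
    (act : Circle → Circle × Circle → Circle × Circle)
    (hone : ∀ x, act 1 x = x)
    (hmul : ∀ g h x, act (g * h) x = act g (act h x))
    (hsmooth : ContMDiff ((𝓡 1).prod ((𝓡 1).prod (𝓡 1))) ((𝓡 1).prod (𝓡 1)) (⊤ : ℕ∞)
      (fun p : Circle × (Circle × Circle) => act p.1 p.2))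
    (hnontriv : ∃ g x, act g x ≠ x) :
    ¬ ∃ x : Circle × Circle, ∀ g, act g x = x := by
  rintro ⟨x₀, hx₀⟩
  obtain ⟨g, x, hgx⟩ := hnontriv
  apply hgx
  obtain ⟨e, he⟩ : ∃ e : ℝ → Circle, ∀ t, e t = Circle.exp (2 * Real.pi * t) := ⟨_, fun _ => rfl⟩
  have hes : ContMDiff 𝓘(ℝ, ℝ) (𝓡 1) (⊤ : ℕ∞) e := by
    rw [funext he]
    exact contMDiff_circleExp.comp (contMDiff_iff_contDiff.2 (by fun_prop))
  have hesurj : ∀ z, ∃ t, e t = z := by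
    intro z
    obtain ⟨s, hs⟩ := Circle.exp_surjective z
    refine ⟨s / (2 * Real.pi), ?_⟩
    rw [he, ← hs]
    congr 1
    have := Real.pi_pos
    field_simp
  have hadd : ∀ s t, e (s + t) = e s * e t := by
    intro s t; simp only [he, mul_add, Circle.exp_add]
  have he0 : e 0 = 1 := by simp [he]
  have he1 : e 1 = 1 := by simp [he]
  obtain ⟨A, hA⟩ : ∃ A : ℝ × (ℝ × ℝ) → Circle × Circle, ∀ p, A p = act (e p.1) (e p.2.1, e p.2.2) :=
    ⟨_, fun _ => rfl⟩
  have hAs : ContMDiff 𝓘(ℝ, ℝ × (ℝ × ℝ)) ((𝓡 1).prod (𝓡 1)) (⊤ : ℕ∞) A := by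
    have c1 : ContMDiff 𝓘(ℝ, ℝ × (ℝ × ℝ)) (𝓡 1) (⊤ : ℕ∞) (fun p : ℝ × (ℝ × ℝ) => e p.1) :=
      hes.comp (contMDiff_iff_contDiff.2 (by fun_prop))
    have c2 : ContMDiff 𝓘(ℝ, ℝ × (ℝ × ℝ)) (𝓡 1) (⊤ : ℕ∞) (fun p : ℝ × (ℝ × ℝ) => e p.2.1) :=
      hes.comp (contMDiff_iff_contDiff.2 (by fun_prop))
    have c3 : ContMDiff 𝓘(ℝ, ℝ × (ℝ × ℝ)) (𝓡 1) (⊤ : ℕ∞) (fun p : ℝ × (ℝ × ℝ) => e p.2.2) :=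
      hes.comp (contMDiff_iff_contDiff.2 (by fun_prop))
    rw [funext hA]
    exact hsmooth.comp (c1.prodMk (c2.prodMk c3))
  have hcoe : ContMDiff (𝓡 1) 𝓘(ℝ, ℂ) (⊤ : ℕ∞) (fun z : Circle => (z : ℂ)) := by
    have : Fact (Module.finrank ℝ ℂ = 1 + 1) := finrank_real_complex_fact'
    exact contMDiff_coe_sphere
  have hA1 : ContDiff ℝ (⊤ : ℕ∞) (fun p => ((A p).1 : ℂ)) :=
    contMDiff_iff_contDiff.1 (hcoe.comp (contMDiff_fst.comp hAs))
  have hA2 : ContDiff ℝ (⊤ : ℕ∞) (fun p => ((A p).2 : ℂ)) :=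
    contMDiff_iff_contDiff.1 (hcoe.comp (contMDiff_snd.comp hAs))
  obtain ⟨D1, hD1, hD10, hD1e⟩ := aux_lift (fun p => (A p).1) hA1
  obtain ⟨D2, hD2, hD20, hD2e⟩ := aux_lift (fun p => (A p).2) hA2
  obtain ⟨F, hF⟩ : ∃ F : ℝ × (ℝ × ℝ) → ℝ × ℝ, ∀ p, F p = (p.2.1 + D1 p, p.2.2 + D2 p) :=
    ⟨_, fun _ => rfl⟩
  have hFs : ContDiff ℝ (⊤ : ℕ∞) F := by
    rw [funext hF]; fun_prop
  have hFc := hFs.continuous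
  have hF0 : ∀ v, F (0, v) = v := by intro v; simp [hF, hD10, hD20]
  have hFA : ∀ t v, (e (F (t, v)).1, e (F (t, v)).2) = A (t, v) := by
    intro t v
    ext1
    · simp only [hF, hadd, hD1e t v]
      rw [hA (0, v)]; simp [he0, hone, he]
    · simp only [hF, hadd, hD2e t v]
      rw [hA (0, v)]; simp [he0, hone, he]
  -- uniqueness of lifts
  have key : ∀ {X : Type} [TopologicalSpace X] [PreconnectedSpace X] (P Q : X → ℝ × ℝ),
      Continuous P → Continuous Q → (∀ x, (e (P x).1, e (P x).2) = (e (Q x).1, e (Q x).2)) →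
      ∀ x₀, P x₀ = Q x₀ → ∀ x, P x = Q x := by
    intro X _ _ P Q hP hQ h x₀ h0 x
    simp only [Prod.mk.injEq, he] at h
    ext
    · exact aux_exp_fun (fun x => (P x).1) (fun x => (Q x).1) (by fun_prop) (by fun_prop)
        (fun x => (h x).1) x₀ (by simp [h0]) x
    · exact aux_exp_fun (fun x => (P x).2) (fun x => (Q x).2) (by fun_prop) (by fun_prop)
        (fun x => (h x).2) x₀ (by simp [h0]) x
  have hFadd : ∀ t s v, F (t + s, v) = F (t, F (s, v)) := by
    intro t s v
    refine key (fun t => F (t + s, v)) (fun t => F (t, F (s, v))) (by fun_prop) (by fun_prop) ?_ 0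
      (by simp [hF0]) t
    intro t
    simp only [hFA]
    rw [hA (t, F (s, v))]
    simp only [hFA]
    simp only [hA, hadd, hmul]
  have hshift : ∀ (m : ℝ × ℝ), e m.1 = 1 → e m.2 = 1 → ∀ t v, F (t, v + m) = F (t, v) + m := by
    intro m hm1 hm2 t v
    refine key (fun t => F (t, v + m)) (fun t => F (t, v) + m) (by fun_prop) (by fun_prop) ?_ 0
      (by simp [hF0]) t
    intro t
    simp only [hFA, Prod.fst_add, Prod.snd_add, hadd, hm1, hm2, mul_one]
    simp only [hA, Prod.fst_add, Prod.snd_add, hadd, hm1, hm2, mul_one]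
  obtain ⟨p, hp⟩ := hesurj x₀.1
  obtain ⟨q, hq⟩ := hesurj x₀.2
  have hfix : ∀ t, F (t, (p, q)) = (p, q) := by
    refine key (fun t => F (t, (p, q))) (fun _ => (p, q)) (by fun_prop) (by fun_prop) ?_ 0 (hF0 _)
    intro t
    simp only [hFA, hA, hp, hq]
    exact hx₀ _
  have hper : ∀ v, F (1, v) = v := by
    refine key (fun v => F (1, v)) (fun v => v) (by fun_prop) (by fun_prop) ?_ (p, q) (hfix 1)
    intro v
    simp only [hFA, hA, he1, hone]
  obtain ⟨t, rfl⟩ := hesurj g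
  obtain ⟨a, ha⟩ := hesurj x.1
  obtain ⟨b, hb⟩ := hesurj x.2
  have hfin := aux_core F hFs hF0 hFadd hper (hshift (1, 0) he1 he0) (hshift (0, 1) he0 he1) t (a, b)
  have h1 := hFA t (a, b)
  rw [hfin, hA] at h1
  simp only [ha, hb] at h1
  exact h1.symm
end
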